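/- arXiv:2201.07618 — 2 statements merged into one kernel-verified Lean document; each statement's English description precedes it below -/
import Mathlib

section
/- Let G be a bridgeless simple graph of order n with minimum degree δ ≥ 4 and girth g = 3. Then for every real ε with 0 < ε < 1, setting L = ⌈2/ε⌉, the oriented diameter of G satisfies diam→(G) ≤ (6+ε)·n/(δ+1) + 4·binomial(3L+1, 2); in particular diam→(G) < 7n/(δ+1) + 4·binomial(3L+1,2). -/
open SimpleGraph

/-- `D` is an orientation of the simple graph `G`: every arc of `D` lies along an edge of `G`,
and every edge of `G` receives exactly one of the two possible directions. -/
def IsOrientation {V : Type*} (G : SimpleGraph V) (D : V → V → Prop) : Prop :=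
  (∀ u v, D u v → G.Adj u v) ∧ ∀ u v, G.Adj u v → (D u v ↔ ¬ D v u)

/-- There is a directed walk of length `n` from `u` to `v` in the digraph with arc relation `D`. -/
def DiReach {V : Type*} (D : V → V → Prop) (u v : V) (n : ℕ) : Prop :=
  ∃ f : Fin (n + 1) → V, f 0 = u ∧ f (Fin.last n) = v ∧
    ∀ i : Fin n, D (f i.castSucc) (f i.succ)

/-- A graph is bridgeless if it is connected and none of its edges is a bridge. -/
def Bridgeless {V : Type*} (G : SimpleGraph V) : Prop :=
  G.Connected ∧ ∀ e : Sym2 V, ¬ G.IsBridge e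

/-- `hPoly δ g = 1 + δ + ∑_{i=1}^{⌊(g-1)/2⌋ - 1} δ (δ - 3)^i`. -/
def hPoly (δ g : ℕ) : ℕ :=
  1 + δ + ∑ i ∈ Finset.Icc 1 ((g - 1) / 2 - 1), δ * (δ - 3) ^ i

/-! ### Directed walks -/

/-- `DWalk D n u v`: there is a walk of length `n` from `u` to `v` along the relation `D`. -/
def DWalk {V : Type*} (D : V → V → Prop) : ℕ → V → V → Prop
  | 0, u, v => u = v
  | n + 1, u, v => ∃ w, D u w ∧ DWalk D n w v

namespace DWalk

variable {V : Type*} {D E : V → V → Prop}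

theorem append {m n : ℕ} {u v w : V} (h : DWalk D m u v) (h' : DWalk D n v w) :
    DWalk D (m + n) u w := by
  induction m generalizing u with
  | zero => cases h; simpa using h'
  | succ m ih =>
    obtain ⟨x, hx, hxv⟩ := h
    rw [Nat.add_right_comm]
    exact ⟨x, hx, ih hxv⟩

theorem single {u v : V} (h : D u v) : DWalk D 1 u v := ⟨v, h, rfl⟩

theorem two {u v w : V} (h : D u v) (h' : D v w) : DWalk D 2 u w := ⟨v, h, w, h', rfl⟩

theorem mono (hDE : ∀ u v, D u v → E u v) {n : ℕ} {u v : V} (h : DWalk D n u v) :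
    DWalk E n u v := by
  induction n generalizing u with
  | zero => exact h
  | succ n ih =>
    obtain ⟨x, hx, hxv⟩ := h
    exact ⟨x, hDE _ _ hx, ih hxv⟩

theorem swap {n : ℕ} {u v : V} (h : DWalk D n u v) : DWalk (fun x y => D y x) n v u := by
  induction n generalizing u with
  | zero => exact h.symm
  | succ n ih =>
    obtain ⟨x, hx, hxv⟩ := h
    exact (ih hxv).append (single hx)

theorem of_fun (q : ℕ → V) {i k : ℕ} (hik : i ≤ k)
    (h : ∀ j, i ≤ j → j < k → D (q (j + 1)) (q j)) : DWalk D (k - i) (q k) (q i) := by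
  induction k, hik using Nat.le_induction with
  | base => simp [DWalk]
  | succ k hk ih =>
    rw [Nat.succ_sub hk]
    exact ⟨q k, h k hk (Nat.lt_succ_self k), ih fun j hj hjk => h j hj (by omega)⟩

theorem exists_fun {n : ℕ} {u v : V} (h : DWalk D n u v) :
    ∃ q : ℕ → V, q n = u ∧ q 0 = v ∧ ∀ j, j < n → D (q (j + 1)) (q j) := by
  induction n generalizing u with
  | zero => exact ⟨fun _ => u, rfl, h, by simp⟩
  | succ n ih =>
    obtain ⟨x, hx, hxv⟩ := h
    obtain ⟨q, hqn, hq0, hq⟩ := ih hxv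
    refine ⟨fun j => if j = n + 1 then u else q j, by simp, by simp [hq0], fun j hj => ?_⟩
    by_cases hjn : j = n
    · subst hjn; simpa [hqn] using hx
    · have h1 : j ≠ n + 1 := by omega
      simpa [hjn, h1] using hq j (by omega)

theorem diReach {n : ℕ} {u v : V} (h : DWalk D n u v) : DiReach D u v n := by
  obtain ⟨q, hqn, hq0, hq⟩ := h.exists_fun
  refine ⟨fun i => q (n - i), by simpa using hqn, by simpa using hq0, fun i => ?_⟩
  have := hq (n - (i + 1)) (by omega)
  have e : n - (i + 1 : ℕ) + 1 = n - i := by omega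
  rw [e] at this
  simpa using this

theorem of_reflTransGen {u v : V} (h : Relation.ReflTransGen D u v) : ∃ n, DWalk D n u v := by
  induction h using Relation.ReflTransGen.head_induction_on with
  | refl => exact ⟨0, rfl⟩
  | head hx _ ih =>
    obtain ⟨n, hn⟩ := ih
    exact ⟨n + 1, _, hx, hn⟩

end DWalk

/-- `DWithin D k u v`: there is a walk of length at most `k` from `u` to `v`. -/
def DWithin {V : Type*} (D : V → V → Prop) (k : ℕ) (u v : V) : Prop :=
  ∃ n ≤ k, DWalk D n u v

namespace DWithin

variable {V : Type*} {D E : V → V → Prop}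

theorem refl (u : V) (k : ℕ) : DWithin D k u u := ⟨0, Nat.zero_le _, rfl⟩

theorem trans {k l : ℕ} {u v w : V} (h : DWithin D k u v) (h' : DWithin D l v w) :
    DWithin D (k + l) u w := by
  obtain ⟨m, hm, hw⟩ := h
  obtain ⟨n, hn, hw'⟩ := h'
  exact ⟨m + n, by omega, hw.append hw'⟩

theorem le {k l : ℕ} {u v : V} (h : DWithin D k u v) (hkl : k ≤ l) : DWithin D l u v := by
  obtain ⟨m, hm, hw⟩ := h
  exact ⟨m, by omega, hw⟩

theorem mono (hDE : ∀ u v, D u v → E u v) {k : ℕ} {u v : V} (h : DWithin D k u v) :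
    DWithin E k u v := by
  obtain ⟨m, hm, hw⟩ := h
  exact ⟨m, hm, hw.mono hDE⟩

theorem swap {k : ℕ} {u v : V} (h : DWithin D k u v) : DWithin (fun x y => D y x) k v u := by
  obtain ⟨m, hm, hw⟩ := h
  exact ⟨m, hm, hw.swap⟩

end DWithin

/-! ### Geodesics to a set -/

/-- `Geo E S b q`: the sequence `q b, q (b - 1), …, q 0` is a shortest walk along `E` into `S`. -/
structure Geo {V : Type*} (E : V → V → Prop) (S : Finset V) (b : ℕ) (q : ℕ → V) : Prop where
  zero_mem : q 0 ∈ S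
  step : ∀ j, j < b → E (q (j + 1)) (q j)
  le : ∀ j, j ≤ b → ∀ n, ∀ s ∈ S, DWalk E n (q j) s → j ≤ n

namespace Geo

variable {V : Type*} {E : V → V → Prop} {S : Finset V} {b : ℕ} {q : ℕ → V}

theorem walk (h : Geo E S b q) {i j : ℕ} (hij : i ≤ j) (hj : j ≤ b) :
    DWalk E (j - i) (q j) (q i) :=
  DWalk.of_fun q hij fun l _ hl => h.step l (by omega)

theorem le_add (h : Geo E S b q) {i j n : ℕ} (hi : i ≤ b) (hj : j ≤ b)
    (hw : DWalk E n (q j) (q i)) : j ≤ n + i := by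
  have := h.walk (Nat.zero_le i) hi
  exact h.le j hj _ _ h.zero_mem (by simpa using hw.append this)

theorem inj (h : Geo E S b q) {i j : ℕ} (hi : i ≤ b) (hj : j ≤ b) (e : q i = q j) : i = j := by
  have h1 := h.le_add hi hj (n := 0) e.symm
  have h2 := h.le_add hj hi (n := 0) e
  omega

theorem notMem (h : Geo E S b q) {j : ℕ} (hj0 : 0 < j) (hj : j ≤ b) : q j ∉ S := fun hm => by
  have := h.le j hj 0 _ hm rfl
  omega

theorem restrict (h : Geo E S b q) {a : ℕ} (ha : a ≤ b) : Geo E S a q :=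
  ⟨h.zero_mem, fun j hj => h.step j (by omega), fun j hj => h.le j (by omega)⟩

theorem exists_of_walk (A : Finset V) (hA : A ⊆ S) {x s : V} {n : ℕ} (hs : s ∈ S)
    (hw : DWalk E n x s) :
    ∃ b q, Geo E S b q ∧ q b = x ∧ b ≤ n ∧
      (q 0 ∈ A ∨ ∀ j, j ≤ b → ∀ s ∈ A, ¬ DWalk E j (q j) s) := by
  classical
  have hex : ∃ n, ∃ s ∈ S, DWalk E n x s := ⟨n, s, hs, hw⟩
  obtain ⟨s₀, hs₀, hw₀⟩ := Nat.find_spec hex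
  have hmin : ∀ m, ∀ s ∈ S, DWalk E m x s → Nat.find hex ≤ m :=
    fun m s hs hm => Nat.find_min' hex ⟨s, hs, hm⟩
  have hn : Nat.find hex ≤ n := hmin n s hs hw
  generalize Nat.find hex = b at *
  obtain ⟨t, ht, htw, hpref⟩ : ∃ t ∈ S, DWalk E b x t ∧
      (t ∈ A ∨ ∀ s ∈ A, ¬ DWalk E b x s) := by
    by_cases h : ∃ t ∈ A, DWalk E b x t
    · obtain ⟨t, ht, hw⟩ := h
      exact ⟨t, hA ht, hw, .inl ht⟩
    · push Not at h
      exact ⟨s₀, hs₀, hw₀, .inr h⟩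
  obtain ⟨q, hqb, hq0, hq⟩ := htw.exists_fun
  have hwalk : ∀ j, j ≤ b → DWalk E (b - j) x (q j) := fun j hj => by
    rw [← hqb]; exact DWalk.of_fun q hj fun l _ hl => hq l hl
  refine ⟨b, q, ⟨hq0 ▸ ht, hq, fun j hj m s hs hm => ?_⟩, hqb, hn, ?_⟩
  · have := hmin _ s hs ((hwalk j hj).append hm)
    omega
  · rw [hq0]
    refine hpref.imp id fun h j hj s hs hm => h s hs ?_
    have := (hwalk j hj).append hm
    rwa [Nat.sub_add_cancel hj] at this

end Geo

/-! ### Shortening walks inside a finite set -/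

section Shorten

variable {V : Type*} {T : V → V → Prop}

theorem DWithin.of_sources {Y : Finset V} {z y : V}
    (h : Relation.ReflTransGen (fun u v => T u v ∧ u ∈ Y) z y) : DWithin T Y.card z y := by
  obtain ⟨n, hn⟩ := DWalk.of_reflTransGen h
  obtain ⟨b, q, hq, hqb, -, -⟩ :=
    Geo.exists_of_walk (S := {y}) ∅ (by simp) (Finset.mem_singleton_self y) hn
  refine ⟨b, ?_, ?_⟩
  · have : (Finset.Icc 1 b).card ≤ Y.card := by
      refine Finset.card_le_card_of_injOn q (fun j hj => ?_) fun i hi j hj e => ?_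
      · simp only [Finset.coe_Icc, Set.mem_Icc] at hj
        have := hq.step (j - 1) (by omega)
        rw [Nat.sub_add_cancel hj.1] at this
        exact this.2
      · simp only [Finset.coe_Icc, Set.mem_Icc] at hi hj
        exact hq.inj hi.2 hj.2 e
    simpa using this
  · have h0 : q 0 = y := by simpa using hq.zero_mem
    have := hq.walk (Nat.zero_le b) le_rfl
    rw [hqb, h0] at this
    exact DWalk.mono (fun _ _ h => h.1) this

theorem DWithin.of_targets {Y : Finset V} {z y : V}
    (h : Relation.ReflTransGen (fun u v => T u v ∧ v ∈ Y) z y) : DWithin T Y.card z y := by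
  have h' : Relation.ReflTransGen (fun u v => T v u ∧ u ∈ Y) y z :=
    Relation.reflTransGen_swap.mp h
  exact (DWithin.of_sources (T := fun u v => T v u) h').swap

/-- Either `z` reaches `z'` inside `X`, or a walk from `z` to `q` and a walk from `p` to `z'`
can be chosen whose total length is at most the number of vertices they are allowed to use. -/
theorem reach_or_out_add_in [DecidableEq V] {X Y Y' : Finset V} (hY : Y ⊆ X)
    (hY' : Y' ⊆ X) {p q z z' : V}
    (hz : Relation.ReflTransGen (fun u v => T u v ∧ u ∈ Y) z q)
    (hz' : Relation.ReflTransGen (fun u v => T u v ∧ v ∈ Y') p z') :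
    Relation.ReflTransGen (fun u v => T u v ∧ u ∈ X) z z' ∨
      ∃ o i, DWithin T o z q ∧ DWithin T i p z' ∧ o + i ≤ (Y ∪ Y').card := by
  classical
  set R := Relation.ReflTransGen (fun u v => T u v ∧ u ∈ X) with hR
  by_cases hd : R z z'
  · exact .inl hd
  right
  have h1 : Relation.ReflTransGen (fun u v => T u v ∧ u ∈ Y.filter (R z)) z q := by
    have key : ∀ y, Relation.ReflTransGen (fun u v => T u v ∧ u ∈ Y) z y →
        Relation.ReflTransGen (fun u v => T u v ∧ u ∈ Y.filter (R z)) z y ∧ R z y := by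
      intro y hy
      induction hy with
      | refl => exact ⟨.refl, .refl⟩
      | tail _ hbc ih =>
        exact ⟨ih.1.tail ⟨hbc.1, Finset.mem_filter.mpr ⟨hbc.2, ih.2⟩⟩,
          ih.2.tail ⟨hbc.1, hY hbc.2⟩⟩
    exact (key q hz).1
  have h2 : Relation.ReflTransGen (fun u v => T u v ∧ v ∈ Y'.filter (R · z')) p z' := by
    have key : ∀ y, Relation.ReflTransGen (fun u v => T u v ∧ v ∈ Y') y z' →
        Relation.ReflTransGen (fun u v => T u v ∧ v ∈ Y'.filter (R · z')) y z' ∧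
          (y ∈ X → R y z') := by
      intro y hy
      induction hy using Relation.ReflTransGen.head_induction_on with
      | refl => exact ⟨.refl, fun _ => .refl⟩
      | head hbc _ ih =>
        exact ⟨ih.1.head ⟨hbc.1, Finset.mem_filter.mpr ⟨hbc.2, ih.2 (hY' hbc.2)⟩⟩,
          fun hy => (ih.2 (hY' hbc.2)).head ⟨hbc.1, hy⟩⟩
    exact (key p hz').1
  refine ⟨_, _, DWithin.of_sources h1, DWithin.of_targets h2, ?_⟩
  rw [← Finset.card_union_of_disjoint]
  · exact Finset.card_le_card (Finset.union_subset_union (Finset.filter_subset _ _)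
      (Finset.filter_subset _ _))
  · rw [Finset.disjoint_left]
    intro y hy hy'
    exact hd ((Finset.mem_filter.mp hy).2.trans (Finset.mem_filter.mp hy').2)

end Shorten

/-! ### Partial orientations with few vertices per center -/

/-- Two vertices are near if their closed neighbourhoods meet. -/
def Near {V : Type*} (G : SimpleGraph V) (u v : V) : Prop :=
  u = v ∨ G.Adj u v ∨ ∃ w, G.Adj u w ∧ G.Adj w v

theorem Near.symm {V : Type*} {G : SimpleGraph V} {u v : V} (h : Near G u v) : Near G v u := by
  rcases h with h | h | ⟨w, h, h'⟩
  · exact .inl h.symm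
  · exact .inr (.inl h.symm)
  · exact .inr (.inr ⟨w, h'.symm, h.symm⟩)

/-- A strongly connected partial orientation `D` on `S` with a set `A` of pairwise non-near
centers, where walk lengths are measured after adding the penalties `α` (at the source) and
`β` (at the target), and are bounded by `B`. -/
structure Core {V : Type*} (G : SimpleGraph V) (L : ℕ) (S A : Finset V) (D : V → V → Prop)
    (α β : V → ℕ) (B : ℕ) : Prop where
  subset : A ⊆ S
  packing : ∀ a ∈ A, ∀ a' ∈ A, a ≠ a' → ¬ Near G a a'
  adj : ∀ u v, D u v → G.Adj u v
  left_mem : ∀ u v, D u v → u ∈ S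
  right_mem : ∀ u v, D u v → v ∈ S
  asymm : ∀ u v, D u v → ¬ D v u
  center_out : ∀ a ∈ A, α a = 2
  center_in : ∀ a ∈ A, β a = 2
  slack : ∀ z ∈ S, 1 ≤ α z ∨ 1 ≤ β z
  six_le : 6 ≤ B
  bound : L * B ≤ (6 * L + 2) * A.card
  dist : ∀ u ∈ S, ∀ v ∈ S, ∃ k, DWithin D k u v ∧ k + α u + β v ≤ B

namespace Core

variable {V : Type*} {G : SimpleGraph V} {L : ℕ} {S A : Finset V} {D : V → V → Prop}
  {α β : V → ℕ} {B : ℕ}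

theorem swap (h : Core G L S A D α β B) : Core G L S A (fun x y => D y x) β α B where
  subset := h.subset
  packing := h.packing
  adj u v huv := (h.adj v u huv).symm
  left_mem u v huv := h.right_mem v u huv
  right_mem u v huv := h.left_mem v u huv
  asymm u v huv := h.asymm v u huv
  center_out := h.center_in
  center_in := h.center_out
  slack z hz := (h.slack z hz).symm
  six_le := h.six_le
  bound := h.bound
  dist u hu v hv := by
    obtain ⟨k, hk, hb⟩ := h.dist v hv u hu
    exact ⟨k, hk.swap, by omega⟩

theorem singleton (G : SimpleGraph V) {L : ℕ} (s : V) :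
    Core G L {s} {s} (fun _ _ => False) (fun _ => 2) (fun _ => 2) 6 where
  subset := subset_rfl
  packing a ha a' ha' hne := by simp_all
  adj _ _ h := h.elim
  left_mem _ _ h := h.elim
  right_mem _ _ h := h.elim
  asymm _ _ h := h.elim
  center_out _ _ := rfl
  center_in _ _ := rfl
  slack _ _ := by simp
  six_le := le_rfl
  bound := by simp; nlinarith
  dist u hu v hv := by
    rw [Finset.mem_singleton] at hu hv
    subst hu hv
    exact ⟨0, .refl _ _, by omega⟩

/-- Adding to a core a set `X` of new vertices, oriented by `T`, entered from `p` and left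
to `q`. -/
theorem extend [DecidableEq V] (h : Core G L S A D α β B) {X C : Finset V} {T : V → V → Prop}
    {a b : V → ℕ} {p q : V} {R : ℕ} (hp : p ∈ S) (hq : q ∈ S) (hXS : Disjoint S X)
    (hCX : C ⊆ X) (hC : L ≤ C.card) (hR : R = 6 * C.card + 2)
    (hCC : ∀ c ∈ C, ∀ c' ∈ C, c ≠ c' → ¬ Near G c c') (hCA : ∀ c ∈ C, ∀ s ∈ A, ¬ Near G c s)
    (hTadj : ∀ u v, T u v → G.Adj u v) (hTl : ∀ u v, T u v → u ∈ S ∪ X)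
    (hTr : ∀ u v, T u v → v ∈ S ∪ X) (hTX : ∀ u v, T u v → u ∈ X ∨ v ∈ X)
    (hTs : ∀ u v, T u v → ¬ T v u)
    (haC : ∀ c ∈ C, a c = 2) (hbC : ∀ c ∈ C, b c = 2) (ha : ∀ z ∈ X, a z ≤ 2)
    (hb : ∀ z ∈ X, b z ≤ 2) (hb1 : ∀ z ∈ X, 1 ≤ b z) (hX : X.card ≤ R + 2)
    (hout : ∀ z ∈ X, ∃ Y : Finset V, Relation.ReflTransGen (fun u v => T u v ∧ u ∈ Y) z q ∧
      Y.card + a z ≤ R + α q)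
    (hin : ∀ z ∈ X, ∃ Y : Finset V, Relation.ReflTransGen (fun u v => T u v ∧ v ∈ Y) p z ∧
      Y.card + b z ≤ R + β p)
    (hpair : ∀ z ∈ X, ∀ z' ∈ X, Relation.ReflTransGen (fun u v => T u v ∧ u ∈ X) z z' ∨
      ∃ Y ⊆ X, ∃ Y' ⊆ X, Relation.ReflTransGen (fun u v => T u v ∧ u ∈ Y) z q ∧
        Relation.ReflTransGen (fun u v => T u v ∧ v ∈ Y') p z' ∧
        (Y ∪ Y').card + a z + b z' ≤ R + α q + β p) :
    ∃ A' D' α' β' B', Core G L (S ∪ X) A' D' α' β' B' := by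
  have hXnS : ∀ z ∈ X, z ∉ S := fun z hz hzS => Finset.disjoint_left.mp hXS hzS hz
  have hCS : ∀ c ∈ C, c ∉ S := fun c hc => hXnS c (hCX hc)
  refine ⟨A ∪ C, fun u v => D u v ∨ T u v, fun z => if z ∈ S then α z else a z,
    fun z => if z ∈ S then β z else b z, B + R, ?_⟩
  have hmonoD : ∀ {k u v}, DWithin D k u v → DWithin (fun u v => D u v ∨ T u v) k u v :=
    fun hk => hk.mono fun _ _ => Or.inl
  have hmonoT : ∀ {k u v}, DWithin T k u v → DWithin (fun u v => D u v ∨ T u v) k u v :=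
    fun hk => hk.mono fun _ _ => Or.inr
  refine ⟨Finset.union_subset_union h.subset hCX, ?_, ?_, ?_, ?_, ?_, ?_, ?_, ?_, ?_, ?_, ?_⟩
  · intro x hx y hy hne
    rcases Finset.mem_union.mp hx with hx | hx <;> rcases Finset.mem_union.mp hy with hy | hy
    · exact h.packing x hx y hy hne
    · exact fun hn => hCA y hy x hx hn.symm
    · exact hCA x hx y hy
    · exact hCC x hx y hy hne
  · rintro u v (huv | huv)
    exacts [h.adj u v huv, hTadj u v huv]
  · rintro u v (huv | huv)
    exacts [Finset.mem_union_left _ (h.left_mem u v huv), hTl u v huv]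
  · rintro u v (huv | huv)
    exacts [Finset.mem_union_left _ (h.right_mem u v huv), hTr u v huv]
  · rintro u v (huv | huv) (hvu | hvu)
    · exact h.asymm u v huv hvu
    · rcases hTX v u hvu with hx | hx
      exacts [hXnS _ hx (h.right_mem u v huv), hXnS _ hx (h.left_mem u v huv)]
    · rcases hTX u v huv with hx | hx
      exacts [hXnS _ hx (h.right_mem v u hvu), hXnS _ hx (h.left_mem v u hvu)]
    · exact hTs u v huv hvu
  · intro x hx
    rcases Finset.mem_union.mp hx with hx | hx
    · simp [h.subset hx, h.center_out x hx]
    · simp [hCS x hx, haC x hx]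
  · intro x hx
    rcases Finset.mem_union.mp hx with hx | hx
    · simp [h.subset hx, h.center_in x hx]
    · simp [hCS x hx, hbC x hx]
  · intro z hz
    by_cases hzS : z ∈ S
    · simpa [hzS] using h.slack z hzS
    · have hzX := (Finset.mem_union.mp hz).resolve_left hzS
      simp [hzS, hb1 z hzX]
  · have := h.six_le
    omega
  · rw [Finset.card_union_of_disjoint]
    · have := h.bound
      subst hR
      nlinarith
    · rw [Finset.disjoint_left]
      exact fun x hx hx' => hCS x hx' (h.subset hx)
  · intro u hu v hv
    have h6 := h.six_le
    by_cases huS : u ∈ S <;> by_cases hvS : v ∈ S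
    · obtain ⟨k, hk, hle⟩ := h.dist u huS v hvS
      exact ⟨k, hmonoD hk, by simp [huS, hvS]; omega⟩
    · have hvX := (Finset.mem_union.mp hv).resolve_left hvS
      obtain ⟨k, hk, hle⟩ := h.dist u huS p hp
      obtain ⟨Y, hY, hYle⟩ := hin v hvX
      exact ⟨k + Y.card, (hmonoD hk).trans (hmonoT (.of_targets hY)), by
        simp [huS, hvS]; omega⟩
    · have huX := (Finset.mem_union.mp hu).resolve_left huS
      obtain ⟨k, hk, hle⟩ := h.dist q hq v hvS
      obtain ⟨Y, hY, hYle⟩ := hout u huX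
      exact ⟨Y.card + k, (hmonoT (.of_sources hY)).trans (hmonoD hk), by
        simp [huS, hvS]; omega⟩
    · have huX := (Finset.mem_union.mp hu).resolve_left huS
      have hvX := (Finset.mem_union.mp hv).resolve_left hvS
      have direct : Relation.ReflTransGen (fun u v => T u v ∧ u ∈ X) u v →
          ∃ k, DWithin (fun u v => D u v ∨ T u v) k u v ∧ k + a u + b v ≤ B + R := by
        intro hr
        have h1 := ha u huX
        have h2 := hb v hvX
        exact ⟨X.card, hmonoT (.of_sources hr), by omega⟩
      simp only [huS, hvS, if_false]
      rcases hpair u huX v hvX with hr | ⟨Y, hYX, Y', hYX', hu', hv', hle⟩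
      · exact direct hr
      · rcases reach_or_out_add_in hYX hYX' hu' hv' with hr | ⟨o, i, ho, hi, hoi⟩
        · exact direct hr
        · obtain ⟨k, hk, hkle⟩ := h.dist q hq p hp
          exact ⟨o + k + i, ((hmonoT ho).trans (hmonoD hk)).trans (hmonoT hi), by omega⟩

end Core

/-! ### Selecting spread-out indices -/

theorem exists_spread_subset (I : Finset ℕ) :
    ∃ C ⊆ I, I.card ≤ 3 * C.card ∧ 3 * C.card ≤ I.card + 2 ∧
      (∀ c ∈ C, ∀ d ∈ C, c < d → c + 3 ≤ d ∧ ∃ l ∈ I, c < l ∧ l < d) ∧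
      (I.card = 3 * C.card → ∀ c ∈ C, ∃ l ∈ I, c < l) := by
  set f := I.orderEmbOfFin rfl with hf
  have hmem : ∀ i, f i ∈ I := fun i => Finset.orderEmbOfFin_mem I rfl i
  have hgap : ∀ i j : Fin I.card, i ≤ j → f i + (j - i : ℕ) ≤ f j := by
    rintro ⟨i, hi⟩ ⟨j, hj⟩ hij
    simp only [Fin.mk_le_mk] at hij
    induction j, hij using Nat.le_induction with
    | base => simp
    | succ j hij ih =>
      have h1 := ih (by omega)
      have h2 : f ⟨j, by omega⟩ < f ⟨j + 1, hj⟩ := f.strictMono (by simp)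
      simp only at h1 ⊢
      omega
  let g : Fin ((I.card + 2) / 3) ↪ ℕ :=
    ⟨fun k => f ⟨3 * k, by omega⟩, fun k l h => by
      have := f.injective h
      simp only [Fin.mk.injEq] at this
      exact Fin.ext (by omega)⟩
  have hcard : (Finset.univ.map g).card = (I.card + 2) / 3 := by simp
  refine ⟨Finset.univ.map g, ?_, by omega, by omega, ?_, ?_⟩
  · intro c hc
    obtain ⟨k, -, rfl⟩ := Finset.mem_map.mp hc
    exact hmem _
  · intro c hc d hd hcd
    obtain ⟨k, -, rfl⟩ := Finset.mem_map.mp hc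
    obtain ⟨l, -, rfl⟩ := Finset.mem_map.mp hd
    have hlt : 3 * (k : ℕ) < 3 * l := by
      have := f.lt_iff_lt.mp hcd
      simpa using this
    have h1 := hgap ⟨3 * k, by omega⟩ ⟨3 * l, by omega⟩ (by simp; omega)
    refine ⟨?_, f ⟨3 * k + 1, by omega⟩, hmem _, f.strictMono (by simp), f.strictMono ?_⟩
    · change f ⟨3 * k, by omega⟩ + 3 ≤ f ⟨3 * l, by omega⟩
      simp only at h1
      omega
    · simp only [Fin.mk_lt_mk]
      omega
  · intro h c hc
    obtain ⟨k, -, rfl⟩ := Finset.mem_map.mp hc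
    exact ⟨f ⟨3 * k + 1, by omega⟩, hmem _, f.strictMono (by simp)⟩

/-! ### A pair of geodesics leaving a set -/

theorem Near.exists_walk {V : Type*} {G : SimpleGraph V} {u v : V} (h : Near G u v) :
    ∃ n ≤ 2, DWalk G.Adj n u v := by
  rcases h with h | h | ⟨w, h, h'⟩
  · exact ⟨0, by omega, h⟩
  · exact ⟨1, by omega, .single h⟩
  · exact ⟨2, le_rfl, .two h h'⟩

section Chain

variable {V : Type*} {r : V → V → Prop} {f : ℕ → V}

theorem reflTransGen_chain_up {i k : ℕ} (hik : i ≤ k)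
    (h : ∀ j, i ≤ j → j < k → r (f j) (f (j + 1))) : Relation.ReflTransGen r (f i) (f k) := by
  induction k, hik using Nat.le_induction with
  | base => exact .refl
  | succ k hk ih => exact (ih fun j hj hjk => h j hj (by omega)).tail (h k hk k.lt_succ_self)

theorem reflTransGen_chain_down {i k : ℕ} (hik : i ≤ k)
    (h : ∀ j, i ≤ j → j < k → r (f (j + 1)) (f j)) : Relation.ReflTransGen r (f k) (f i) :=
  Relation.reflTransGen_swap.mp (reflTransGen_chain_up (r := Function.swap r) hik h)

end Chain

/-- The arcs of `G` in both directions, except for the downward arcs of the path `p`. -/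
def upward {V : Type*} (G : SimpleGraph V) (p : ℕ → V) (a : ℕ) (x y : V) : Prop :=
  G.Adj x y ∧ ¬ ∃ i < a, x = p (i + 1) ∧ y = p i

theorem Geo.upward_path {V : Type*} {G : SimpleGraph V} {S : Finset V} {a : ℕ} {p : ℕ → V}
    (h : Geo G.Adj S a p) {i : ℕ} (hi : i < a) :
    upward G p a (p i) (p (i + 1)) := by
  refine ⟨(h.step i hi).symm, ?_⟩
  rintro ⟨j, hj, h1, h2⟩
  have e1 := h.inj (by omega) (by omega) h1
  have e2 := h.inj (by omega) (by omega) h2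
  omega

/-- A shortest path `p 0, …, p a` leaving `S` and a shortest way `q b = p a, …, q 0` back to `S`
which does not use the downward arcs of `p`. -/
structure EarPair {V : Type*} (G : SimpleGraph V) (L : ℕ) (S A : Finset V) (a b hp hq : ℕ)
    (p q : ℕ → V) : Prop where
  one_le : 1 ≤ L
  subset : A ⊆ S
  geo_p : Geo G.Adj S a p
  geo_q : Geo (upward G p a) S b q
  top : q b = p a
  len : a + hp = 3 * L
  case_p : (hp = 0 ∧ p 0 ∈ A) ∨ (hp = 1 ∧ ∀ i ≤ a, ∀ s ∈ A, ¬ DWalk G.Adj i (p i) s)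
  case_q : hq = 0 ∨ (hq = 1 ∧ ∀ j ≤ b, ∀ s ∈ A, ¬ DWalk (upward G p a) j (q j) s)

section EarDefs

variable {V : Type*} [DecidableEq V]

/-- The vertices of the path `p` outside its starting point. -/
def pathSet (p : ℕ → V) (a : ℕ) : Finset V := (Finset.Icc 1 a).image p

/-- The indices of the inner vertices of `q` which do not lie on `p`. -/
def privateIdx (p q : ℕ → V) (a b : ℕ) : Finset ℕ :=
  (Finset.Icc 1 b).filter fun j => q j ∉ pathSet p a

/-- The private indices preceded by at least `2 - hq` private indices. -/
def lateIdx (p q : ℕ → V) (a b hq : ℕ) : Finset ℕ :=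
  (privateIdx p q a b).filter fun j => 2 ≤ ((privateIdx p q a b).filter (· < j)).card + hq

open Classical in
/-- The late indices whose vertices are not near a center. -/
noncomputable def freeIdx (G : SimpleGraph V) (A : Finset V) (p q : ℕ → V) (a b hq : ℕ) :
    Finset ℕ :=
  (lateIdx p q a b hq).filter fun j => ∀ s ∈ A, ¬ Near G (q j) s

open Classical in
/-- The late indices whose vertices are near a center. -/
noncomputable def blockedIdx (G : SimpleGraph V) (A : Finset V) (p q : ℕ → V) (a b hq : ℕ) :
    Finset ℕ :=
  (lateIdx p q a b hq).filter fun j => ¬ ∀ s ∈ A, ¬ Near G (q j) s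

end EarDefs

namespace EarPair

variable {V : Type*} {G : SimpleGraph V} {L : ℕ} {S A : Finset V} {a b hp hq : ℕ} {p q : ℕ → V}

theorem hp_le (h : EarPair G L S A a b hp hq p q) : hp ≤ 1 := by
  rcases h.case_p with h | h <;> omega

theorem hq_le (h : EarPair G L S A a b hp hq p q) : hq ≤ 1 := by
  rcases h.case_q with h | h <;> omega

theorem two_le (h : EarPair G L S A a b hp hq p q) : 2 ≤ a := by
  have := h.hp_le
  have := h.one_le
  have := h.len
  omega

theorem b_pos (h : EarPair G L S A a b hp hq p q) : 0 < b := by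
  rcases Nat.eq_zero_or_pos b with hb | hb
  · have h1 := h.geo_q.zero_mem
    have h2 := h.top
    rw [hb] at h2
    rw [h2] at h1
    exact absurd h1 (h.geo_p.notMem (by have := h.two_le; omega) le_rfl)
  · exact hb

theorem not_upward (_ : EarPair G L S A a b hp hq p q) {i : ℕ} (hi : i < a) :
    ¬ upward G p a (p (i + 1)) (p i) := fun h => h.2 ⟨i, hi, rfl, rfl⟩

theorem not_near_path (h : EarPair G L S A a b hp hq p q) {i j : ℕ} (hj : j ≤ a)
    (hij : i + 3 ≤ j) : ¬ Near G (p j) (p i) := by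
  intro hn
  obtain ⟨n, hn2, hw⟩ := hn.exists_walk
  have := h.geo_p.le_add (by omega) hj hw
  omega

theorem not_near_center_path (h : EarPair G L S A a b hp hq p q) {i : ℕ} (hi : i ≤ a)
    (hi3 : 3 ≤ i + hp) {s : V} (hs : s ∈ A) : ¬ Near G (p i) s := by
  intro hn
  obtain ⟨n, hn2, hw⟩ := hn.exists_walk
  have h1 := h.geo_p.le i hi n s (h.subset hs) hw
  rcases h.case_p with ⟨h0, -⟩ | ⟨h0, h2⟩
  · omega
  · obtain rfl : n = i := by omega
    exact h2 n hi s hs hw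

variable [DecidableEq V]

theorem mem_pathSet {x : V} : x ∈ pathSet p a ↔ ∃ i, 1 ≤ i ∧ i ≤ a ∧ p i = x := by
  simp [pathSet, and_assoc]

theorem mem_privateIdx {j : ℕ} :
    j ∈ privateIdx p q a b ↔ (1 ≤ j ∧ j ≤ b) ∧ q j ∉ pathSet p a := by
  simp [privateIdx]

theorem p_mem {i : ℕ} (hi : 1 ≤ i) (hia : i ≤ a) : p i ∈ pathSet p a :=
  mem_pathSet.mpr ⟨i, hi, hia, rfl⟩

theorem lt_b (h : EarPair G L S A a b hp hq p q) {j : ℕ} (hj : j ∈ privateIdx p q a b) :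
    j < b := by
  obtain ⟨⟨h1, h2⟩, h3⟩ := mem_privateIdx.mp hj
  refine lt_of_le_of_ne h2 ?_
  rintro rfl
  exact h3 (h.top ▸ p_mem (by have := h.two_le; omega) le_rfl)

theorem card_pathSet (h : EarPair G L S A a b hp hq p q) : (pathSet p a).card = a := by
  rw [pathSet, Finset.card_image_of_injOn]
  · simp
  · intro i hi j hj e
    simp only [Finset.coe_Icc, Set.mem_Icc] at hi hj
    exact h.geo_p.inj hi.2 hj.2 e

theorem card_image_private (h : EarPair G L S A a b hp hq p q) {J : Finset ℕ}
    (hJ : J ⊆ privateIdx p q a b) : (J.image q).card = J.card := by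
  refine Finset.card_image_of_injOn fun i hi j hj e => ?_
  exact h.geo_q.inj (mem_privateIdx.mp (hJ hi)).1.2 (mem_privateIdx.mp (hJ hj)).1.2 e

theorem card_union_private (h : EarPair G L S A a b hp hq p q) {J : Finset ℕ}
    (hJ : J ⊆ privateIdx p q a b) : (pathSet p a ∪ J.image q).card = a + J.card := by
  rw [Finset.card_union_of_disjoint, h.card_pathSet, h.card_image_private hJ]
  rw [Finset.disjoint_right]
  intro x hx
  obtain ⟨j, hj, rfl⟩ := Finset.mem_image.mp hx
  exact (mem_privateIdx.mp (hJ hj)).2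

theorem ne_path (h : EarPair G L S A a b hp hq p q) {i j : ℕ} (hj : j ∈ privateIdx p q a b)
    (hi : i ≤ a) : q j ≠ p i := by
  obtain ⟨⟨h1, h2⟩, h3⟩ := mem_privateIdx.mp hj
  rcases Nat.eq_zero_or_pos i with rfl | h0
  · exact fun e => h.geo_q.notMem h1 h2 (e ▸ h.geo_p.zero_mem)
  · exact fun e => h3 (e ▸ p_mem h0 hi)

theorem upward_of_private_left (h : EarPair G L S A a b hp hq p q) {j : ℕ} {y : V}
    (hj : j ∈ privateIdx p q a b) (hy : G.Adj (q j) y) : upward G p a (q j) y :=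
  ⟨hy, fun ⟨_, hi, h1, _⟩ => h.ne_path hj (by omega) h1⟩

theorem upward_of_private_right (h : EarPair G L S A a b hp hq p q) {j : ℕ} {y : V}
    (hj : j ∈ privateIdx p q a b) (hy : G.Adj y (q j)) : upward G p a y (q j) :=
  ⟨hy, fun ⟨_, hi, _, h1⟩ => h.ne_path hj (by omega) h1⟩

theorem not_near_private (h : EarPair G L S A a b hp hq p q) {i j : ℕ}
    (hi : i ∈ privateIdx p q a b) (hj : j ∈ privateIdx p q a b) (hij : i + 3 ≤ j) :
    ¬ Near G (q j) (q i) := by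
  have hib := h.lt_b hi
  have hjb := h.lt_b hj
  rintro (e | e | ⟨w, e, e'⟩)
  · have := h.geo_q.inj hjb.le hib.le e
    omega
  · have := h.geo_q.le_add hib.le hjb.le (.single (h.upward_of_private_left hj e))
    omega
  · have := h.geo_q.le_add hib.le hjb.le
      (.two (h.upward_of_private_left hj e) (h.upward_of_private_right hi e'))
    omega

theorem mem_freeIdx {j : ℕ} : j ∈ freeIdx G A p q a b hq ↔
    j ∈ lateIdx p q a b hq ∧ ∀ s ∈ A, ¬ Near G (q j) s := by
  simp [freeIdx]

theorem mem_blockedIdx {j : ℕ} : j ∈ blockedIdx G A p q a b hq ↔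
    j ∈ lateIdx p q a b hq ∧ ∃ s ∈ A, Near G (q j) s := by
  simp [blockedIdx]

theorem lateIdx_subset : lateIdx p q a b hq ⊆ privateIdx p q a b := Finset.filter_subset _ _

theorem freeIdx_subset : freeIdx G A p q a b hq ⊆ privateIdx p q a b := fun _ hj =>
  lateIdx_subset (mem_freeIdx.mp hj).1

theorem blockedIdx_subset : blockedIdx G A p q a b hq ⊆ privateIdx p q a b := fun _ hj =>
  lateIdx_subset (mem_blockedIdx.mp hj).1

theorem exists_private_lt (h : EarPair G L S A a b hp hq p q) {j : ℕ}
    (hj : j ∈ lateIdx p q a b hq) : ∃ i ∈ privateIdx p q a b, i < j := by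
  have h1 := (Finset.mem_filter.mp hj).2
  have h2 := h.hq_le
  obtain ⟨i, hi⟩ := Finset.card_pos.mp
    (show 0 < ((privateIdx p q a b).filter (· < j)).card by omega)
  exact ⟨i, Finset.mem_filter.mp hi⟩

theorem adj_of_blocked (h : EarPair G L S A a b hp hq p q) {j : ℕ}
    (hj : j ∈ blockedIdx G A p q a b hq) : hp = 0 ∧ G.Adj (q j) (p 1) := by
  obtain ⟨hj1, s, hs, hn⟩ := mem_blockedIdx.mp hj
  obtain ⟨hj3, hj4⟩ := Finset.mem_filter.mp hj1
  have hjb := h.lt_b hj3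
  have hj3' : 3 ≤ j + hq := by
    have : ((privateIdx p q a b).filter (· < j)).card ≤ (Finset.Ico 1 j).card := by
      refine Finset.card_le_card fun i hi => ?_
      obtain ⟨h1, h2⟩ := Finset.mem_filter.mp hi
      have := (mem_privateIdx.mp h1).1
      simp only [Finset.mem_Ico]
      omega
    have h1 := (mem_privateIdx.mp hj3).1
    simp only [Nat.card_Ico] at this
    omega
  have key : ∀ n ≤ 2, ¬ DWalk (upward G p a) n (q j) s := by
    intro n hn hw
    have h1 := h.geo_q.le j hjb.le n s (h.subset hs) hw
    rcases h.case_q with h0 | ⟨h0, h2⟩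
    · omega
    · obtain rfl : n = j := by omega
      exact h2 n hjb.le s hs hw
  rcases hn with e | e | ⟨w, e, e'⟩
  · exact absurd e (key 0 (by omega))
  · exact absurd (.single (h.upward_of_private_left hj3 e)) (key 1 (by omega))
  · have hup := h.upward_of_private_left hj3 e
    by_cases hw : upward G p a w s
    · exact absurd (.two hup hw) (key 2 le_rfl)
    · have : ∃ i < a, w = p (i + 1) ∧ s = p i := by
        by_contra hc
        exact hw ⟨e', hc⟩
      obtain ⟨i, hi, rfl, rfl⟩ := this
      obtain rfl : i = 0 := by
        by_contra h0
        exact h.geo_p.notMem (by omega) hi.le (h.subset hs)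
      refine ⟨?_, e⟩
      rcases h.case_p with h0 | ⟨-, h0⟩
      · exact h0.1
      · exact absurd rfl (h0 0 (Nat.zero_le _) _ hs)

theorem blocked_le_add_two (h : EarPair G L S A a b hp hq p q) {i j : ℕ}
    (hi : i ∈ blockedIdx G A p q a b hq) (hj : j ∈ blockedIdx G A p q a b hq) : j ≤ i + 2 := by
  have hi' := blockedIdx_subset hi
  have hj' := blockedIdx_subset hj
  have := h.geo_q.le_add (h.lt_b hi').le (h.lt_b hj').le
    (.two (h.upward_of_private_left hj' (h.adj_of_blocked hj).2)
      (h.upward_of_private_right hi' (h.adj_of_blocked hi).2.symm))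
  omega

theorem card_filter_private_le (h : EarPair G L S A a b hp hq p q) (Q : ℕ → Prop)
    [DecidablePred Q] :
    ((privateIdx p q a b).filter Q).card + hq ≤
      2 + ((freeIdx G A p q a b hq).filter Q).card +
        ((blockedIdx G A p q a b hq).filter Q).card := by
  have hq1 := h.hq_le
  set low := (privateIdx p q a b).filter
    fun j => ((privateIdx p q a b).filter (· < j)).card + hq < 2 with hlow
  have h1 : low.card ≤ 2 - hq := by
    rw [← Finset.card_range (2 - hq)]
    refine Finset.card_le_card_of_injOn
      (fun j => ((privateIdx p q a b).filter (· < j)).card) (fun j hj => ?_) ?_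
    · have := (Finset.mem_filter.mp hj).2
      simp only [Finset.coe_range, Set.mem_Iio]
      omega
    · have key : ∀ i ∈ privateIdx p q a b, ∀ j, i < j →
          ((privateIdx p q a b).filter (· < i)).card <
            ((privateIdx p q a b).filter (· < j)).card := by
        intro i hi j hij
        refine Finset.card_lt_card (Finset.ssubset_iff_of_subset (fun l hl => ?_) |>.mpr
          ⟨i, by simp [hi, hij], by simp⟩)
        simp only [Finset.mem_filter] at hl ⊢
        exact ⟨hl.1, by omega⟩
      intro i hi j hj e
      simp only at e
      rcases lt_trichotomy i j with hlt | heq | hlt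
      · have := key i (Finset.mem_filter.mp hi).1 j hlt
        omega
      · exact heq
      · have := key j (Finset.mem_filter.mp hj).1 i hlt
        omega
  have h2 : (privateIdx p q a b).filter Q ⊆
      low ∪ (freeIdx G A p q a b hq).filter Q ∪ (blockedIdx G A p q a b hq).filter Q := by
    intro j hj
    simp only [Finset.mem_filter, Finset.mem_union, hlow, mem_freeIdx, mem_blockedIdx, lateIdx]
      at hj ⊢
    by_cases hc : 2 ≤ ((privateIdx p q a b).filter (· < j)).card + hq
    · by_cases hd : ∃ s ∈ A, Near G (q j) s
      · exact .inr ⟨⟨⟨hj.1, hc⟩, hd⟩, hj.2⟩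
      · push Not at hd
        exact .inl (.inr ⟨⟨⟨hj.1, hc⟩, hd⟩, hj.2⟩)
    · exact .inl (.inl ⟨hj.1, by omega⟩)
  have h3 := Finset.card_le_card h2
  have h4 := Finset.card_union_le (low ∪ (freeIdx G A p q a b hq).filter Q)
    ((blockedIdx G A p q a b hq).filter Q)
  have h5 := Finset.card_union_le low ((freeIdx G A p q a b hq).filter Q)
  omega

end EarPair

namespace EarPair

variable {V : Type*} {G : SimpleGraph V} {L : ℕ} {S A : Finset V}
  {a b hp hq : ℕ} {p q : ℕ → V} {D : V → V → Prop} {α β : V → ℕ} {B : ℕ}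

/-- The arcs going up along `p` and down along `q`. -/
def plainArc {V : Type*} (p q : ℕ → V) (a b : ℕ) (u v : V) : Prop :=
  (∃ i < a, u = p i ∧ v = p (i + 1)) ∨ ∃ j < b, u = q (j + 1) ∧ v = q j

theorem upward_of_plainArc (h : EarPair G L S A a b hp hq p q) {u v : V}
    (huv : plainArc p q a b u v) : upward G p a u v := by
  rcases huv with ⟨i, hi, rfl, rfl⟩ | ⟨j, hj, rfl, rfl⟩
  · exact h.geo_p.upward_path hi
  · exact h.geo_q.step j hj

theorem plainArc_asymm (h : EarPair G L S A a b hp hq p q) {u v : V}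
    (huv : plainArc p q a b u v) : ¬ plainArc p q a b v u := by
  intro hvu
  have h1 := h.upward_of_plainArc huv
  have h2 := h.upward_of_plainArc hvu
  rcases huv with ⟨i, hi, rfl, rfl⟩ | ⟨j, hj, rfl, rfl⟩
  · exact h.not_upward hi h2
  · rcases hvu with ⟨i, hi, e, e'⟩ | ⟨j', hj', e, e'⟩
    · rw [e, e'] at h1
      exact h.not_upward hi h1
    · have e1 := h.geo_q.inj (by omega) (by omega) e
      have e2 := h.geo_q.inj (by omega) (by omega) e'
      omega

theorem plainArc_path : ∀ i < a, plainArc p q a b (p i) (p (i + 1)) :=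
  fun i hi => .inl ⟨i, hi, rfl, rfl⟩

theorem plainArc_back : ∀ j < b, plainArc p q a b (q (j + 1)) (q j) :=
  fun j hj => .inr ⟨j, hj, rfl, rfl⟩

section Reach

variable {T : V → V → Prop} {Y : Finset V}

theorem path_sources (hT : ∀ i < a, T (p i) (p (i + 1))) {i k : ℕ} (hik : i ≤ k) (hk : k ≤ a)
    (hY : ∀ l, i ≤ l → l < k → p l ∈ Y) :
    Relation.ReflTransGen (fun u v => T u v ∧ u ∈ Y) (p i) (p k) :=
  reflTransGen_chain_up hik fun j hj hjk => ⟨hT j (by omega), hY j hj hjk⟩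

theorem path_targets (hT : ∀ i < a, T (p i) (p (i + 1))) {i k : ℕ} (hik : i ≤ k) (hk : k ≤ a)
    (hY : ∀ l, i < l → l ≤ k → p l ∈ Y) :
    Relation.ReflTransGen (fun u v => T u v ∧ v ∈ Y) (p i) (p k) :=
  reflTransGen_chain_up hik fun j hj hjk =>
    ⟨hT j (by omega), hY (j + 1) (by omega) (by omega)⟩

theorem back_sources {i k : ℕ} (hT : ∀ j, i ≤ j → j < k → T (q (j + 1)) (q j)) (hik : i ≤ k)
    (hY : ∀ l, i < l → l ≤ k → q l ∈ Y) :
    Relation.ReflTransGen (fun u v => T u v ∧ u ∈ Y) (q k) (q i) :=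
  reflTransGen_chain_down hik fun j hj hjk =>
    ⟨hT j hj hjk, hY (j + 1) (by omega) (by omega)⟩

theorem back_targets {i k : ℕ} (hT : ∀ j, i ≤ j → j < k → T (q (j + 1)) (q j)) (hik : i ≤ k)
    (hY : ∀ l, i ≤ l → l < k → q l ∈ Y) :
    Relation.ReflTransGen (fun u v => T u v ∧ v ∈ Y) (q k) (q i) :=
  reflTransGen_chain_down hik fun j hj hjk => ⟨hT j hj hjk, hY j hj hjk⟩

end Reach

variable [DecidableEq V]

theorem disjoint_union_private (h : EarPair G L S A a b hp hq p q) {J : Finset ℕ}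
    (hJ : J ⊆ privateIdx p q a b) : Disjoint S (pathSet p a ∪ J.image q) := by
  rw [Finset.disjoint_right]
  intro x hx
  rcases Finset.mem_union.mp hx with hx | hx
  · obtain ⟨i, hi, hia, rfl⟩ := mem_pathSet.mp hx
    exact h.geo_p.notMem hi hia
  · obtain ⟨j, hj, rfl⟩ := Finset.mem_image.mp hx
    obtain ⟨⟨h1, h2⟩, -⟩ := mem_privateIdx.mp (hJ hj)
    exact h.geo_q.notMem h1 h2

theorem card_lt_card_union (h : EarPair G L S A a b hp hq p q) {J : Finset ℕ}
    (hJ : J ⊆ privateIdx p q a b) : S.card < (S ∪ (pathSet p a ∪ J.image q)).card := by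
  rw [Finset.card_union_of_disjoint (h.disjoint_union_private hJ), h.card_union_private hJ]
  have := h.two_le
  omega

theorem card_blockedIdx_eq_zero (h : EarPair G L S A a b hp hq p q) (h1 : hp = 1) :
    (blockedIdx G A p q a b hq).card = 0 := by
  rw [Finset.card_eq_zero, Finset.eq_empty_iff_forall_notMem]
  intro j hj
  have := (h.adj_of_blocked hj).1
  omega

theorem card_privateIdx_le (h : EarPair G L S A a b hp hq p q) :
    (privateIdx p q a b).card + hq ≤
      2 + (freeIdx G A p q a b hq).card + (blockedIdx G A p q a b hq).card := by
  simpa using h.card_filter_private_le fun _ => True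

theorem q_mem {J : Finset ℕ} {j : ℕ} (hj : 1 ≤ j) (hjb : j ≤ b)
    (hJ : j ∈ privateIdx p q a b → j ∈ J) : q j ∈ pathSet p a ∪ J.image q := by
  by_cases hjp : q j ∈ pathSet p a
  · exact Finset.mem_union_left _ hjp
  · exact Finset.mem_union_right _ (Finset.mem_image_of_mem _
      (hJ (mem_privateIdx.mpr ⟨⟨hj, hjb⟩, hjp⟩)))

theorem plainArc_mem (h : EarPair G L S A a b hp hq p q) {u v : V}
    (huv : plainArc p q a b u v) :
    u ∈ S ∪ (pathSet p a ∪ (privateIdx p q a b).image q) ∧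
      v ∈ S ∪ (pathSet p a ∪ (privateIdx p q a b).image q) ∧
      (u ∈ pathSet p a ∪ (privateIdx p q a b).image q ∨
        v ∈ pathSet p a ∪ (privateIdx p q a b).image q) := by
  have hpm : ∀ i, 1 ≤ i → i ≤ a → p i ∈ pathSet p a ∪ (privateIdx p q a b).image q :=
    fun i hi hia => Finset.mem_union_left _ (p_mem hi hia)
  have hqm : ∀ j, 1 ≤ j → j ≤ b → q j ∈ pathSet p a ∪ (privateIdx p q a b).image q :=
    fun j hj hjb => q_mem hj hjb id
  have hpS : ∀ i, i ≤ a → p i ∈ S ∪ (pathSet p a ∪ (privateIdx p q a b).image q) := by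
    intro i hia
    rcases Nat.eq_zero_or_pos i with rfl | hi
    exacts [Finset.mem_union_left _ h.geo_p.zero_mem, Finset.mem_union_right _ (hpm i hi hia)]
  have hqS : ∀ j, j ≤ b → q j ∈ S ∪ (pathSet p a ∪ (privateIdx p q a b).image q) := by
    intro j hjb
    rcases Nat.eq_zero_or_pos j with rfl | hj
    exacts [Finset.mem_union_left _ h.geo_q.zero_mem, Finset.mem_union_right _ (hqm j hj hjb)]
  rcases huv with ⟨i, hi, rfl, rfl⟩ | ⟨j, hj, rfl, rfl⟩
  · exact ⟨hpS _ (by omega), hpS _ (by omega), .inr (hpm _ (by omega) (by omega))⟩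
  · exact ⟨hqS _ (by omega), hqS _ (by omega), .inl (hqm _ (by omega) (by omega))⟩

theorem plain_out (h : EarPair G L S A a b hp hq p q) {z : V}
    (hz : z ∈ pathSet p a ∪ (privateIdx p q a b).image q) :
    Relation.ReflTransGen (fun u v => plainArc p q a b u v ∧
      u ∈ pathSet p a ∪ (privateIdx p q a b).image q) z (q 0) := by
  have hqr : ∀ j ≤ b, Relation.ReflTransGen (fun u v => plainArc p q a b u v ∧
      u ∈ pathSet p a ∪ (privateIdx p q a b).image q) (q j) (q 0) := fun j hj =>
    back_sources (fun l _ hl => plainArc_back l (by omega)) (Nat.zero_le j)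
      fun l hl hlj => q_mem (by omega) (by omega) id
  rcases Finset.mem_union.mp hz with hz | hz
  · obtain ⟨i, hi, hia, rfl⟩ := mem_pathSet.mp hz
    refine .trans (path_sources plainArc_path hia le_rfl fun l hl hla => ?_)
      (h.top ▸ hqr b le_rfl)
    exact Finset.mem_union_left _ (p_mem (by omega) hla.le)
  · obtain ⟨j, hj, rfl⟩ := Finset.mem_image.mp hz
    exact hqr j (h.lt_b hj).le

theorem plain_in (h : EarPair G L S A a b hp hq p q) {z : V}
    (hz : z ∈ pathSet p a ∪ (privateIdx p q a b).image q) :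
    Relation.ReflTransGen (fun u v => plainArc p q a b u v ∧
      v ∈ pathSet p a ∪ (privateIdx p q a b).image q) (p 0) z := by
  have hpr : ∀ i ≤ a, Relation.ReflTransGen (fun u v => plainArc p q a b u v ∧
      v ∈ pathSet p a ∪ (privateIdx p q a b).image q) (p 0) (p i) := fun i hi =>
    path_targets plainArc_path (Nat.zero_le i) hi fun l hl hla =>
      Finset.mem_union_left _ (p_mem (by omega) (by omega))
  rcases Finset.mem_union.mp hz with hz | hz
  · obtain ⟨i, hi, hia, rfl⟩ := mem_pathSet.mp hz
    exact hpr i hia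
  · obtain ⟨j, hj, rfl⟩ := Finset.mem_image.mp hz
    have hjb := h.lt_b hj
    have hj1 := (mem_privateIdx.mp hj).1.1
    refine .trans (hpr a le_rfl) (h.top ▸ back_targets
      (fun l _ hl => plainArc_back l hl) hjb.le fun l hl hlb => ?_)
    exact q_mem (by omega) (by omega) id

/-- The centers can be placed on the path `p` if `q` has few free indices. -/
theorem extend_of_few_free (h : EarPair G L S A a b hp hq p q) (hc : Core G L S A D α β B)
    (hβ : 2 ≤ β (p 0) + hp) (hα0 : hp = 0 → 2 ≤ α (q 0) + hq) (hα : 2 ≤ α (q 0) + 2 * hq)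
    (hN : (freeIdx G A p q a b hq).card + (blockedIdx G A p q a b hq).card + hp ≤ 3 * L) :
    ∃ S' A' D' α' β' B', S.card < S'.card ∧ Core G L S' A' D' α' β' B' := by
  have hL := h.one_le
  have hlen := h.len
  have hp1 := h.hp_le
  have hq1 := h.hq_le
  set X := pathSet p a ∪ (privateIdx p q a b).image q with hX
  have hXc : X.card = a + (privateIdx p q a b).card := h.card_union_private subset_rfl
  have hpriv := h.card_privateIdx_le
  have hX1 : X.card + 2 ≤ 6 * L + 2 + α (q 0) ∧ X.card + 2 ≤ 6 * L + 2 + β (p 0) ∧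
      X.card + 4 ≤ 6 * L + 2 + α (q 0) + β (p 0) := by
    rcases h.case_p with ⟨h0, -⟩ | ⟨h0, -⟩
    · have := hα0 h0
      omega
    · have := h.card_blockedIdx_eq_zero h0
      omega
  set C := (Finset.Icc 1 L).image (fun k => p (3 * k - hp)) with hC
  have hCmem : ∀ c ∈ C, ∃ k, 1 ≤ k ∧ k ≤ L ∧ p (3 * k - hp) = c := by
    intro c hc
    obtain ⟨k, hk, rfl⟩ := Finset.mem_image.mp hc
    exact ⟨k, (Finset.mem_Icc.mp hk).1, (Finset.mem_Icc.mp hk).2, rfl⟩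
  have hCc : C.card = L := by
    rw [hC, Finset.card_image_of_injOn]
    · simp
    · intro k hk l hl e
      simp only [Finset.coe_Icc, Set.mem_Icc] at hk hl
      have := h.geo_p.inj (by omega) (by omega) e
      omega
  obtain ⟨A', D', α', β', B', hcore⟩ := hc.extend (X := X) (C := C) (T := plainArc p q a b)
    (a := fun z => if z ∈ C then 2 else 0) (b := fun z => if z ∈ C then 2 else 1)
    (p := p 0) (q := q 0) (R := 6 * L + 2) h.geo_p.zero_mem h.geo_q.zero_mem
    (h.disjoint_union_private subset_rfl)
    (fun c hc => by
      obtain ⟨k, hk, hkL, rfl⟩ := hCmem c hc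
      exact Finset.mem_union_left _ (p_mem (by omega) (by omega)))
    hCc.ge (by rw [hCc])
    (fun c hc c' hc' hne => by
      obtain ⟨k, hk, hkL, rfl⟩ := hCmem c hc
      obtain ⟨l, hl, hlL, rfl⟩ := hCmem c' hc'
      rcases lt_trichotomy k l with hlt | rfl | hlt
      · exact fun hn => h.not_near_path (by omega) (by omega) hn.symm
      · exact absurd rfl hne
      · exact h.not_near_path (by omega) (by omega))
    (fun c hc s hs => by
      obtain ⟨k, hk, hkL, rfl⟩ := hCmem c hc
      exact h.not_near_center_path (by omega) (by omega) hs)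
    (fun u v huv => (h.upward_of_plainArc huv).1)
    (fun u v huv => (h.plainArc_mem huv).1) (fun u v huv => (h.plainArc_mem huv).2.1)
    (fun u v huv => (h.plainArc_mem huv).2.2) (fun u v huv => h.plainArc_asymm huv)
    (fun c hc => by simp [hc]) (fun c hc => by simp [hc])
    (fun z _ => by split_ifs <;> omega)
    (fun z _ => by split_ifs <;> omega)
    (fun z _ => by split_ifs <;> omega)
    (by
      rcases h.case_p with ⟨h0, -⟩ | ⟨h0, -⟩
      · omega
      · have := h.card_blockedIdx_eq_zero h0
        omega)
    (fun z hz => ⟨X, h.plain_out hz, by split_ifs <;> omega⟩)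
    (fun z hz => ⟨X, h.plain_in hz, by split_ifs <;> omega⟩)
    (fun z hz z' hz' => .inr ⟨X, subset_rfl, X, subset_rfl, h.plain_out hz, h.plain_in hz', by
      rw [Finset.union_self]
      split_ifs <;> omega⟩)
  exact ⟨_, A', D', α', β', B', h.card_lt_card_union subset_rfl, hcore⟩

end EarPair

namespace EarPair

variable {V : Type*} {G : SimpleGraph V} {L : ℕ} {S A : Finset V}
  {a b hp hq : ℕ} {p q : ℕ → V} {D : V → V → Prop} {α β : V → ℕ} {B : ℕ}

theorem card_add_one_le {X Y : Finset V} {x : V} (hY : Y ⊆ X) (hx : x ∈ X) (hxY : x ∉ Y) :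
    Y.card + 1 ≤ X.card :=
  Finset.card_lt_card (Finset.ssubset_iff_of_subset hY |>.mpr ⟨x, hx, hxY⟩)

variable [DecidableEq V]

theorem pairwise_not_near_image (h : EarPair G L S A a b hp hq p q) {C : Finset ℕ}
    (hC : C ⊆ privateIdx p q a b) (hC3 : ∀ c ∈ C, ∀ d ∈ C, c < d → c + 3 ≤ d) :
    ∀ x ∈ C.image q, ∀ y ∈ C.image q, x ≠ y → ¬ Near G x y := by
  intro x hx y hy hne
  obtain ⟨c, hc, rfl⟩ := Finset.mem_image.mp hx
  obtain ⟨d, hd, rfl⟩ := Finset.mem_image.mp hy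
  rcases lt_trichotomy c d with hlt | rfl | hlt
  · exact fun hn => h.not_near_private (hC hc) (hC hd) (hC3 c hc d hd hlt) hn.symm
  · exact absurd rfl hne
  · exact h.not_near_private (hC hd) (hC hc) (hC3 d hd c hc hlt)

/-- The centers can be placed on `q` if at most one index is blocked. -/
theorem extend_of_blocked_le_one (h : EarPair G L S A a b hp hq p q)
    (hc : Core G L S A D α β B) (hβ : 2 ≤ β (p 0) + hp) (hα0 : hp = 0 → 2 ≤ α (q 0) + hq)
    (hα : 2 ≤ α (q 0) + 2 * hq) (hN : 3 * L ≤ (freeIdx G A p q a b hq).card + 2)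
    (hW : (blockedIdx G A p q a b hq).card ≤ 1) :
    ∃ S' A' D' α' β' B', S.card < S'.card ∧ Core G L S' A' D' α' β' B' := by
  have hL := h.one_le
  have hlen := h.len
  have hp1 := h.hp_le
  have hq1 := h.hq_le
  have ha2 := h.two_le
  set I := freeIdx G A p q a b hq with hI
  have hIpriv : ∀ {j}, j ∈ I → j ∈ privateIdx p q a b := fun hj => freeIdx_subset hj
  obtain ⟨C, hCI, hC1, hC2, hC3, -⟩ := exists_spread_subset I
  have hCpriv : C ⊆ privateIdx p q a b := fun _ hj => hIpriv (hCI hj)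
  set X := pathSet p a ∪ (privateIdx p q a b).image q with hX
  have hXc : X.card = a + (privateIdx p q a b).card := h.card_union_private subset_rfl
  have hpriv := h.card_privateIdx_le
  rw [← hI] at hpriv
  have hCc : (C.image q).card = C.card := h.card_image_private hCpriv
  have hX1 : (hp = 0 ∧ X.card + hq ≤ 6 * C.card + 3 ∧ 2 ≤ α (q 0) + hq) ∨
      (hp = 1 ∧ X.card + hq ≤ 6 * C.card + 1) := by
    rcases h.case_p with ⟨h0, -⟩ | ⟨h0, -⟩
    · have := hα0 h0
      omega
    · have := h.card_blockedIdx_eq_zero h0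
      omega
  have hqX : ∀ j, 1 ≤ j → j ≤ b → q j ∈ X := fun j hj hjb => q_mem hj hjb id
  have hpX : ∀ i, 1 ≤ i → i ≤ a → p i ∈ X := fun i hi hia =>
    Finset.mem_union_left _ (p_mem hi hia)
  set out : ℕ → Finset V := fun j => (Finset.Icc 1 j).image q with hout
  set inn : ℕ → Finset V := fun j => pathSet p a ∪ (Finset.Icc j b).image q with hinn
  have houtX : ∀ j ∈ C, out j ⊆ X := by
    intro j hj x hx
    obtain ⟨l, hl, rfl⟩ := Finset.mem_image.mp hx
    have := h.lt_b (hCpriv hj)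
    have := Finset.mem_Icc.mp hl
    exact hqX l (by omega) (by omega)
  have hinnX : ∀ j ∈ C, inn j ⊆ X := by
    intro j hj x hx
    rcases Finset.mem_union.mp hx with hx | hx
    · exact Finset.mem_union_left _ hx
    · obtain ⟨l, hl, rfl⟩ := Finset.mem_image.mp hx
      have := (mem_privateIdx.mp (hCpriv hj)).1
      have := Finset.mem_Icc.mp hl
      exact hqX l (by omega) (by omega)
  have hnotout : ∀ j l, j < l → l ≤ b → q l ∉ out j := by
    intro j l hjl hl hm
    obtain ⟨i, hi, e⟩ := Finset.mem_image.mp hm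
    have := Finset.mem_Icc.mp hi
    have := h.geo_q.inj (by omega) hl e
    omega
  have hnotinn : ∀ j, ∀ l ∈ privateIdx p q a b, l < j → q l ∉ inn j := by
    intro j l hl hlj hm
    rcases Finset.mem_union.mp hm with hm | hm
    · exact (mem_privateIdx.mp hl).2 hm
    · obtain ⟨i, hi, e⟩ := Finset.mem_image.mp hm
      have := Finset.mem_Icc.mp hi
      have := h.geo_q.inj (by omega) (mem_privateIdx.mp hl).1.2 e
      omega
  have houtr : ∀ j ∈ C, Relation.ReflTransGen
      (fun u v => plainArc p q a b u v ∧ u ∈ out j) (q j) (q 0) := by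
    intro j hj
    have := h.lt_b (hCpriv hj)
    refine back_sources (fun l _ hl => plainArc_back l (by omega)) (Nat.zero_le j)
      fun l hl hlj => Finset.mem_image_of_mem _ (Finset.mem_Icc.mpr ⟨by omega, hlj⟩)
  have hinnr : ∀ j ∈ C, Relation.ReflTransGen
      (fun u v => plainArc p q a b u v ∧ v ∈ inn j) (p 0) (q j) := by
    intro j hj
    refine .trans (path_targets plainArc_path (Nat.zero_le a) le_rfl fun l hl hla =>
      Finset.mem_union_left _ (p_mem hl hla)) ?_
    rw [← h.top]
    exact back_targets (fun l _ hl => plainArc_back l hl) (h.lt_b (hCpriv hj)).le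
      fun l hl hlb => Finset.mem_union_right _ (Finset.mem_image_of_mem _
        (Finset.mem_Icc.mpr ⟨hl, hlb.le⟩))
  have houtc : ∀ j ∈ C, (out j).card + 1 ≤ X.card := fun j hj =>
    card_add_one_le (houtX j hj) (hqX b h.b_pos le_rfl) (hnotout j b (h.lt_b (hCpriv hj)) le_rfl)
  have hinnc : ∀ j ∈ C, (inn j).card + 1 ≤ X.card := by
    intro j hj
    obtain ⟨i, hi, hij⟩ := h.exists_private_lt (mem_freeIdx.mp (hCI hj)).1
    have hi' := (mem_privateIdx.mp hi).1
    exact card_add_one_le (hinnX j hj) (hqX i hi'.1 hi'.2) (hnotinn j i hi hij)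
  obtain ⟨A', D', α', β', B', hcore⟩ := hc.extend (X := X) (C := C.image q)
    (T := plainArc p q a b)
    (a := fun z => if z ∈ C.image q then 2 else 0) (b := fun z => if z ∈ C.image q then 2 else 1)
    (p := p 0) (q := q 0) (R := 6 * C.card + 2) h.geo_p.zero_mem h.geo_q.zero_mem
    (h.disjoint_union_private subset_rfl)
    (fun x hx => Finset.mem_union_right _ (Finset.image_subset_image hCpriv hx))
    (by omega) (by rw [hCc])
    (h.pairwise_not_near_image hCpriv fun c hc d hd hcd => (hC3 c hc d hd hcd).1)
    (fun x hx s hs => by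
      obtain ⟨c, hc, rfl⟩ := Finset.mem_image.mp hx
      exact (mem_freeIdx.mp (hCI hc)).2 s hs)
    (fun u v huv => (h.upward_of_plainArc huv).1)
    (fun u v huv => (h.plainArc_mem huv).1) (fun u v huv => (h.plainArc_mem huv).2.1)
    (fun u v huv => (h.plainArc_mem huv).2.2) (fun u v huv => h.plainArc_asymm huv)
    (fun c hc => by simp only [hc, if_true]) (fun c hc => by simp only [hc, if_true])
    (fun z _ => by split_ifs <;> omega)
    (fun z _ => by split_ifs <;> omega)
    (fun z _ => by split_ifs <;> omega)
    (by omega)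
    (fun z hz => by
      by_cases hzC : z ∈ C.image q
      · obtain ⟨j, hj, rfl⟩ := Finset.mem_image.mp hzC
        have := houtc j hj
        exact ⟨out j, houtr j hj, by simp only [hzC, if_true]; omega⟩
      · exact ⟨X, h.plain_out hz, by simp only [hzC, if_false]; omega⟩)
    (fun z hz => by
      by_cases hzC : z ∈ C.image q
      · obtain ⟨j, hj, rfl⟩ := Finset.mem_image.mp hzC
        have := hinnc j hj
        exact ⟨inn j, hinnr j hj, by simp only [hzC, if_true]; omega⟩
      · exact ⟨X, h.plain_in hz, by simp only [hzC, if_false]; omega⟩)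
    (fun z hz z' hz' => by
      by_cases hzC : z ∈ C.image q ∧ z' ∈ C.image q
      · obtain ⟨hzC, hzC'⟩ := hzC
        obtain ⟨j, hj, rfl⟩ := Finset.mem_image.mp hzC
        obtain ⟨l, hl, rfl⟩ := Finset.mem_image.mp hzC'
        have hjb := h.lt_b (hCpriv hj)
        rcases le_or_gt l j with hlj | hjl
        · exact .inl (back_sources (fun i _ hi => plainArc_back i (by omega)) hlj
            fun i hi hij => hqX i (by omega) (by omega))
        · obtain ⟨i, hi, hji, hil⟩ := (hC3 j hj l hl hjl).2
          have hib := (h.lt_b (hIpriv hi)).le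
          have := card_add_one_le (Finset.union_subset (houtX j hj) (hinnX l hl))
            (hqX i (by omega) hib) (fun hm => (Finset.mem_union.mp hm).elim
              (hnotout j i hji hib) (hnotinn l i (hIpriv hi) hil))
          exact .inr ⟨out j, houtX j hj, inn l, hinnX l hl, houtr j hj, hinnr l hl, by
            simp only [hzC, hzC', if_true]; omega⟩
      · refine .inr ⟨X, subset_rfl, X, subset_rfl, h.plain_out hz, h.plain_in hz', ?_⟩
        rw [Finset.union_self]
        split_ifs <;> first | omega | exact absurd ⟨‹_›, ‹_›⟩ hzC)
  exact ⟨_, A', D', α', β', B', h.card_lt_card_union subset_rfl, hcore⟩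

end EarPair

namespace EarPair

variable {V : Type*} {G : SimpleGraph V} {L : ℕ} {S A : Finset V}
  {a b hp hq : ℕ} {p q : ℕ → V} {D : V → V → Prop} {α β : V → ℕ} {B : ℕ} {m k : ℕ}

/-- The arcs going up along `p` and down along `q`, where `q` takes the detour
`q k, p 1, q m` instead of following its part between `k` and `m`. -/
def detourArc (p q : ℕ → V) (a b m k : ℕ) (u v : V) : Prop :=
  (∃ i < a, u = p i ∧ v = p (i + 1)) ∨
    (∃ j < b, (k ≤ j ∨ j + 1 ≤ m) ∧ u = q (j + 1) ∧ v = q j) ∨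
      (u = q k ∧ v = p 1) ∨ (u = p 1 ∧ v = q m)

theorem detourArc_path : ∀ i < a, detourArc p q a b m k (p i) (p (i + 1)) :=
  fun i hi => .inl ⟨i, hi, rfl, rfl⟩

theorem detourArc_back : ∀ j < b, (k ≤ j ∨ j + 1 ≤ m) →
    detourArc p q a b m k (q (j + 1)) (q j) :=
  fun j hj h => .inr (.inl ⟨j, hj, h, rfl, rfl⟩)

theorem detourArc_leave : detourArc p q a b m k (q k) (p 1) := .inr (.inr (.inl ⟨rfl, rfl⟩))

theorem detourArc_return : detourArc p q a b m k (p 1) (q m) := .inr (.inr (.inr ⟨rfl, rfl⟩))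

theorem card_add_two_le {X Y : Finset V} {x y : V} (hY : Y ⊆ X) (hx : x ∈ X) (hy : y ∈ X)
    (hxY : x ∉ Y) (hyY : y ∉ Y) (hxy : x ≠ y) : Y.card + 2 ≤ X.card := by
  classical
  have h1 : insert x Y ⊆ X := Finset.insert_subset hx hY
  have h2 := card_add_one_le h1 hy (by simp [hyY, hxy.symm])
  rw [Finset.card_insert_of_notMem hxY] at h2
  omega

variable [DecidableEq V]

theorem upward_of_detourArc (h : EarPair G L S A a b hp hq p q)
    (hm : m ∈ blockedIdx G A p q a b hq) (hk : k ∈ blockedIdx G A p q a b hq) {u v : V}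
    (huv : detourArc p q a b m k u v) : upward G p a u v := by
  rcases huv with ⟨i, hi, rfl, rfl⟩ | ⟨j, hj, -, rfl, rfl⟩ | ⟨rfl, rfl⟩ | ⟨rfl, rfl⟩
  · exact h.geo_p.upward_path hi
  · exact h.geo_q.step j hj
  · exact h.upward_of_private_left (blockedIdx_subset hk) (h.adj_of_blocked hk).2
  · exact h.upward_of_private_right (blockedIdx_subset hm) (h.adj_of_blocked hm).2.symm

theorem detourArc_asymm (h : EarPair G L S A a b hp hq p q)
    (hm : m ∈ blockedIdx G A p q a b hq) (hk : k ∈ blockedIdx G A p q a b hq) (hmk : m < k)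
    {u v : V} (huv : detourArc p q a b m k u v) : ¬ detourArc p q a b m k v u := by
  intro hvu
  have h1 := h.upward_of_detourArc hm hk huv
  have h2 := h.upward_of_detourArc hm hk hvu
  have hm' := blockedIdx_subset hm
  have hk' := blockedIdx_subset hk
  have hmb := h.lt_b hm'
  have hkb := h.lt_b hk'
  have ha2 := h.two_le
  have hup : upward G p a (p 1) (q m) := h.upward_of_detourArc hm hk detourArc_return
  have hdown : upward G p a (q k) (p 1) := h.upward_of_detourArc hm hk detourArc_leave
  have key : ∀ j ≤ b, q j = p 1 → k ≤ j + 1 ∧ j ≤ m + 1 := by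
    intro j hj e
    have e1 := h.geo_q.le_add hj hkb.le (.single (e ▸ hdown))
    have e2 := h.geo_q.le_add hmb.le hj (.single (e ▸ hup))
    omega
  rcases huv with ⟨i, hi, rfl, rfl⟩ | ⟨j, hj, hjk, rfl, rfl⟩ | ⟨rfl, rfl⟩ | ⟨rfl, rfl⟩
  · exact h.not_upward hi h2
  · rcases hvu with ⟨i, hi, e, e'⟩ | ⟨j', hj', -, e, e'⟩ | ⟨e, e'⟩ | ⟨e, e'⟩
    · rw [e, e'] at h1
      exact h.not_upward hi h1
    · have e1 := h.geo_q.inj (by omega) (by omega) e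
      have e2 := h.geo_q.inj (by omega) (by omega) e'
      omega
    · have e1 := h.geo_q.inj (by omega) (by omega) e
      have e2 := key _ (by omega) e'
      omega
    · have e1 := h.geo_q.inj (by omega) (by omega) e'
      have e2 := key _ (by omega) e
      omega
  · rcases hvu with ⟨i, hi, e, e'⟩ | ⟨j', hj', hjk, e, e'⟩ | ⟨e, e'⟩ | ⟨e, e'⟩
    · rw [e, e'] at h1
      exact h.not_upward hi h1
    · have e1 := h.geo_q.inj (by omega) (by omega) e'
      have e2 := key _ (by omega) e.symm
      omega
    · exact h.ne_path hk' (by omega) e.symm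
    · have e1 := h.geo_q.inj (by omega) (by omega) e'
      omega
  · rcases hvu with ⟨i, hi, e, e'⟩ | ⟨j', hj', hjk, e, e'⟩ | ⟨e, e'⟩ | ⟨e, e'⟩
    · rw [e, e'] at h1
      exact h.not_upward hi h1
    · have e1 := h.geo_q.inj (by omega) (by omega) e
      have e2 := key _ (by omega) e'.symm
      omega
    · have e1 := h.geo_q.inj (by omega) (by omega) e
      omega
    · exact h.ne_path hm' (by omega) e

end EarPair

namespace EarPair

variable {V : Type*} [DecidableEq V] {G : SimpleGraph V} {L : ℕ} {S A : Finset V}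
  {a b hp hq : ℕ} {p q : ℕ → V} {D : V → V → Prop} {α β : V → ℕ} {B : ℕ} {m k : ℕ}

/-- The centers can be placed on `q` if the part of `q` between two blocked indices is
short-cut through `p 1`. -/
theorem extend_of_detour (h : EarPair G L S A a b hp hq p q)
    (hc : Core G L S A D α β B) (hβ : 2 ≤ β (p 0) + hp) (hα0 : hp = 0 → 2 ≤ α (q 0) + hq)
    (hm : m ∈ blockedIdx G A p q a b hq) (hk : k ∈ blockedIdx G A p q a b hq) (hmk : m < k)
    (hmin : ∀ j ∈ blockedIdx G A p q a b hq, m ≤ j) (hmax : ∀ j ∈ blockedIdx G A p q a b hq, j ≤ k)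
    (hN : 3 * L ≤ ((freeIdx G A p q a b hq).filter fun j => j ≤ m ∨ k ≤ j).card + 2) :
    ∃ S' A' D' α' β' B', S.card < S'.card ∧ Core G L S' A' D' α' β' B' := by
  have hL := h.one_le
  have hlen := h.len
  have hp0 : hp = 0 := (h.adj_of_blocked hm).1
  have hq1 := h.hq_le
  have ha2 := h.two_le
  have hα := hα0 hp0
  have hm' := blockedIdx_subset hm
  have hk' := blockedIdx_subset hk
  have hmb := h.lt_b hm'
  have hkb := h.lt_b hk'
  have hm1 := (mem_privateIdx.mp hm').1.1
  set I := (freeIdx G A p q a b hq).filter fun j => j ≤ m ∨ k ≤ j with hI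
  have hIfree : ∀ {j}, j ∈ I → j ∈ freeIdx G A p q a b hq := fun hj =>
    (Finset.mem_filter.mp hj).1
  have hIne : ∀ {j}, j ∈ I → j < m ∨ k < j := by
    intro j hj
    have hne : ∀ i ∈ blockedIdx G A p q a b hq, j ≠ i := by
      rintro i hi rfl
      obtain ⟨s, hs, hn⟩ := (mem_blockedIdx.mp hi).2
      exact (mem_freeIdx.mp (hIfree hj)).2 s hs hn
    have h1 := hne m hm
    have h2 := hne k hk
    have h3 := (Finset.mem_filter.mp hj).2
    omega
  set J := (privateIdx p q a b).filter fun j => j ≤ m ∨ k ≤ j with hJ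
  have hJpriv : J ⊆ privateIdx p q a b := Finset.filter_subset _ _
  have hIJ : I ⊆ J := fun j hj => Finset.mem_filter.mpr
    ⟨freeIdx_subset (hIfree hj), (Finset.mem_filter.mp hj).2⟩
  obtain ⟨C, hCI, hC1, hC2, hC3, hC4⟩ := exists_spread_subset I
  have hCpriv : C ⊆ privateIdx p q a b := (hCI.trans hIJ).trans hJpriv
  set X := pathSet p a ∪ J.image q with hX
  have hXc : X.card = a + J.card := h.card_union_private hJpriv
  have hJc : J.card + hq ≤ 2 + I.card + 2 := by
    refine (h.card_filter_private_le _).trans (Nat.add_le_add_left ?_ _)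
    refine (Finset.card_le_card (t := {m, k}) fun j hj => ?_).trans Finset.card_le_two
    obtain ⟨h1, h2⟩ := Finset.mem_filter.mp hj
    have := hmin j h1
    have := hmax j h1
    simp only [Finset.mem_insert, Finset.mem_singleton]
    omega
  have hCc : (C.image q).card = C.card := h.card_image_private hCpriv
  have hX1 : X.card + hq ≤ 6 * C.card + 4 := by omega
  have hX2 : I.card ≠ 3 * C.card → X.card + hq ≤ 6 * C.card + 3 := by omega
  have hqX : ∀ j, 1 ≤ j → j ≤ b → (j ≤ m ∨ k ≤ j) → q j ∈ X := fun j hj hjb hjm =>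
    q_mem hj hjb fun hjp => Finset.mem_filter.mpr ⟨hjp, hjm⟩
  have hpX : ∀ i, 1 ≤ i → i ≤ a → p i ∈ X := fun i hi hia =>
    Finset.mem_union_left _ (p_mem hi hia)
  have hXcases : ∀ z ∈ X, (∃ i, 1 ≤ i ∧ i ≤ a ∧ p i = z) ∨
      ∃ j, 1 ≤ j ∧ j < b ∧ (j ≤ m ∨ k ≤ j) ∧ q j = z := by
    intro z hz
    rcases Finset.mem_union.mp hz with hz | hz
    · exact .inl (mem_pathSet.mp hz)
    · obtain ⟨j, hj, rfl⟩ := Finset.mem_image.mp hz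
      obtain ⟨h1, h2⟩ := Finset.mem_filter.mp hj
      exact .inr ⟨j, (mem_privateIdx.mp h1).1.1, h.lt_b h1, h2, rfl⟩
  have hXm := hqX m hm1 hmb.le (.inl le_rfl)
  have hXk := hqX k (by omega) hkb.le (.inr le_rfl)
  have hXb := hqX b h.b_pos le_rfl (.inr hkb.le)
  have hqinj : ∀ i j, i ≤ b → j ≤ b → q i = q j → i = j := fun i j hi hj e =>
    h.geo_q.inj hi hj e
  have hqmk : q m ≠ q k := fun e => by have := hqinj m k hmb.le hkb.le e; omega
  have hqkb : q k ≠ q b := fun e => by have := hqinj k b hkb.le le_rfl e; omega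
  have hb1 : q b ≠ p 1 := fun e => by
    have := h.geo_p.inj le_rfl (by omega) (h.top.symm.trans e)
    omega
  have himg : ∀ j, j ≤ b → ∀ s t, t ≤ b → q j ∈ (Finset.Icc s t).image q → s ≤ j ∧ j ≤ t := by
    intro j hj s t ht hmem
    obtain ⟨i, hi, e⟩ := Finset.mem_image.mp hmem
    rw [Finset.mem_Icc] at hi
    obtain rfl := hqinj i j (by omega) hj e
    exact hi
  have hmemimg : ∀ j s t, s ≤ j → j ≤ t → q j ∈ (Finset.Icc s t).image q := fun j s t h1 h2 =>
    Finset.mem_image_of_mem _ (Finset.mem_Icc.mpr ⟨h1, h2⟩)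
  have himgX : ∀ s t, 1 ≤ s → t ≤ b → (t ≤ m ∨ k ≤ s) → (Finset.Icc s t).image q ⊆ X := by
    intro s t hs ht hst x hx
    obtain ⟨i, hi, rfl⟩ := Finset.mem_image.mp hx
    rw [Finset.mem_Icc] at hi
    exact hqX i (by omega) (by omega) (by omega)
  -- walks out of the new vertices
  have lowOut : ∀ Y : Finset V, ∀ j ≤ m, (Finset.Icc 1 j).image q ⊆ Y →
      Relation.ReflTransGen (fun u v => detourArc p q a b m k u v ∧ u ∈ Y) (q j) (q 0) :=
    fun Y j hj hY => back_sources
      (fun l _ hl => detourArc_back l (by omega) (.inr (by omega)))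
      (Nat.zero_le j) fun l hl hlj => hY (hmemimg l 1 j hl hlj)
  have highOut : ∀ Y : Finset V, ∀ j, k ≤ j → j ≤ b → (Finset.Icc k j).image q ⊆ Y →
      Relation.ReflTransGen (fun u v => detourArc p q a b m k u v ∧ u ∈ Y) (q j) (p 1) :=
    fun Y j hkj hj hY => (back_sources
      (fun l hl hlj => detourArc_back l (by omega) (.inl hl)) hkj
      fun l hl hlj => hY (hmemimg l k j hl.le hlj)).tail
        ⟨detourArc_leave, hY (hmemimg k k j le_rfl hkj)⟩
  have pathOut : ∀ i, 1 ≤ i → i ≤ a → ∀ j, i ≤ j → j ≤ a →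
      Relation.ReflTransGen (fun u v => detourArc p q a b m k u v ∧ u ∈ X) (p i) (p j) :=
    fun i hi hia j hij hj => path_sources detourArc_path hij hj
      fun l hl hla => hpX l (by omega) (by omega)
  have outAll : ∀ z ∈ X,
      Relation.ReflTransGen (fun u v => detourArc p q a b m k u v ∧ u ∈ X) z (q 0) := by
    have hlow : ∀ j ≤ m,
        Relation.ReflTransGen (fun u v => detourArc p q a b m k u v ∧ u ∈ X) (q j) (q 0) :=
      fun j hj => lowOut X j hj (himgX 1 j le_rfl (by omega) (.inl hj))
    have hhigh : ∀ j, k ≤ j → j ≤ b →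
        Relation.ReflTransGen (fun u v => detourArc p q a b m k u v ∧ u ∈ X) (q j) (q 0) :=
      fun j hkj hj => ((highOut X j hkj hj (himgX k j (by omega) hj (.inr le_rfl))).tail
        ⟨detourArc_return, hpX 1 le_rfl (by omega)⟩).trans (hlow m le_rfl)
    intro z hz
    rcases hXcases z hz with ⟨i, hi, hia, rfl⟩ | ⟨j, hj, hjb, hjm | hkj, rfl⟩
    · exact (pathOut i hi hia a hia le_rfl).trans (h.top ▸ hhigh b hkb.le le_rfl)
    · exact hlow j hjm
    · exact hhigh j hkj hjb.le
  -- walks to the new vertices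
  have pathIn : ∀ Y : Finset V, pathSet p a ⊆ Y → ∀ i ≤ a, Relation.ReflTransGen
      (fun u v => detourArc p q a b m k u v ∧ v ∈ Y) (p 0) (p i) :=
    fun Y hY i hi => path_targets detourArc_path (Nat.zero_le i) hi
      fun l hl hli => hY (p_mem (by omega) (by omega))
  have highIn : ∀ j, k ≤ j → j ≤ b → Relation.ReflTransGen
      (fun u v => detourArc p q a b m k u v ∧ v ∈ pathSet p a ∪ (Finset.Icc j b).image q)
      (p 0) (q j) := by
    intro j hkj hj
    refine .trans (pathIn _ Finset.subset_union_left a le_rfl) ?_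
    rw [← h.top]
    exact back_targets (fun l hl hlb => detourArc_back l hlb (.inl (by omega))) hj
      fun l hl hlb => Finset.mem_union_right _ (hmemimg l j b hl hlb.le)
  have lowIn : ∀ j ≤ m, Relation.ReflTransGen
      (fun u v => detourArc p q a b m k u v ∧ v ∈ insert (p 1) ((Finset.Icc j m).image q))
      (p 0) (q j) := by
    intro j hj
    refine .head ⟨detourArc_path 0 (by omega), Finset.mem_insert_self _ _⟩ (.head
      ⟨detourArc_return, Finset.mem_insert_of_mem (hmemimg m j m hj le_rfl)⟩ ?_)
    exact back_targets (fun l _ hl => detourArc_back l (by omega) (.inr (by omega))) hj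
      fun l hl hlm => Finset.mem_insert_of_mem (hmemimg l j m hl hlm.le)
  -- the vertices avoided by these walks
  have pathX : pathSet p a ⊆ X := Finset.subset_union_left
  have highX : ∀ j, k ≤ j → pathSet p a ∪ (Finset.Icc j b).image q ⊆ X := fun j hj =>
    Finset.union_subset pathX (himgX j b (by omega) le_rfl (.inr hj))
  have lowX : ∀ j, 1 ≤ j → insert (p 1) ((Finset.Icc j m).image q) ⊆ X := fun j hj =>
    Finset.insert_subset (hpX 1 le_rfl (by omega)) (himgX j m hj hmb.le (.inl le_rfl))
  have hpath_priv : ∀ j ∈ privateIdx p q a b, q j ∉ pathSet p a := fun j hj =>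
    (mem_privateIdx.mp hj).2
  have high_m : ∀ j, k ≤ j → q m ∉ pathSet p a ∪ (Finset.Icc j b).image q := fun j hj hmem =>
    (Finset.mem_union.mp hmem).elim (hpath_priv m hm') fun hmem => by
      have := himg m hmb.le j b le_rfl hmem
      omega
  have high_k : ∀ j, k < j → q k ∉ pathSet p a ∪ (Finset.Icc j b).image q := fun j hj hmem =>
    (Finset.mem_union.mp hmem).elim (hpath_priv k hk') fun hmem => by
      have := himg k hkb.le j b le_rfl hmem
      omega
  have low_k : ∀ j, q k ∉ insert (p 1) ((Finset.Icc j m).image q) := fun j hmem =>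
    (Finset.mem_insert.mp hmem).elim (h.ne_path hk' (by omega)) fun hmem => by
      have := himg k hkb.le j m hmb.le hmem
      omega
  have low_b : ∀ j, q b ∉ insert (p 1) ((Finset.Icc j m).image q) := fun j hmem =>
    (Finset.mem_insert.mp hmem).elim hb1 fun hmem => by
      have := himg b le_rfl j m hmb.le hmem
      omega
  have inAll : ∀ z ∈ X, ∃ Y ⊆ X,
      Relation.ReflTransGen (fun u v => detourArc p q a b m k u v ∧ v ∈ Y) (p 0) z ∧
        Y.card + 1 ≤ X.card ∧ (z ∈ C.image q → Y.card + 2 ≤ X.card) := by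
    intro z hz
    rcases hXcases z hz with ⟨i, hi, hia, rfl⟩ | ⟨j, hj, hjb, hjm | hkj, rfl⟩
    · refine ⟨_, pathX, pathIn _ subset_rfl i hia, card_add_one_le pathX hXm (hpath_priv m hm'),
        fun hzC => ?_⟩
      obtain ⟨c, hc, e⟩ := Finset.mem_image.mp hzC
      exact absurd e (h.ne_path (hCpriv hc) hia)
    · have := card_add_two_le (lowX j hj) hXk hXb (low_k j) (low_b j) hqkb
      exact ⟨_, lowX j hj, lowIn j hjm, by omega, fun _ => this⟩
    · refine ⟨_, highX j hkj, highIn j hkj hjb.le,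
        card_add_one_le (highX j hkj) hXm (high_m j hkj), fun hzC => ?_⟩
      obtain ⟨c, hc, e⟩ := Finset.mem_image.mp hzC
      obtain rfl := hqinj c j (h.lt_b (hCpriv hc)).le hjb.le e
      have := hIne (hCI hc)
      exact card_add_two_le (highX c hkj) hXm hXk (high_m c hkj) (high_k c (by omega)) hqmk
  have outCenter : ∀ c ∈ C, ∃ Y : Finset V, Relation.ReflTransGen
      (fun u v => detourArc p q a b m k u v ∧ u ∈ Y) (q c) (q 0) ∧
        Y.card + hq ≤ 6 * C.card + 2 := by
    intro c hc
    have hc1 := (mem_privateIdx.mp (hCpriv hc)).1.1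
    have hcb := h.lt_b (hCpriv hc)
    rcases hIne (hCI hc) with hcm | hkc
    · have := card_add_two_le (himgX 1 c le_rfl hcb.le (.inl hcm.le)) hXk hXb
        (fun hmem => by have := himg k hkb.le 1 c hcb.le hmem; omega)
        (fun hmem => by have := himg b le_rfl 1 c hcb.le hmem; omega) hqkb
      exact ⟨_, lowOut _ c hcm.le subset_rfl, by omega⟩
    · set Y := (Finset.Icc k c).image q ∪ insert (p 1) ((Finset.Icc 1 m).image q) with hY
      have hYX : Y ⊆ X := Finset.union_subset
        (himgX k c (by omega) hcb.le (.inr le_rfl)) (lowX 1 le_rfl)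
      have hreach : Relation.ReflTransGen
          (fun u v => detourArc p q a b m k u v ∧ u ∈ Y) (q c) (q 0) :=
        ((highOut Y c hkc.le hcb.le Finset.subset_union_left).tail
          ⟨detourArc_return, Finset.mem_union_right _ (Finset.mem_insert_self _ _)⟩).trans
          (lowOut Y m le_rfl ((Finset.subset_insert _ _).trans Finset.subset_union_right))
      have hYb : q b ∉ Y := fun hmem => (Finset.mem_union.mp hmem).elim
        (fun hmem => by have := himg b le_rfl k c hcb.le hmem; omega) (low_b 1)
      refine ⟨Y, hreach, ?_⟩
      by_cases h3 : I.card = 3 * C.card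
      · obtain ⟨l, hl, hcl⟩ := hC4 h3 c hc
        have hlJ := hJpriv (hIJ hl)
        have hlb := h.lt_b hlJ
        have hYl : q l ∉ Y := fun hmem => (Finset.mem_union.mp hmem).elim
          (fun hmem => by have := himg l hlb.le k c hcb.le hmem; omega) fun hmem =>
          (Finset.mem_insert.mp hmem).elim (h.ne_path hlJ (by omega)) fun hmem => by
            have := himg l hlb.le 1 m hmb.le hmem
            omega
        have := card_add_two_le hYX hXb (hqX l (by omega) hlb.le (.inr (by omega))) hYb hYl
          fun e => by have := hqinj b l le_rfl hlb.le e; omega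
        omega
      · have := card_add_one_le hYX hXb hYb
        have := hX2 h3
        omega
  have arcMem : ∀ u v, detourArc p q a b m k u v →
      u ∈ S ∪ X ∧ v ∈ S ∪ X ∧ (u ∈ X ∨ v ∈ X) := by
    have hpS : ∀ i, i ≤ a → p i ∈ S ∪ X := by
      intro i hia
      rcases Nat.eq_zero_or_pos i with rfl | hi
      exacts [Finset.mem_union_left _ h.geo_p.zero_mem, Finset.mem_union_right _ (hpX i hi hia)]
    have hqS : ∀ j, j ≤ b → (j ≤ m ∨ k ≤ j) → q j ∈ S ∪ X := by
      intro j hjb hjm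
      rcases Nat.eq_zero_or_pos j with rfl | hj
      exacts [Finset.mem_union_left _ h.geo_q.zero_mem,
        Finset.mem_union_right _ (hqX j hj hjb hjm)]
    rintro u v (⟨i, hi, rfl, rfl⟩ | ⟨j, hj, hjk, rfl, rfl⟩ | ⟨rfl, rfl⟩ | ⟨rfl, rfl⟩)
    · exact ⟨hpS _ hi.le, hpS _ hi, .inr (hpX _ (by omega) hi)⟩
    · exact ⟨hqS _ hj (by omega), hqS _ hj.le (by omega), .inl (hqX _ (by omega) hj (by omega))⟩
    · exact ⟨Finset.mem_union_right _ hXk, hpS 1 (by omega), .inl hXk⟩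
    · exact ⟨hpS 1 (by omega), Finset.mem_union_right _ hXm, .inr hXm⟩
  -- walks from a center on the lower part of `q`
  have lowPair : ∀ c ∈ C, c < m → ∀ z ∈ X, ∃ Y ⊆ X, ∃ Y' ⊆ X,
      Relation.ReflTransGen (fun u v => detourArc p q a b m k u v ∧ u ∈ Y) (q c) (q 0) ∧
      Relation.ReflTransGen (fun u v => detourArc p q a b m k u v ∧ v ∈ Y') (p 0) z ∧
        (Y ∪ Y').card + 1 ≤ X.card ∧ (z ∈ C.image q → (Y ∪ Y').card + 2 ≤ X.card) := by
    intro c hc hcm z hz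
    have hcb := h.lt_b (hCpriv hc)
    have hYX := himgX 1 c le_rfl hcb.le (.inl hcm.le)
    have hYm : q m ∉ (Finset.Icc 1 c).image q := fun hmem => by
      have := himg m hmb.le 1 c hcb.le hmem
      omega
    have hYk : q k ∉ (Finset.Icc 1 c).image q := fun hmem => by
      have := himg k hkb.le 1 c hcb.le hmem
      omega
    have hYb : q b ∉ (Finset.Icc 1 c).image q := fun hmem => by
      have := himg b le_rfl 1 c hcb.le hmem
      omega
    refine ⟨_, hYX, ?_⟩
    rcases hXcases z hz with ⟨i, hi, hia, rfl⟩ | ⟨j, hj, hjb, hjm | hkj, rfl⟩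
    · refine ⟨_, pathX, lowOut _ c hcm.le subset_rfl, pathIn _ subset_rfl i hia,
        card_add_one_le (Finset.union_subset hYX pathX) hXm
          (fun hmem => (Finset.mem_union.mp hmem).elim hYm (hpath_priv m hm')), fun hzC => ?_⟩
      obtain ⟨d, hd, e⟩ := Finset.mem_image.mp hzC
      exact absurd e (h.ne_path (hCpriv hd) hia)
    · have := card_add_two_le (Finset.union_subset hYX (lowX j hj)) hXk hXb
        (fun hmem => (Finset.mem_union.mp hmem).elim hYk (low_k j))
        (fun hmem => (Finset.mem_union.mp hmem).elim hYb (low_b j)) hqkb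
      exact ⟨_, lowX j hj, lowOut _ c hcm.le subset_rfl, lowIn j hjm, by omega, fun _ => this⟩
    · refine ⟨_, highX j hkj, lowOut _ c hcm.le subset_rfl, highIn j hkj hjb.le,
        card_add_one_le (Finset.union_subset hYX (highX j hkj)) hXm
          (fun hmem => (Finset.mem_union.mp hmem).elim hYm (high_m j hkj)), fun hzC => ?_⟩
      obtain ⟨d, hd, e⟩ := Finset.mem_image.mp hzC
      obtain rfl := hqinj d j (h.lt_b (hCpriv hd)).le hjb.le e
      have := hIne (hCI hd)
      exact card_add_two_le (Finset.union_subset hYX (highX d hkj)) hXm hXk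
        (fun hmem => (Finset.mem_union.mp hmem).elim hYm (high_m d hkj))
        (fun hmem => (Finset.mem_union.mp hmem).elim hYk (high_k d (by omega))) hqmk
  have highDirect : ∀ c ∈ C, k < c → ∀ z ∈ X,
      Relation.ReflTransGen (fun u v => detourArc p q a b m k u v ∧ u ∈ X) (q c) z := by
    intro c hc hkc z hz
    have hcb := h.lt_b (hCpriv hc)
    have h1 := highOut X c hkc.le hcb.le (himgX k c (by omega) hcb.le (.inr le_rfl))
    rcases hXcases z hz with ⟨i, hi, hia, rfl⟩ | ⟨j, hj, hjb, hjm | hkj, rfl⟩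
    · exact h1.trans (pathOut 1 le_rfl (by omega) i hi hia)
    · refine (h1.tail ⟨detourArc_return, hpX 1 le_rfl (by omega)⟩).trans ?_
      exact back_sources (fun l _ hl => detourArc_back l (by omega) (.inr (by omega))) hjm
        fun l hl hlm => hqX l (by omega) (by omega) (.inl hlm)
    · refine h1.trans ((pathOut 1 le_rfl (by omega) a (by omega) le_rfl).trans ?_)
      rw [← h.top]
      exact back_sources (fun l hl hlb => detourArc_back l hlb (.inl (by omega))) hjb.le
        fun l hl hlb => hqX l (by omega) hlb (.inr (by omega))
  obtain ⟨A', D', α', β', B', hcore⟩ := hc.extend (X := X) (C := C.image q)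
    (T := detourArc p q a b m k)
    (a := fun z => if z ∈ C.image q then 2 else 0) (b := fun z => if z ∈ C.image q then 2 else 1)
    (p := p 0) (q := q 0) (R := 6 * C.card + 2) h.geo_p.zero_mem h.geo_q.zero_mem
    (h.disjoint_union_private hJpriv)
    (fun x hx => Finset.mem_union_right _ (Finset.image_subset_image (hCI.trans hIJ) hx))
    (by omega) (by rw [hCc])
    (h.pairwise_not_near_image hCpriv fun c hc d hd hcd => (hC3 c hc d hd hcd).1)
    (fun x hx s hs => by
      obtain ⟨c, hc, rfl⟩ := Finset.mem_image.mp hx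
      exact (mem_freeIdx.mp (hIfree (hCI hc))).2 s hs)
    (fun u v huv => (h.upward_of_detourArc hm hk huv).1)
    (fun u v huv => (arcMem u v huv).1) (fun u v huv => (arcMem u v huv).2.1)
    (fun u v huv => (arcMem u v huv).2.2)
    (fun u v huv => h.detourArc_asymm hm hk hmk huv)
    (fun c hc => by simp only [hc, if_true]) (fun c hc => by simp only [hc, if_true])
    (fun z _ => by split_ifs <;> omega)
    (fun z _ => by split_ifs <;> omega)
    (fun z _ => by split_ifs <;> omega)
    (by omega)
    (fun z hz => by
      by_cases hzC : z ∈ C.image q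
      · obtain ⟨c, hc, rfl⟩ := Finset.mem_image.mp hzC
        obtain ⟨Y, hr, h1⟩ := outCenter c hc
        exact ⟨Y, hr, by simp only [hzC, if_true]; omega⟩
      · exact ⟨X, outAll z hz, by simp only [hzC, if_false]; omega⟩)
    (fun z hz => by
      obtain ⟨Y, hY, hr, h1, h2⟩ := inAll z hz
      refine ⟨Y, hr, ?_⟩
      by_cases hzC : z ∈ C.image q
      · have := h2 hzC
        simp only [hzC, if_true]
        omega
      · simp only [hzC, if_false]
        omega)
    (fun z hz z' hz' => by
      by_cases hzC : z ∈ C.image q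
      · obtain ⟨c, hc, rfl⟩ := Finset.mem_image.mp hzC
        rcases hIne (hCI hc) with hcm | hkc
        · obtain ⟨Y, hYX, Y', hYX', hr, hr', h1, h2⟩ := lowPair c hc hcm z' hz'
          refine .inr ⟨Y, hYX, Y', hYX', hr, hr', ?_⟩
          by_cases hzC' : z' ∈ C.image q
          · have := h2 hzC'
            simp only [hzC, hzC', if_true]
            omega
          · simp only [hzC, hzC', if_true, if_false]
            omega
        · exact .inl (highDirect c hc hkc z' hz')
      · obtain ⟨Y, hY, hr, -, -⟩ := inAll z' hz'
        refine .inr ⟨X, subset_rfl, Y, hY, outAll z hz, hr, ?_⟩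
        rw [Finset.union_eq_left.mpr hY]
        simp only [hzC, if_false]
        split_ifs <;> omega)
  exact ⟨_, A', D', α', β', B', h.card_lt_card_union hJpriv, hcore⟩

end EarPair

namespace EarPair

variable {V : Type*} [DecidableEq V] {G : SimpleGraph V} {L : ℕ} {S A : Finset V}
  {a b hp hq : ℕ} {p q : ℕ → V} {D : V → V → Prop} {α β : V → ℕ} {B : ℕ}

theorem disjoint_free_blocked {j : ℕ} (h : j ∈ freeIdx G A p q a b hq) :
    j ∉ blockedIdx G A p q a b hq :=
  fun h' => by
    obtain ⟨s, hs, hn⟩ := (mem_blockedIdx.mp h').2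
    exact (mem_freeIdx.mp h).2 s hs hn

/-- A pair of geodesics of length about `3 * L` allows to enlarge the core. -/
theorem extend (h : EarPair G L S A a b hp hq p q) (hc : Core G L S A D α β B)
    (hβ : 2 ≤ β (p 0) + hp) (hα0 : hp = 0 → 2 ≤ α (q 0) + hq)
    (hα : 2 ≤ α (q 0) + 2 * hq) :
    ∃ S' A' D' α' β' B', S.card < S'.card ∧ Core G L S' A' D' α' β' B' := by
  set F := freeIdx G A p q a b hq with hF
  set W := blockedIdx G A p q a b hq with hW
  have hp1 := h.hp_le
  rcases le_or_gt (F.card + W.card + hp) (3 * L) with h1 | h1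
  · exact h.extend_of_few_free hc hβ hα0 hα h1
  rcases le_or_gt W.card 1 with h2 | h2
  · exact h.extend_of_blocked_le_one hc hβ hα0 hα (by rw [← hF]; omega) h2
  have hne : W.Nonempty := Finset.card_pos.mp (by omega)
  have h0 : hp = 0 := by
    by_contra hne0
    have := h.card_blockedIdx_eq_zero (by omega)
    rw [← hW] at this
    omega
  have hm := W.min'_mem hne
  have hk := W.max'_mem hne
  have hmin : ∀ j ∈ W, W.min' hne ≤ j := fun j hj => W.min'_le j hj
  have hmax : ∀ j ∈ W, j ≤ W.max' hne := fun j hj => W.le_max' j hj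
  have hmk := h.blocked_le_add_two hm hk
  generalize W.min' hne = m at *
  generalize W.max' hne = k at *
  have hWsub : W ⊆ Finset.Icc m k := fun j hj => Finset.mem_Icc.mpr ⟨hmin j hj, hmax j hj⟩
  have hmid : W.card + (F.filter fun j => ¬ (j ≤ m ∨ k ≤ j)).card ≤ k + 1 - m := by
    rw [← Finset.card_union_of_disjoint, ← Nat.card_Icc]
    · refine Finset.card_le_card (Finset.union_subset hWsub fun j hj => ?_)
      have := (Finset.mem_filter.mp hj).2
      exact Finset.mem_Icc.mpr (by omega)
    · rw [Finset.disjoint_left]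
      exact fun j hj hj' => disjoint_free_blocked (Finset.mem_filter.mp hj').1 hj
  have hsplit := Finset.card_filter_add_card_filter_not (s := F) (fun j => j ≤ m ∨ k ≤ j)
  exact h.extend_of_detour hc hβ hα0 hm hk (by omega) hmin hmax (by rw [← hF]; omega)

end EarPair

theorem exists_dWalk_of_connected {V : Type*} {G : SimpleGraph V} (hG : G.Connected) (u v : V) :
    ∃ n, DWalk G.Adj n u v :=
  DWalk.of_reflTransGen ((G.reachable_iff_reflTransGen u v).mp (hG.preconnected u v))

theorem Bridgeless.reflTransGen {V : Type*} {G : SimpleGraph V} (hG : Bridgeless G) {u v : V} :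
    Relation.ReflTransGen (fun x y => G.Adj x y ∧ s(x, y) ≠ s(u, v)) u v := by
  have h := hG.2 s(u, v)
  rw [isBridge_iff, not_not, reachable_iff_reflTransGen] at h
  exact Relation.ReflTransGen.mono (fun x y hxy => by simpa using hxy) _ _ h

namespace Geo

variable {V : Type*} {G : SimpleGraph V} {S : Finset V} {a : ℕ} {p : ℕ → V}

theorem exists_upward_walk (h : Geo G.Adj S a p) (hG : Bridgeless G) :
    ∃ s ∈ S, ∃ n, DWalk (upward G p a) n (p a) s := by
  classical
  by_contra hcon
  have hR : ∀ s ∈ S, ¬ Relation.ReflTransGen (upward G p a) (p a) s :=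
    fun s hs hr => hcon ⟨s, hs, DWalk.of_reflTransGen hr⟩
  have hex : ∃ i, i ≤ a ∧ Relation.ReflTransGen (upward G p a) (p a) (p i) := ⟨a, le_rfl, .refl⟩
  obtain ⟨hia, hi⟩ := Nat.find_spec hex
  have hmin : ∀ j, j ≤ a → Relation.ReflTransGen (upward G p a) (p a) (p j) →
      Nat.find hex ≤ j := fun j hj hr => Nat.find_min' hex ⟨hj, hr⟩
  generalize Nat.find hex = i at *
  rcases i with _ | i
  · exact hR _ h.zero_mem hi
  have key : ∀ y, Relation.ReflTransGen
      (fun x y => G.Adj x y ∧ s(x, y) ≠ s(p (i + 1), p i)) (p (i + 1)) y →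
      Relation.ReflTransGen (upward G p a) (p a) y := by
    intro y hy
    induction hy with
    | refl => exact hi
    | @tail x y _ hxy ih =>
      by_cases hup : ∃ j < a, x = p (j + 1) ∧ y = p j
      · obtain ⟨j, hj, rfl, rfl⟩ := hup
        have h1 := hmin _ (by omega) ih
        have h2 : i ≠ j := fun e => hxy.2 (by rw [e])
        exact hi.trans (reflTransGen_chain_up (by omega) fun l _ hl => h.upward_path (by omega))
      · exact ih.tail ⟨hxy.1, hup⟩
  have := hmin i (by omega) (key _ hG.reflTransGen)
  omega

end Geo

namespace Core

variable {V : Type*} {G : SimpleGraph V} {L : ℕ} {S A : Finset V} {D : V → V → Prop}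
  {α β : V → ℕ} {B : ℕ}

theorem exists_larger [DecidableEq V] (hc : Core G L S A D α β B) (hG : Bridgeless G)
    (hL : 1 ≤ L) (hS : S.Nonempty) {x : V}
    (hx : ∀ n ≤ 3 * L, ∀ s ∈ S, ¬ DWalk G.Adj n x s) :
    ∃ S' A' D' α' β' B', S.card < S'.card ∧ Core G L S' A' D' α' β' B' := by
  obtain ⟨s, hs⟩ := hS
  obtain ⟨n, hn⟩ := exists_dWalk_of_connected hG.1 x s
  obtain ⟨c, p, hgeo, rfl, -, hpref⟩ := Geo.exists_of_walk A hc.subset hs hn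
  have hlen : 3 * L < c := by
    by_contra hle
    exact hx c (by omega) _ hgeo.zero_mem (by simpa using hgeo.walk (Nat.zero_le c) le_rfl)
  obtain ⟨a, hp, ha, hcp⟩ : ∃ a hp, a + hp = 3 * L ∧ ((hp = 0 ∧ p 0 ∈ A) ∨
      (hp = 1 ∧ ∀ i ≤ a, ∀ s ∈ A, ¬ DWalk G.Adj i (p i) s)) := by
    rcases hpref with h | h
    · exact ⟨3 * L, 0, rfl, .inl ⟨rfl, h⟩⟩
    · exact ⟨3 * L - 1, 1, by omega, .inr ⟨rfl, fun i hi => h i (by omega)⟩⟩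
  have hgp : Geo G.Adj S a p := hgeo.restrict (by omega)
  obtain ⟨t, ht, m, hm⟩ := hgp.exists_upward_walk hG
  obtain ⟨b, q, hgq, hqb, -, hprefq⟩ := Geo.exists_of_walk A hc.subset ht hm
  obtain ⟨hq, hcq, hq0⟩ : ∃ hq, (hq = 0 ∨
      (hq = 1 ∧ ∀ j ≤ b, ∀ s ∈ A, ¬ DWalk (upward G p a) j (q j) s)) ∧
      (q 0 ∈ A ∨ hq = 1) := by
    rcases hprefq with h | h
    · exact ⟨0, .inl rfl, .inl h⟩
    · exact ⟨1, .inr ⟨rfl, h⟩, .inr rfl⟩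
  have hear : EarPair G L S A a b hp hq p q :=
    ⟨hL, hc.subset, hgp, hgq, hqb, ha, hcp, hcq⟩
  have key : ∀ (D : V → V → Prop) (α β : V → ℕ), Core G L S A D α β B →
      2 ≤ β (p 0) + hp → (hp = 0 → 2 ≤ α (q 0) + hq) →
      ∃ S' A' D' α' β' B', S.card < S'.card ∧ Core G L S' A' D' α' β' B' := by
    intro D α β hc h1 h2
    refine hear.extend hc h1 h2 ?_
    rcases hq0 with h | h
    · have := hc.center_out _ h
      omega
    · omega
  rcases hcp with ⟨h0, hpA⟩ | ⟨h1, -⟩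
  · rcases hq0 with h | h
    · exact key D α β hc (by have := hc.center_in _ hpA; omega)
        fun _ => by have := hc.center_out _ h; omega
    · rcases hc.slack _ hgq.zero_mem with hs | hs
      · exact key D α β hc (by have := hc.center_in _ hpA; omega) fun _ => by omega
      · exact key _ β α hc.swap (by have := hc.center_out _ hpA; omega) fun _ => by omega
  · rcases hc.slack _ hgp.zero_mem with hs | hs
    · exact key _ β α hc.swap (by omega) fun _ => by omega
    · exact key D α β hc (by omega) fun _ => by omega

/-- There is a core which every vertex reaches within `3 * L` steps. -/
theorem exists_dominating [Fintype V] (hG : Bridgeless G) (hL : 1 ≤ L) :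
    ∃ (S A : Finset V) (D : V → V → Prop) (α β : V → ℕ) (B : ℕ), S.Nonempty ∧
      Core G L S A D α β B ∧ ∀ x, ∃ s ∈ S, DWithin G.Adj (3 * L) x s := by
  classical
  have hV := hG.1.nonempty
  have key : ∀ n (S A : Finset V) (D : V → V → Prop) (α β : V → ℕ) (B : ℕ), S.Nonempty →
      Core G L S A D α β B → Fintype.card V ≤ S.card + n →
      ∃ (S A : Finset V) (D : V → V → Prop) (α β : V → ℕ) (B : ℕ), S.Nonempty ∧
        Core G L S A D α β B ∧ ∀ x, ∃ s ∈ S, DWithin G.Adj (3 * L) x s := by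
    intro n
    induction n with
    | zero =>
      intro S A D α β B hS hc hn
      refine ⟨S, A, D, α, β, B, hS, hc, fun x => ⟨x, ?_, .refl _ _⟩⟩
      rw [Finset.eq_univ_of_card S (le_antisymm (Finset.card_le_univ S) hn)]
      exact Finset.mem_univ x
    | succ n ih =>
      intro S A D α β B hS hc hn
      by_cases hd : ∀ x, ∃ s ∈ S, DWithin G.Adj (3 * L) x s
      · exact ⟨S, A, D, α, β, B, hS, hc, hd⟩
      · push Not at hd
        obtain ⟨x, hx⟩ := hd
        obtain ⟨S', A', D', α', β', B', hlt, hc'⟩ :=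
          hc.exists_larger hG hL hS (x := x) fun n hn s hs hw => hx s hs ⟨n, hn, hw⟩
        exact ih S' A' D' α' β' B' (Finset.card_pos.mp (by omega)) hc' (by omega)
  obtain ⟨s⟩ := hV
  exact key (Fintype.card V) {s} {s} _ _ _ 6 (Finset.singleton_nonempty s)
    (Core.singleton G s) (by omega)

end Core

/-! ### Orienting the vertices adjacent to a set -/

/-- The adjacency relation of `G` without the edge between `u` and `v`. -/
def avoiding {V : Type*} (G : SimpleGraph V) (u v x y : V) : Prop :=
  G.Adj x y ∧ s(x, y) ≠ s(u, v)

section Avoiding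

variable {V : Type*} {G : SimpleGraph V} {S : Finset V} {u v : V}

theorem avoiding_symm {x y : V} (h : avoiding G u v x y) : avoiding G u v y x :=
  ⟨h.1.symm, by rw [Sym2.eq_swap]; exact h.2⟩

theorem avoiding_walk_symm {n : ℕ} {x y : V} (h : DWalk (avoiding G u v) n x y) :
    DWalk (avoiding G u v) n y x :=
  h.swap.mono fun _ _ => avoiding_symm

theorem avoiding_walk_or (hu : u ∈ S) {n : ℕ} {x s : V} (hs : s ∈ S) (hw : DWalk G.Adj n x s) :
    (∃ t ∈ S, DWithin (avoiding G u v) n x t) ∨ ∃ m < n, DWalk (avoiding G u v) m x v := by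
  induction n generalizing x with
  | zero => exact .inl ⟨s, hs, 0, le_rfl, hw⟩
  | succ n ih =>
    obtain ⟨w, hxw, hws⟩ := hw
    by_cases he : s(x, w) = s(u, v)
    · rcases Sym2.eq_iff.mp he with ⟨rfl, -⟩ | ⟨rfl, -⟩
      · exact .inl ⟨x, hu, .refl _ _⟩
      · exact .inr ⟨0, by omega, rfl⟩
    · rcases ih hws with ⟨t, ht, k, hk, hwt⟩ | ⟨m, hm, hwv⟩
      · exact .inl ⟨t, ht, k + 1, by omega, w, ⟨hxw, he⟩, hwt⟩
      · exact .inr ⟨m + 1, by omega, w, ⟨hxw, he⟩, hwv⟩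

theorem exists_avoiding_walk (hG : Bridgeless G) (hu : u ∈ S) {r : ℕ}
    (hr : ∀ x, ∃ s ∈ S, DWithin G.Adj r x s) :
    ∃ s ∈ S, DWithin (avoiding G u v) (2 * r) v s := by
  have hnf : ∀ x, (∃ t ∈ S, DWithin (avoiding G u v) r x t) ∨
      ∃ m < r, DWalk (avoiding G u v) m x v := by
    intro x
    obtain ⟨s, hs, n, hn, hw⟩ := hr x
    rcases avoiding_walk_or (v := v) hu hs hw with ⟨t, ht, h⟩ | ⟨m, hm, h⟩
    · exact .inl ⟨t, ht, h.le hn⟩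
    · exact .inr ⟨m, by omega, h⟩
  have key : ∀ y, Relation.ReflTransGen (avoiding G u v) y u →
      (∃ m < r, DWalk (avoiding G u v) m y v) →
      ∃ s ∈ S, DWithin (avoiding G u v) (2 * r) v s := by
    intro y hy
    induction hy using Relation.ReflTransGen.head_induction_on with
    | refl =>
      rintro ⟨m, hm, hw⟩
      exact ⟨u, hu, m, by omega, avoiding_walk_symm hw⟩
    | head hyz _ ih =>
      rintro ⟨m, hm, hw⟩
      rcases hnf _ with ⟨t, ht, k, hk, hzt⟩ | hfar
      · exact ⟨t, ht, m + 1 + k, by omega,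
          ((avoiding_walk_symm hw).append (.single hyz)).append hzt⟩
      · exact ih hfar
  have hvu : Relation.ReflTransGen (avoiding G u v) v u := by
    have := hG.reflTransGen (u := v) (v := u)
    rwa [Sym2.eq_swap] at this
  rcases hnf v with ⟨t, ht, h⟩ | h
  · exact ⟨t, ht, h.le (by omega)⟩
  · exact key v hvu h

end Avoiding

/-- A partial orientation `T` of edges meeting a set `Y` disjoint from `S`, such that each
`y ∈ Y` is reached from `S` in `i y` steps and reaches `S` in `o y` steps. -/
structure Fringe {V : Type*} (G : SimpleGraph V) (S : Finset V) (r : ℕ) (Y : Finset V)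
    (T : V → V → Prop) (i o : V → ℕ) : Prop where
  disj : ∀ y ∈ Y, y ∉ S
  adj : ∀ x y, T x y → G.Adj x y
  left_mem : ∀ x y, T x y → x ∈ S ∨ x ∈ Y
  right_mem : ∀ x y, T x y → y ∈ S ∨ y ∈ Y
  meets : ∀ x y, T x y → x ∈ Y ∨ y ∈ Y
  asymm : ∀ x y, T x y → ¬ T y x
  from_base : ∀ y ∈ Y, ∃ s ∈ S, DWithin T (i y) s y
  to_base : ∀ y ∈ Y, ∃ s ∈ S, DWithin T (o y) y s
  add_le : ∀ y ∈ Y, i y + o y ≤ 2 * r + 1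
  one_le_in : ∀ y ∈ Y, 1 ≤ i y
  one_le_out : ∀ y ∈ Y, 1 ≤ o y
  short : ∀ y ∈ Y, ∀ n, ∀ s ∈ S, DWalk G.Adj n y s → i y ≤ n ∨ o y ≤ n

namespace Fringe

variable {V : Type*} {G : SimpleGraph V} {S Y : Finset V} {r : ℕ} {T : V → V → Prop}
  {i o : V → ℕ}

theorem empty (G : SimpleGraph V) (S : Finset V) (r : ℕ) :
    Fringe G S r ∅ (fun _ _ => False) (fun _ => 0) (fun _ => 0) := by
  constructor <;> simp

theorem swap (h : Fringe G S r Y T i o) : Fringe G S r Y (fun x y => T y x) o i where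
  disj := h.disj
  adj x y hxy := (h.adj y x hxy).symm
  left_mem x y hxy := h.right_mem y x hxy
  right_mem x y hxy := h.left_mem y x hxy
  meets x y hxy := (h.meets y x hxy).symm
  asymm x y hxy := h.asymm y x hxy
  from_base y hy := by
    obtain ⟨s, hs, hw⟩ := h.to_base y hy
    exact ⟨s, hs, hw.swap⟩
  to_base y hy := by
    obtain ⟨s, hs, hw⟩ := h.from_base y hy
    exact ⟨s, hs, hw.swap⟩
  add_le y hy := by have := h.add_le y hy; omega
  one_le_in := h.one_le_out
  one_le_out := h.one_le_in
  short y hy n s hs hw := (h.short y hy n s hs hw).symm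

theorem add_ear [DecidableEq V] (h : Fringe G S r Y T i o) {u v : V} {q : ℕ → V} {b c : ℕ}
    (huv : G.Adj u v) (hu : u ∈ S) (hgeo : Geo (avoiding G u v) S b q) (hqb : q b = v)
    (hb : b ≤ 2 * r) (hcb : c < b) (hnew : ∀ j, c < j → j ≤ b → q j ∉ S ∧ q j ∉ Y)
    (hc : q c ∈ S ∨ q c ∈ Y ∧ o (q c) ≤ c) :
    ∃ Y' T' i' o', Y.card < Y'.card ∧ Fringe G S r Y' T' i' o' := by
  set N := (Finset.Ioc c b).image q with hN
  have hmemN : ∀ {y}, y ∈ N ↔ ∃ j, (c < j ∧ j ≤ b) ∧ q j = y := by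
    intro y
    simp [hN]
  have hqN : ∀ j, c < j → j ≤ b → q j ∈ N := fun j h1 h2 => hmemN.mpr ⟨j, ⟨h1, h2⟩, rfl⟩
  have hNS : ∀ y ∈ N, y ∉ S := by
    intro y hy
    obtain ⟨j, hj, rfl⟩ := hmemN.mp hy
    exact (hnew j hj.1 hj.2).1
  have hNY : ∀ y ∈ N, y ∉ Y := by
    intro y hy
    obtain ⟨j, hj, rfl⟩ := hmemN.mp hy
    exact (hnew j hj.1 hj.2).2
  obtain ⟨w, hwc, hwS, hwY⟩ : ∃ w, w ≤ c ∧ (q c ∈ S → w = 0) ∧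
      (∃ s ∈ S, DWithin T w (q c) s) := by
    by_cases hcS : q c ∈ S
    · exact ⟨0, by omega, fun _ => rfl, q c, hcS, .refl _ _⟩
    · obtain ⟨hcY, hoc⟩ := hc.resolve_left hcS
      exact ⟨o (q c), hoc, fun h => absurd h hcS, h.to_base _ hcY⟩
  have hsrc : q c ∈ S ∨ q c ∈ Y := hc.imp id And.left
  let idx : V → ℕ := fun y => Function.invFunOn q (Set.Icc 0 b) y
  have hidx : ∀ j, j ≤ b → idx (q j) = j := by
    intro j hj
    have h1 : q j ∈ q '' Set.Icc 0 b := ⟨j, by simpa using hj, rfl⟩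
    have h2 := Function.invFunOn_mem h1
    have h3 := Function.invFunOn_eq h1
    exact hgeo.inj (Set.mem_Icc.mp h2).2 hj h3
  let P : V → V → Prop := fun x y =>
    (x = u ∧ y = v) ∨ ∃ j, (c ≤ j ∧ j < b) ∧ x = q (j + 1) ∧ y = q j
  have hPN : ∀ x y, P x y → x ∈ N ∨ y ∈ N := by
    rintro x y (⟨rfl, rfl⟩ | ⟨j, hj, rfl, rfl⟩)
    · exact .inr (hqb ▸ hqN b hcb le_rfl)
    · exact .inl (hqN _ (by omega) (by omega))
  have hold : ∀ x y, T x y → x ∉ N ∧ y ∉ N := fun x y hxy =>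
    ⟨fun hx => (h.left_mem x y hxy).elim (hNS x hx) (hNY x hx),
      fun hy => (h.right_mem x y hxy).elim (hNS y hy) (hNY y hy)⟩
  have hmono : ∀ {k x y}, DWithin T k x y → DWithin (fun x y => T x y ∨ P x y) k x y :=
    fun hk => hk.mono fun _ _ => Or.inl
  have hPs : ∀ x y, P x y → ¬ P y x := by
    rintro x y (⟨rfl, rfl⟩ | ⟨j, hj, rfl, rfl⟩) (⟨e1, e2⟩ | ⟨k, hk, e1, e2⟩)
    · exact huv.ne e2
    · refine (hgeo.step k hk.2).2 ?_
      rw [← e1, ← e2, Sym2.eq_swap]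
    · refine (hgeo.step j hj.2).2 ?_
      rw [e1, e2, Sym2.eq_swap]
    · have h1 := hgeo.inj (by omega) (by omega) e1
      have h2 := hgeo.inj (by omega) (by omega) e2
      omega
  refine ⟨Y ∪ N, fun x y => T x y ∨ P x y, fun y => if y ∈ N then b + 1 - idx y else i y,
    fun y => if y ∈ N then idx y - c + w else o y, ?_, ?_⟩
  · rw [Finset.card_union_of_disjoint
      (Finset.disjoint_left.mpr fun y hy hy' => hNY y hy' hy)]
    have : 0 < N.card := Finset.card_pos.mpr ⟨_, hqN b hcb le_rfl⟩
    omega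
  · have hcases : ∀ {Q : V → Prop}, (∀ y ∈ Y, y ∉ N → Q y) →
        (∀ j, c < j → j ≤ b → q j ∈ N → Q (q j)) → ∀ y ∈ Y ∪ N, Q y := by
      intro Q h1 h2 y hy
      by_cases hyN : y ∈ N
      · obtain ⟨j, hj, rfl⟩ := hmemN.mp hyN
        exact h2 j hj.1 hj.2 hyN
      · exact h1 y ((Finset.mem_union.mp hy).resolve_right hyN) hyN
    constructor
    · exact hcases (fun y hy _ => h.disj y hy) fun j _ _ hj => hNS _ hj
    · rintro x y (hxy | ⟨rfl, rfl⟩ | ⟨j, hj, rfl, rfl⟩)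
      exacts [h.adj x y hxy, huv, (hgeo.step j hj.2).1]
    · rintro x y (hxy | ⟨rfl, rfl⟩ | ⟨j, hj, rfl, rfl⟩)
      · exact (h.left_mem x y hxy).imp id (Finset.mem_union_left _)
      · exact .inl hu
      · exact .inr (Finset.mem_union_right _ (hqN _ (by omega) (by omega)))
    · rintro x y (hxy | ⟨rfl, rfl⟩ | ⟨j, hj, rfl, rfl⟩)
      · exact (h.right_mem x y hxy).imp id (Finset.mem_union_left _)
      · exact .inr (Finset.mem_union_right _ (hqb ▸ hqN b hcb le_rfl))
      · rcases hj.1.eq_or_lt with rfl | hlt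
        · exact hsrc.imp id (Finset.mem_union_left _)
        · exact .inr (Finset.mem_union_right _ (hqN _ hlt (by omega)))
    · rintro x y (hxy | hxy)
      · exact (h.meets x y hxy).imp (Finset.mem_union_left _) (Finset.mem_union_left _)
      · exact (hPN x y hxy).imp (Finset.mem_union_right _) (Finset.mem_union_right _)
    · rintro x y (hxy | hxy) (hyx | hyx)
      · exact h.asymm x y hxy hyx
      · exact (hPN y x hyx).elim (hold x y hxy).2 (hold x y hxy).1
      · exact (hPN x y hxy).elim (hold y x hyx).2 (hold y x hyx).1
      · exact hPs x y hxy hyx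
    · refine hcases (fun y hy hyN => ?_) fun j hcj hjb hj => ?_
      · obtain ⟨s, hs, hw⟩ := h.from_base y hy
        exact ⟨s, hs, by simpa [hyN] using hmono hw⟩
      · refine ⟨u, hu, 1 + (b - j), ?_, (DWalk.single ?_).append (v := q b)
          (DWalk.of_fun q hjb fun l _ hl => ?_)⟩
        · simp only [hj, if_true, hidx j hjb]
          omega
        · exact .inr (.inl ⟨rfl, hqb⟩)
        · exact .inr (.inr ⟨l, ⟨by omega, hl⟩, rfl, rfl⟩)
    · refine hcases (fun y hy hyN => ?_) fun j hcj hjb hj => ?_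
      · obtain ⟨s, hs, hw⟩ := h.to_base y hy
        exact ⟨s, hs, by simpa [hyN] using hmono hw⟩
      · obtain ⟨s, hs, hw⟩ := hwY
        refine ⟨s, hs, ?_⟩
        simp only [hj, if_true, hidx j hjb]
        refine DWithin.trans ⟨j - c, le_rfl, DWalk.of_fun q hcj.le fun l _ hl => ?_⟩ (hmono hw)
        exact .inr (.inr ⟨l, ⟨by omega, by omega⟩, rfl, rfl⟩)
    · refine hcases (fun y hy hyN => ?_) fun j hcj hjb hj => ?_
      · simpa [hyN] using h.add_le y hy
      · simp only [hj, if_true, hidx j hjb]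
        omega
    · refine hcases (fun y hy hyN => ?_) fun j hcj hjb hj => ?_
      · simpa [hyN] using h.one_le_in y hy
      · simp only [hj, if_true, hidx j hjb]
        omega
    · refine hcases (fun y hy hyN => ?_) fun j hcj hjb hj => ?_
      · simpa [hyN] using h.one_le_out y hy
      · simp only [hj, if_true, hidx j hjb]
        omega
    · refine hcases (fun y hy hyN => ?_) fun j hcj hjb hj => ?_
      · simpa [hyN] using h.short y hy
      · intro n s hs hw
        simp only [hj, if_true, hidx j hjb]
        rcases avoiding_walk_or (v := v) hu hs hw with ⟨t, ht, m, hm, hmt⟩ | ⟨m, hm, hmv⟩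
        · have := hgeo.le j hjb m t ht hmt
          omega
        · rw [← hqb] at hgeo hmv
          have := hgeo.le_add hjb le_rfl (avoiding_walk_symm hmv)
          omega

theorem exists_larger [DecidableEq V] (h : Fringe G S r Y T i o) (hG : Bridgeless G)
    (hr : ∀ x, ∃ s ∈ S, DWithin G.Adj r x s) {u v : V} (huv : G.Adj u v) (hu : u ∈ S)
    (hvS : v ∉ S) (hvY : v ∉ Y) :
    ∃ Y' T' i' o', Y.card < Y'.card ∧ Fringe G S r Y' T' i' o' := by
  obtain ⟨s, hs, n, hn, hw⟩ := exists_avoiding_walk (v := v) hG hu hr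
  obtain ⟨b, q, hgeo, hqb, hbn, -⟩ := Geo.exists_of_walk ∅ (by simp) hs hw
  have hex : ∃ k, k ≤ b ∧ (q (b - k) ∈ S ∨ q (b - k) ∈ Y) :=
    ⟨b, le_rfl, .inl (by simpa using hgeo.zero_mem)⟩
  obtain ⟨hkb, hk⟩ := Nat.find_spec hex
  have hmin : ∀ m, m < Nat.find hex → ¬ (m ≤ b ∧ (q (b - m) ∈ S ∨ q (b - m) ∈ Y)) :=
    fun m => Nat.find_min hex
  generalize Nat.find hex = k at *
  have hk0 : k ≠ 0 := by
    rintro rfl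
    simp [hqb, hvS, hvY] at hk
  have hnew : ∀ j, b - k < j → j ≤ b → q j ∉ S ∧ q j ∉ Y := by
    intro j h1 h2
    have := hmin (b - j) (by omega)
    rw [Nat.sub_sub_self h2] at this
    have hjb : b - j ≤ b := by omega
    tauto
  by_cases hcS : q (b - k) ∈ S
  · exact h.add_ear huv hu hgeo hqb (by omega) (by omega) hnew (.inl hcS)
  · have hcY := hk.resolve_left hcS
    have hgw := (hgeo.walk (Nat.zero_le (b - k)) (by omega)).mono (E := G.Adj) fun _ _ h => h.1
    rcases h.short _ hcY _ _ hgeo.zero_mem hgw with hi | ho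
    · exact h.swap.add_ear huv hu hgeo hqb (by omega) (by omega) hnew (.inr ⟨hcY, hi⟩)
    · exact h.add_ear huv hu hgeo hqb (by omega) (by omega) hnew (.inr ⟨hcY, ho⟩)

theorem exists_full [Fintype V] (hG : Bridgeless G)
    (hr : ∀ x, ∃ s ∈ S, DWithin G.Adj r x s) :
    ∃ (Y : Finset V) (T : V → V → Prop) (i o : V → ℕ), Fringe G S r Y T i o ∧
      ∀ u ∈ S, ∀ v, G.Adj u v → v ∈ S ∨ v ∈ Y := by
  classical
  have key : ∀ n (Y : Finset V) (T : V → V → Prop) (i o : V → ℕ), Fringe G S r Y T i o →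
      Fintype.card V ≤ Y.card + n →
      ∃ (Y : Finset V) (T : V → V → Prop) (i o : V → ℕ), Fringe G S r Y T i o ∧
        ∀ u ∈ S, ∀ v, G.Adj u v → v ∈ S ∨ v ∈ Y := by
    intro n
    induction n with
    | zero =>
      intro Y T i o h hn
      refine ⟨Y, T, i, o, h, fun u _ v _ => .inr ?_⟩
      rw [Finset.eq_univ_of_card Y (le_antisymm (Finset.card_le_univ Y) hn)]
      exact Finset.mem_univ v
    | succ n ih =>
      intro Y T i o h hn
      by_cases hd : ∀ u ∈ S, ∀ v, G.Adj u v → v ∈ S ∨ v ∈ Y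
      · exact ⟨Y, T, i, o, h, hd⟩
      · push Not at hd
        obtain ⟨u, hu, v, huv, hvS, hvY⟩ := hd
        obtain ⟨Y', T', i', o', hlt, h'⟩ := h.exists_larger hG hr huv hu hvS hvY
        exact ih Y' T' i' o' h' (by omega)
  exact key (Fintype.card V) ∅ _ _ _ (Fringe.empty G S r) (by omega)

end Fringe

/-! ### Extending a partial orientation to the whole graph -/

theorem exists_stage {V : Type*} [Fintype V] {G : SimpleGraph V} (hG : Bridgeless G) {r : ℕ}
    {S : Finset V} {D : V → V → Prop} (hr : ∀ x, ∃ s ∈ S, DWithin G.Adj (r + 1) x s)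
    (hadj : ∀ x y, D x y → G.Adj x y) (hmem : ∀ x y, D x y → x ∈ S ∧ y ∈ S)
    (hasymm : ∀ x y, D x y → ¬ D y x) :
    ∃ (S' : Finset V) (D' : V → V → Prop), (∀ x, ∃ s ∈ S', DWithin G.Adj r x s) ∧
      (∀ x y, D x y → D' x y) ∧ (∀ x y, D' x y → G.Adj x y) ∧
      (∀ x y, D' x y → x ∈ S' ∧ y ∈ S') ∧ (∀ x y, D' x y → ¬ D' y x) ∧
      ∀ x ∈ S', (∃ s ∈ S, DWithin D' (2 * (r + 1)) x s) ∧
        ∃ s ∈ S, DWithin D' (2 * (r + 1)) s x := by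
  classical
  obtain ⟨Y, T, i, o, h, hfull⟩ := Fringe.exists_full hG hr
  refine ⟨S ∪ Y, fun x y => D x y ∨ T x y, fun x => ?_, fun _ _ => Or.inl, ?_, ?_, ?_, ?_⟩
  · have key : ∀ n x, ∀ s ∈ S, DWalk G.Adj n x s →
        ∃ t ∈ S ∪ Y, DWithin G.Adj (n - 1) x t := by
      intro n
      induction n with
      | zero => exact fun x s hs hw => ⟨s, Finset.mem_union_left _ hs, 0, le_rfl, hw⟩
      | succ n ih =>
        rintro x s hs ⟨w, hxw, hw⟩
        rcases n with _ | n
        · cases hw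
          exact ⟨x, Finset.mem_union.mpr (hfull _ hs x hxw.symm), .refl _ _⟩
        · obtain ⟨t, ht, m, hm, hwt⟩ := ih w s hs hw
          exact ⟨t, ht, m + 1, by omega, w, hxw, hwt⟩
    obtain ⟨s, hs, n, hn, hw⟩ := hr x
    obtain ⟨t, ht, hw'⟩ := key n x s hs hw
    exact ⟨t, ht, hw'.le (by omega)⟩
  · rintro x y (hxy | hxy)
    exacts [hadj x y hxy, h.adj x y hxy]
  · rintro x y (hxy | hxy)
    · exact ⟨Finset.mem_union_left _ (hmem x y hxy).1, Finset.mem_union_left _ (hmem x y hxy).2⟩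
    · exact ⟨Finset.mem_union.mpr (h.left_mem x y hxy), Finset.mem_union.mpr (h.right_mem x y hxy)⟩
  · rintro x y (hxy | hxy) (hyx | hyx)
    · exact hasymm x y hxy hyx
    · exact (h.meets y x hyx).elim (fun hy => h.disj y hy (hmem x y hxy).2)
        fun hx => h.disj x hx (hmem x y hxy).1
    · exact (h.meets x y hxy).elim (fun hx => h.disj x hx (hmem y x hyx).2)
        fun hy => h.disj y hy (hmem y x hyx).1
    · exact h.asymm x y hxy hyx
  · intro x hx
    by_cases hxS : x ∈ S
    · exact ⟨⟨x, hxS, .refl _ _⟩, ⟨x, hxS, .refl _ _⟩⟩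
    · have hxY := (Finset.mem_union.mp hx).resolve_left hxS
      have h1 := h.add_le x hxY
      have h2 := h.one_le_in x hxY
      have h3 := h.one_le_out x hxY
      obtain ⟨s, hs, hw⟩ := h.to_base x hxY
      obtain ⟨t, ht, hw'⟩ := h.from_base x hxY
      exact ⟨⟨s, hs, (hw.mono fun _ _ => Or.inr).le (by omega)⟩,
        ⟨t, ht, (hw'.mono fun _ _ => Or.inr).le (by omega)⟩⟩

/-- A partial orientation on a set within distance `r` of every vertex extends to a partial
orientation in which every vertex is within `r * (r + 1)` steps of the set, in both directions. -/
theorem exists_extension {V : Type*} [Fintype V] {G : SimpleGraph V} (hG : Bridgeless G) (r : ℕ)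
    {S : Finset V} {D : V → V → Prop} (hr : ∀ x, ∃ s ∈ S, DWithin G.Adj r x s)
    (hadj : ∀ x y, D x y → G.Adj x y) (hmem : ∀ x y, D x y → x ∈ S ∧ y ∈ S)
    (hasymm : ∀ x y, D x y → ¬ D y x) :
    ∃ D' : V → V → Prop, (∀ x y, D x y → D' x y) ∧ (∀ x y, D' x y → G.Adj x y) ∧
      (∀ x y, D' x y → ¬ D' y x) ∧
      ∀ x, (∃ s ∈ S, DWithin D' (r * (r + 1)) x s) ∧ ∃ s ∈ S, DWithin D' (r * (r + 1)) s x := by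
  induction r generalizing S D with
  | zero =>
    refine ⟨D, fun _ _ => id, hadj, hasymm, fun x => ?_⟩
    obtain ⟨s, hs, n, hn, hw⟩ := hr x
    obtain rfl : n = 0 := by omega
    cases hw
    exact ⟨⟨x, hs, .refl _ _⟩, ⟨x, hs, .refl _ _⟩⟩
  | succ r ih =>
    obtain ⟨S', D', h1, h2, h3, h4, h5, h6⟩ := exists_stage hG hr hadj hmem hasymm
    obtain ⟨D'', g1, g2, g3, g4⟩ := ih h1 h3 h4 h5
    refine ⟨D'', fun x y hxy => g1 x y (h2 x y hxy), g2, g3, fun x => ?_⟩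
    obtain ⟨⟨s, hs, hxs⟩, ⟨t, ht, htx⟩⟩ := g4 x
    obtain ⟨s', hs', hss⟩ := (h6 s hs).1
    obtain ⟨t', ht', htt⟩ := (h6 t ht).2
    have e : r * (r + 1) + 2 * (r + 1) ≤ (r + 1) * (r + 1 + 1) := by
      apply le_of_eq
      ring
    exact ⟨⟨s', hs', (hxs.trans (hss.mono g1)).le e⟩,
      ⟨t', ht', ((htt.mono g1).trans htx).le (by omega)⟩⟩

theorem exists_isOrientation {V : Type*} {G : SimpleGraph V} {D : V → V → Prop}
    (hadj : ∀ x y, D x y → G.Adj x y) (hasymm : ∀ x y, D x y → ¬ D y x) :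
    ∃ D' : V → V → Prop, IsOrientation G D' ∧ ∀ x y, D x y → D' x y := by
  refine ⟨fun x y => D x y ∨ G.Adj x y ∧ ¬ D y x ∧ WellOrderingRel x y, ⟨?_, ?_⟩,
    fun _ _ => Or.inl⟩
  · rintro x y (h | h)
    exacts [hadj x y h, h.1]
  · intro x y hxy
    have h1 := hasymm x y
    have h2 : ¬ (WellOrderingRel x y ∧ WellOrderingRel y x) :=
      fun h => asymm_of WellOrderingRel h.1 h.2
    have h3 : WellOrderingRel x y ∨ WellOrderingRel y x := by
      rcases trichotomous_of WellOrderingRel x y with h | h | h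
      exacts [.inl h, absurd h hxy.ne, .inr h]
    have h4 := hxy.symm
    tauto

theorem card_mul_le_of_packing {V : Type*} [Fintype V] {G : SimpleGraph V} [DecidableRel G.Adj]
    {A : Finset V} (h : ∀ a ∈ A, ∀ a' ∈ A, a ≠ a' → ¬ Near G a a') :
    A.card * (G.minDegree + 1) ≤ Fintype.card V := by
  classical
  have hdisj : (A : Set V).PairwiseDisjoint fun a => insert a (G.neighborFinset a) := by
    intro a ha b hb hab
    refine Finset.disjoint_left.mpr fun x hx hx' => h a ha b hb hab ?_
    simp only [Finset.mem_insert, mem_neighborFinset] at hx hx'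
    rcases hx with rfl | hx <;> rcases hx' with rfl | hx'
    · exact .inl rfl
    · exact .inr (.inl hx'.symm)
    · exact .inr (.inl hx)
    · exact .inr (.inr ⟨x, hx, hx'.symm⟩)
  calc A.card * (G.minDegree + 1)
      ≤ ∑ a ∈ A, (insert a (G.neighborFinset a)).card := by
        rw [← smul_eq_mul]
        refine Finset.card_nsmul_le_sum _ _ _ fun a _ => ?_
        rw [Finset.card_insert_of_notMem (by simp), card_neighborFinset_eq_degree]
        exact Nat.succ_le_succ (G.minDegree_le_degree a)
    _ = (A.biUnion fun a => insert a (G.neighborFinset a)).card :=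
        (Finset.card_biUnion hdisj).symm
    _ ≤ Fintype.card V := Finset.card_le_univ _

theorem exists_orientation_of_bridgeless {V : Type*} [Fintype V] {G : SimpleGraph V}
    [DecidableRel G.Adj] (hG : Bridgeless G) {L : ℕ} (hL : 1 ≤ L) :
    ∃ (D : V → V → Prop) (B k : ℕ), IsOrientation G D ∧ L * B ≤ (6 * L + 2) * k ∧
      k * (G.minDegree + 1) ≤ Fintype.card V ∧
      ∀ u v, DWithin D (B + 4 * (3 * L + 1).choose 2) u v := by
  obtain ⟨S, A, D, α, β, B, -, hc, hdom⟩ := Core.exists_dominating hG hL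
  obtain ⟨D', h1, h2, h3, h4⟩ := exists_extension hG (3 * L) hdom hc.adj
    (fun x y hxy => ⟨hc.left_mem x y hxy, hc.right_mem x y hxy⟩) hc.asymm
  obtain ⟨D'', g1, g2⟩ := exists_isOrientation h2 h3
  refine ⟨D'', B, A.card, g1, hc.bound, card_mul_le_of_packing hc.packing, fun u v => ?_⟩
  obtain ⟨s, hs, hus⟩ := (h4 u).1
  obtain ⟨t, ht, htv⟩ := (h4 v).2
  obtain ⟨k, hk, hkB⟩ := hc.dist s hs t ht
  have hch : (3 * L + 1).choose 2 * 2 = 3 * L * (3 * L + 1) := by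
    have := Nat.add_one_mul_choose_eq (3 * L) 1
    rw [Nat.choose_one_right] at this
    linarith
  exact (((hus.mono g2).trans (hk.mono fun x y h => g2 x y (h1 x y h))).trans
    (htv.mono g2)).le (by omega)

/-- For a bridgeless graph `G` of order `n` with minimum degree `δ ≥ 4` and
girth `3`, for every `0 < ε < 1`, with `L = ⌈2/ε⌉`, the oriented diameter of `G` is at most
`(6+ε)·n/(δ+1) + 4·C(3L+1, 2)`; in particular it is `< 7n/(δ+1) + 4·C(3L+1, 2)`. -/
theorem oriented_diameter_lt_of_girth_three
    {V : Type*} [Fintype V] (G : SimpleGraph V) [DecidableRel G.Adj]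
    (n δ : ℕ) (hn : Fintype.card V = n)
    (hG : Bridgeless G) (hδ : G.minDegree = δ) (hδ4 : 4 ≤ δ)
    (hg : G.egirth = (3 : ℕ∞)) (ε : ℝ) (hε0 : 0 < ε) (hε1 : ε < 1) :
    ∃ D : V → V → Prop, IsOrientation G D ∧
      (∀ u v : V, ∃ m : ℕ,
        (m : ℝ) ≤ (6 + ε) * n / (δ + 1) +
          4 * Nat.choose (3 * ⌈(2 : ℝ) / ε⌉₊ + 1) 2 ∧
        DiReach D u v m) ∧
      (∀ u v : V, ∃ m : ℕ,
        (m : ℝ) < 7 * n / (δ + 1) +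
          4 * Nat.choose (3 * ⌈(2 : ℝ) / ε⌉₊ + 1) 2 ∧
        DiReach D u v m) := by
  have hLε : 2 ≤ ε * (⌈(2 : ℝ) / ε⌉₊ : ℝ) := by
    have := Nat.le_ceil ((2 : ℝ) / ε)
    rwa [div_le_iff₀' hε0] at this
  have hL : 1 ≤ ⌈(2 : ℝ) / ε⌉₊ := Nat.ceil_pos.mpr (by positivity)
  generalize ⌈(2 : ℝ) / ε⌉₊ = L at *
  obtain ⟨D, B, k, hD, hB, hk, hdist⟩ := exists_orientation_of_bridgeless hG hL
  rw [hδ, hn] at hk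
  have hn0 : 0 < n := by
    have := hG.1.nonempty
    rw [← hn]
    exact Fintype.card_pos
  have hL0 : (0 : ℝ) < L := by exact_mod_cast hL
  have hδ0 : (0 : ℝ) < (δ : ℝ) + 1 := by positivity
  have hBk : (B : ℝ) ≤ (6 + ε) * k := by
    have hB' : (L : ℝ) * B ≤ (6 * L + 2) * k := by exact_mod_cast hB
    have h2 : (6 * (L : ℝ) + 2) * k ≤ (6 * L + ε * L) * k := by gcongr
    refine le_of_mul_le_mul_left (hB'.trans (h2.trans (le_of_eq ?_))) hL0
    ring
  have hkn : (k : ℝ) ≤ n / (δ + 1) := by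
    rw [le_div_iff₀ hδ0]
    exact_mod_cast hk
  have hBn : (B : ℝ) ≤ (6 + ε) * n / (δ + 1) := by
    rw [mul_div_assoc]
    exact hBk.trans (by gcongr)
  have hlt : (6 + ε) * n / (δ + 1) < 7 * n / ((δ : ℝ) + 1) := by
    have : (0 : ℝ) < n := by exact_mod_cast hn0
    gcongr
    linarith
  have key : ∀ u v : V, ∃ m : ℕ, (m : ℝ) ≤ (6 + ε) * n / (δ + 1) +
      4 * Nat.choose (3 * L + 1) 2 ∧ DiReach D u v m := by
    intro u v
    obtain ⟨m, hm, hw⟩ := hdist u v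
    have hm' : (m : ℝ) ≤ B + 4 * Nat.choose (3 * L + 1) 2 := by exact_mod_cast hm
    exact ⟨m, by linarith, hw.diReach⟩
  refine ⟨D, hD, key, fun u v => ?_⟩
  obtain ⟨m, hm, hw⟩ := key u v
  exact ⟨m, by linarith, hw⟩
end

section
/- Let G be a bridgeless simple graph of order n, minimum degree δ ≥ 4, and girth g, let ε > 0 be real, and set L = ⌈(g-1)/ε⌉ and h(δ,g) = 1 + δ + Σ_{i=1}^{⌊(g-1)/2⌋-1} δ(δ-3)^i. Then there exists a bridgeless subgraph H of G such that every vertex of G is at distance less than L·g from V(H) in G, and H admits a strong orientation whose diameter is at most (2g+ε)·n/h(δ,g). -/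
open SimpleGraph

section Girth

variable {V : Type*} {G : SimpleGraph V}

theorem le_length_add_length_of_isPath_of_ne {g : ℕ} (hg : (g : ℕ∞) ≤ G.egirth) {a b : V}
    {p q : G.Walk a b} (hp : p.IsPath) (hq : q.IsPath) (hne : p ≠ q) :
    g ≤ p.length + q.length := by
  set K : SimpleGraph V := fromEdgeSet {e | e ∈ p.edges ∨ e ∈ q.edges} with hK
  have hKG : K ≤ G := by
    intro x y hxy
    rw [hK, fromEdgeSet_adj] at hxy
    rcases hxy.1 with h | h
    · exact p.adj_of_mem_edges h
    · exact q.adj_of_mem_edges h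
  have hpK : ∀ e ∈ p.edges, e ∈ K.edgeSet := by
    intro e he
    rw [hK, edgeSet_fromEdgeSet]
    exact ⟨Or.inl he, fun h => G.not_isDiag_of_mem_edgeSet (p.edges_subset_edgeSet he) h⟩
  have hqK : ∀ e ∈ q.edges, e ∈ K.edgeSet := by
    intro e he
    rw [hK, edgeSet_fromEdgeSet]
    exact ⟨Or.inr he, fun h => G.not_isDiag_of_mem_edgeSet (q.edges_subset_edgeSet he) h⟩
  have hcyc : ¬ K.IsAcyclic := by
    intro hac
    have h := congrArg Subtype.val ((hac.subsingleton_path a b).elim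
      ⟨p.transfer K hpK, hp.transfer hpK⟩ ⟨q.transfer K hqK, hq.transfer hqK⟩)
    apply hne
    apply Walk.ext_support
    have := congrArg Walk.support h
    simpa using this
  simp only [IsAcyclic, not_forall, not_not] at hcyc
  obtain ⟨v, c, hc⟩ := hcyc
  have hlen : (g : ℕ∞) ≤ c.length := by
    have := hg.trans (egirth_anti hKG)
    exact this.trans (egirth_le_length hc)
  have hsub : c.edges ⊆ p.edges ++ q.edges := by
    intro e he
    have := c.edges_subset_edgeSet he
    rw [hK, edgeSet_fromEdgeSet] at this
    simpa using this.1
  have := (List.subperm_of_subset hc.edges_nodup hsub).length_le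
  simp only [List.length_append, Walk.length_edges] at this
  exact (by exact_mod_cast hlen : g ≤ c.length).trans this

/-- Below half the girth, a vertex has at most one neighbour that is no farther from `c` than it
is itself. -/
theorem eq_of_adj_of_length_le {g i : ℕ} (hg : (g : ℕ∞) ≤ G.egirth) (hi : 2 * i + 2 < g)
    {c z y₁ y₂ : V} (hz : ∀ w : G.Walk z c, i ≤ w.length) (h₁ : G.Adj z y₁) (h₂ : G.Adj z y₂)
    (w₁ : G.Walk y₁ c) (w₂ : G.Walk y₂ c) (hw₁ : w₁.length ≤ i) (hw₂ : w₂.length ≤ i) :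
    y₁ = y₂ := by
  classical
  have key : ∀ y, G.Adj z y → ∀ w : G.Walk y c, w.length ≤ i →
      ∃ p : G.Walk z c, p.IsPath ∧ p.length ≤ i + 1 ∧ p.snd = y := by
    intro y h w hw
    have hb : w.bypass.length ≤ i := w.length_bypass_le_length.trans hw
    refine ⟨Walk.cons h w.bypass, (Walk.cons_isPath_iff _ _).2 ⟨w.bypass_isPath, fun hs => ?_⟩,
      by simpa using hb, by simp⟩
    have h1 := hz (w.bypass.dropUntil z hs)
    have h2 := congrArg Walk.length (w.bypass.take_spec hs)
    rw [Walk.length_append] at h2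
    have h3 : (w.bypass.takeUntil z hs).length = 0 := by omega
    exact h.ne (Walk.eq_of_length_eq_zero h3).symm
  obtain ⟨p, hp, hpl, rfl⟩ := key y₁ h₁ w₁ hw₁
  obtain ⟨q, hq, hql, rfl⟩ := key y₂ h₂ w₂ hw₂
  by_contra hne
  have := le_length_add_length_of_isPath_of_ne hg hp hq (fun h => hne (by rw [h]))
  omega

end Girth

section Ball

variable {V : Type*} [Fintype V]

open Classical in
/-- The vertices joined to `c` by a walk of length at most `i`. -/
noncomputable def walkBall (K : SimpleGraph V) (c : V) (i : ℕ) : Finset V :=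
  Finset.univ.filter fun x => ∃ w : K.Walk x c, w.length ≤ i

open Classical in
/-- The number of neighbours of `x`. -/
noncomputable def nbrCard (K : SimpleGraph V) (x : V) : ℕ :=
  (Finset.univ.filter fun y => K.Adj x y).card

theorem mem_walkBall {K : SimpleGraph V} {c x : V} {i : ℕ} :
    x ∈ walkBall K c i ↔ ∃ w : K.Walk x c, w.length ≤ i := by
  classical
  simp [walkBall]

theorem walkBall_mono {K : SimpleGraph V} {c : V} {i j : ℕ} (h : i ≤ j) :
    walkBall K c i ⊆ walkBall K c j := fun x hx => by
  obtain ⟨w, hw⟩ := mem_walkBall.1 hx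
  exact mem_walkBall.2 ⟨w, hw.trans h⟩

theorem walkBall_zero (K : SimpleGraph V) (c : V) : walkBall K c 0 = {c} := by
  ext x
  rw [mem_walkBall, Finset.mem_singleton]
  constructor
  · rintro ⟨w, hw⟩
    exact Walk.eq_of_length_eq_zero (Nat.le_zero.1 hw)
  · rintro rfl
    exact ⟨Walk.nil, le_rfl⟩

theorem walkBall_succ_of_adj {K : SimpleGraph V} {c x y : V} {i : ℕ} (h : K.Adj x y)
    (hx : x ∈ walkBall K c i) : y ∈ walkBall K c (i + 1) := by
  obtain ⟨w, hw⟩ := mem_walkBall.1 hx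
  exact mem_walkBall.2 ⟨Walk.cons h.symm w, by simpa using hw⟩

theorem le_length_of_notMem_walkBall {K : SimpleGraph V} {c x : V} {i : ℕ}
    (hx : x ∉ walkBall K c i) (w : K.Walk x c) : i + 1 ≤ w.length := by
  by_contra h
  exact hx (mem_walkBall.2 ⟨w, by omega⟩)

open Classical in
theorem nbrCard_le_card_sdiff_walkBall {K : SimpleGraph V} {g i : ℕ} (hg : (g : ℕ∞) ≤ K.egirth)
    (hi : 2 * (i + 1) + 2 < g) {c x : V} (hx : x ∈ walkBall K c (i + 1))
    (hx' : x ∉ walkBall K c i) :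
    nbrCard K x ≤ ((walkBall K c (i + 2) \ walkBall K c (i + 1)).filter
      fun y => K.Adj x y).card + 1 := by
  have hone : ((walkBall K c (i + 1)).filter fun y => K.Adj x y).card ≤ 1 := by
    refine Finset.card_le_one.2 fun y₁ h₁ y₂ h₂ => ?_
    rw [Finset.mem_filter] at h₁ h₂
    obtain ⟨w₁, hw₁⟩ := mem_walkBall.1 h₁.1
    obtain ⟨w₂, hw₂⟩ := mem_walkBall.1 h₂.1
    exact eq_of_adj_of_length_le hg hi (le_length_of_notMem_walkBall hx') h₁.2 h₂.2 w₁ w₂ hw₁ hw₂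
  refine le_trans ?_ (Nat.add_le_add_left hone _)
  refine le_trans (Finset.card_le_card fun y hy => ?_) (Finset.card_union_le _ _)
  have hxy : K.Adj x y := by simpa using hy
  by_cases h : y ∈ walkBall K c (i + 1)
  · exact Finset.mem_union_right _ (Finset.mem_filter.2 ⟨h, hxy⟩)
  · exact Finset.mem_union_left _ (Finset.mem_filter.2
      ⟨Finset.mem_sdiff.2 ⟨walkBall_succ_of_adj hxy hx, h⟩, hxy⟩)

open Classical in
theorem sum_nbrCard_sub_one_le {K : SimpleGraph V} {g i : ℕ} (hg : (g : ℕ∞) ≤ K.egirth)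
    (hi : 2 * (i + 1) + 2 < g) (c : V) :
    ∑ x ∈ walkBall K c (i + 1) \ walkBall K c i, (nbrCard K x - 1) ≤
      (walkBall K c (i + 2) \ walkBall K c (i + 1)).card := by
  set T := walkBall K c (i + 2) \ walkBall K c (i + 1) with hT
  calc _ ≤ ∑ x ∈ walkBall K c (i + 1) \ walkBall K c i, (T.filter fun y => K.Adj x y).card := by
        refine Finset.sum_le_sum fun x hx => ?_
        rw [Finset.mem_sdiff] at hx
        exact Nat.sub_le_iff_le_add.2 (nbrCard_le_card_sdiff_walkBall hg hi hx.1 hx.2)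
    _ = ((walkBall K c (i + 1) \ walkBall K c i).biUnion
          fun x => T.filter fun y => K.Adj x y).card := by
        refine (Finset.card_biUnion fun x₁ h₁ x₂ h₂ hne => ?_).symm
        refine Finset.disjoint_left.2 fun z hz₁ hz₂ => hne ?_
        rw [Finset.mem_filter, hT, Finset.mem_sdiff] at hz₁ hz₂
        obtain ⟨w₁, hw₁⟩ := mem_walkBall.1 (Finset.mem_sdiff.1 h₁).1
        obtain ⟨w₂, hw₂⟩ := mem_walkBall.1 (Finset.mem_sdiff.1 h₂).1
        exact eq_of_adj_of_length_le hg hi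
          (fun w => (Nat.le_succ _).trans (le_length_of_notMem_walkBall hz₁.1.2 w))
          hz₁.2.symm hz₂.2.symm w₁ w₂ hw₁ hw₂
    _ ≤ T.card := Finset.card_le_card (Finset.biUnion_subset.2 fun x _ => Finset.filter_subset _ _)

open Classical in
theorem le_card_sphere {K : SimpleGraph V} {g δ : ℕ} (hg : (g : ℕ∞) ≤ K.egirth) (hδ : 4 ≤ δ)
    {loss : V → ℕ} {c : V} (hc : δ ≤ nbrCard K c + loss c)
    (hloss : ∀ x, δ ≤ nbrCard K x + 2 + loss x) (i : ℕ) (hi : 2 * i + 2 < g) :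
    δ * (δ - 3) ^ i ≤ (walkBall K c (i + 1) \ walkBall K c i).card +
      (δ - 3) ^ i * ∑ x ∈ walkBall K c i, loss x := by
  induction i with
  | zero =>
    have : nbrCard K c ≤ (walkBall K c 1 \ walkBall K c 0).card := by
      refine Finset.card_le_card fun y hy => ?_
      have hy : K.Adj c y := by simpa using hy
      refine Finset.mem_sdiff.2 ⟨walkBall_succ_of_adj hy (by simp [walkBall_zero]), ?_⟩
      simpa [walkBall_zero] using hy.ne'
    simp only [pow_zero, mul_one, one_mul, zero_add]
    rw [walkBall_zero, Finset.sum_singleton, ← walkBall_zero K c]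
    omega
  | succ i ih =>
    have ih := ih (by omega)
    set S := walkBall K c (i + 1) \ walkBall K c i with hS
    have h1 := sum_nbrCard_sub_one_le hg hi c
    have h2 : S.card * (δ - 3) ≤
        ∑ x ∈ S, (nbrCard K x - 1) + ∑ x ∈ S, loss x := by
      rw [← Finset.sum_add_distrib, ← smul_eq_mul]
      refine Finset.card_nsmul_le_sum _ _ _ fun x _ => ?_
      have := hloss x
      omega
    have h3 : ∑ x ∈ walkBall K c (i + 1), loss x =
        ∑ x ∈ S, loss x + ∑ x ∈ walkBall K c i, loss x :=
      (Finset.sum_sdiff (walkBall_mono (Nat.le_succ i))).symm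
    have h4 : 1 ≤ (δ - 3) ^ (i + 1) := Nat.one_le_pow _ _ (by omega)
    rw [h3]
    have h5 : ∑ x ∈ S, loss x ≤ (δ - 3) ^ (i + 1) * ∑ x ∈ S, loss x :=
      Nat.le_mul_of_pos_left _ h4
    have h6 := Nat.mul_le_mul_right (δ - 3) ih
    rw [pow_succ] at *
    nlinarith

open Classical in
theorem le_card_walkBall {K : SimpleGraph V} {g δ : ℕ} (hg : (g : ℕ∞) ≤ K.egirth) (hδ : 4 ≤ δ)
    {loss : V → ℕ} {c : V} (hc : δ ≤ nbrCard K c + loss c)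
    (hloss : ∀ x, δ ≤ nbrCard K x + 2 + loss x) (k : ℕ) (hk : 2 * k < g) :
    1 + δ * ∑ i ∈ Finset.range k, (δ - 3) ^ i ≤ (walkBall K c k).card +
      (∑ i ∈ Finset.range k, (δ - 3) ^ i) * ∑ x ∈ walkBall K c k, loss x := by
  induction k with
  | zero => simp [walkBall_zero]
  | succ k ih =>
    have ih := ih (by omega)
    have h1 := le_card_sphere hg hδ hc hloss k (by omega)
    have hsub := walkBall_mono (K := K) (c := c) (Nat.le_succ k)
    have h2 := Finset.card_sdiff_add_card_eq_card hsub
    have h3 : ∑ x ∈ walkBall K c k, loss x ≤ ∑ x ∈ walkBall K c (k + 1), loss x :=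
      Finset.sum_le_sum_of_subset hsub
    rw [Finset.sum_range_succ]
    have h4 := Nat.mul_le_mul_left (∑ i ∈ Finset.range k, (δ - 3) ^ i) h3
    have h5 := Nat.mul_le_mul_left ((δ - 3) ^ k) h3
    simp only [Nat.succ_eq_add_one] at h2
    nlinarith

/-- Disjoint balls around the vertices of `C` fit into the vertex set. -/
theorem card_mul_le_card_add {K : SimpleGraph V} {g δ : ℕ} (hg : (g : ℕ∞) ≤ K.egirth)
    (hδ : 4 ≤ δ) {loss : V → ℕ} {C : Finset V} (hC : ∀ c ∈ C, δ ≤ nbrCard K c + loss c)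
    (hloss : ∀ x, δ ≤ nbrCard K x + 2 + loss x)
    (hsep : ∀ c ∈ C, ∀ c' ∈ C, c ≠ c' → ∀ w : K.Walk c c', g ≤ w.length)
    (k : ℕ) (hk : 2 * k < g) :
    C.card * (1 + δ * ∑ i ∈ Finset.range k, (δ - 3) ^ i) ≤ Fintype.card V +
      (∑ i ∈ Finset.range k, (δ - 3) ^ i) * ∑ x, loss x := by
  classical
  have hdisj : (C : Set V).PairwiseDisjoint fun c => walkBall K c k := by
    intro c hc c' hc' hne
    refine Finset.disjoint_left.2 fun x hx hx' => ?_
    obtain ⟨w, hw⟩ := mem_walkBall.1 hx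
    obtain ⟨w', hw'⟩ := mem_walkBall.1 hx'
    have := hsep c hc c' hc' hne (w.reverse.append w')
    rw [Walk.length_append, Walk.length_reverse] at this
    omega
  have h1 : C.card * (1 + δ * ∑ i ∈ Finset.range k, (δ - 3) ^ i) ≤
      ∑ c ∈ C, ((walkBall K c k).card +
        (∑ i ∈ Finset.range k, (δ - 3) ^ i) * ∑ x ∈ walkBall K c k, loss x) := by
    rw [← smul_eq_mul]
    exact Finset.card_nsmul_le_sum _ _ _ fun c hc => le_card_walkBall hg hδ (hC c hc) hloss k hk
  refine h1.trans ?_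
  rw [Finset.sum_add_distrib, ← Finset.mul_sum, ← Finset.card_biUnion hdisj,
    ← Finset.sum_biUnion hdisj]
  exact Nat.add_le_add (Finset.card_le_univ _)
    (Nat.mul_le_mul_left _ (Finset.sum_le_sum_of_subset (Finset.subset_univ _)))

theorem hPoly_eq {δ g : ℕ} (hg : 3 ≤ g) :
    hPoly δ g = 1 + δ * ∑ i ∈ Finset.range ((g - 1) / 2), (δ - 3) ^ i := by
  obtain ⟨k, hk⟩ : ∃ k, (g - 1) / 2 = k + 1 := ⟨(g - 1) / 2 - 1, by omega⟩
  rw [hPoly, hk, Nat.add_sub_cancel, Finset.sum_range_succ', mul_add, Finset.mul_sum,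
    Finset.range_eq_Ico, Finset.sum_Ico_add' (fun i => δ * (δ - 3) ^ i) 0 k 1]
  have : Finset.Ico (0 + 1) (k + 1) = Finset.Icc 1 k := by ext; simp
  rw [this]
  simp
  ring

end Ball

section Orientation

open Relation

theorem DiReach.zero {W : Type*} (R : W → W → Prop) (u : W) : DiReach R u u 0 :=
  ⟨fun _ => u, rfl, rfl, fun i => i.elim0⟩

theorem DiReach.snoc {W : Type*} {R : W → W → Prop} {u x y : W} {m : ℕ} (h : DiReach R u x m)
    (hxy : R x y) : DiReach R u y (m + 1) := by
  obtain ⟨f, h0, hm, hf⟩ := h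
  refine ⟨Fin.snoc (α := fun _ => W) f y, ?_, Fin.snoc_last _ _, fun i => ?_⟩
  · rw [← h0, ← Fin.castSucc_zero, Fin.snoc_castSucc]
  · refine Fin.lastCases ?_ (fun j => ?_) i
    · rw [Fin.snoc_castSucc, Fin.succ_last, Fin.snoc_last, hm]
      exact hxy
    · rw [Fin.snoc_castSucc, ← Fin.castSucc_succ, Fin.snoc_castSucc]
      exact hf j

theorem exists_diReach_of_reflTransGen {W : Type*} [Fintype W] {R : W → W → Prop} {u v : W}
    (h : ReflTransGen R u v) : ∃ m, m + 1 ≤ Fintype.card W ∧ DiReach R u v m := by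
  classical
  set B : ℕ → Finset W := fun m => Finset.univ.filter fun x => ∃ j ≤ m, DiReach R u x j with hB
  have hmem : ∀ {m x}, x ∈ B m ↔ ∃ j ≤ m, DiReach R u x j := by simp [hB]
  have hu : ∀ m, u ∈ B m := fun m => hmem.2 ⟨0, Nat.zero_le _, DiReach.zero R u⟩
  have hmono : ∀ m, B m ⊆ B (m + 1) := fun m x hx => by
    obtain ⟨j, hj, hjx⟩ := hmem.1 hx
    exact hmem.2 ⟨j, hj.trans (Nat.le_succ m), hjx⟩
  have hgrow : ∀ m, v ∉ B m → m + 1 ≤ (B m).card := by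
    intro m
    induction m with
    | zero => exact fun _ => Finset.card_pos.2 ⟨u, hu 0⟩
    | succ m ih =>
      intro hv
      have hvm : v ∉ B m := fun h => hv (hmono m h)
      have hne : B m ≠ B (m + 1) := by
        intro heq
        refine hvm ?_
        clear hv hvm ih
        induction h with
        | refl => exact hu m
        | tail _ hxy ih =>
          obtain ⟨j, hj, hjx⟩ := hmem.1 ih
          rw [heq]
          exact hmem.2 ⟨j + 1, Nat.succ_le_succ hj, hjx.snoc hxy⟩
      have := Finset.card_lt_card ((hmono m).ssubset_of_ne hne)
      have := ih hvm
      omega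
  have hpos : 0 < Fintype.card W := Fintype.card_pos_iff.2 ⟨u⟩
  have hv : v ∈ B (Fintype.card W - 1) := by
    by_contra hv
    have h1 := hgrow _ hv
    have h2 : (B (Fintype.card W - 1)) = Finset.univ := by
      rw [← Finset.card_eq_iff_eq_univ]
      exact le_antisymm (Finset.card_le_univ _) (by omega)
    exact hv (h2 ▸ Finset.mem_univ v)
  obtain ⟨j, hj, hjv⟩ := hmem.1 hv
  exact ⟨j, by omega, hjv⟩

theorem bridgeless_of_isOrientation {W : Type*} [Nonempty W] {K : SimpleGraph W}
    {D : W → W → Prop} (hD : IsOrientation K D) (hstrong : ∀ u v, ReflTransGen D u v) :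
    Bridgeless K := by
  have hpre : K.Preconnected := by
    intro u v
    have h := hstrong u v
    induction h with
    | refl => exact Reachable.refl u
    | tail _ hxy ih => exact ih.trans (hD.1 _ _ hxy).reachable
  have key : ∀ a b, D a b → (K.deleteEdges {s(a, b)}).Reachable b a := by
    intro a b hab
    have hba : ¬ D b a := (hD.2 _ _ (hD.1 _ _ hab)).1 hab
    have : ∀ x, ReflTransGen D b x → (K.deleteEdges {s(a, b)}).Reachable b x ∨
        (K.deleteEdges {s(a, b)}).Reachable b a := by
      intro x hx
      induction hx with
      | refl => exact Or.inl (Reachable.refl b)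
      | @tail x y _ hxy ih =>
        rcases ih with ih | ih
        · by_cases he : s(x, y) = s(a, b)
          · rcases Sym2.eq_iff.1 he with ⟨rfl, rfl⟩ | ⟨rfl, rfl⟩
            · exact Or.inr ih
            · exact absurd hxy hba
          · refine Or.inl (ih.trans (Adj.reachable ?_))
            rw [deleteEdges_adj]
            exact ⟨hD.1 _ _ hxy, he⟩
        · exact Or.inr ih
    exact (this a (hstrong b a)).elim id id
  refine ⟨⟨hpre⟩, fun e => ?_⟩
  induction e with
  | h a b =>
    rw [isBridge_iff, not_not]
    by_cases hab : K.Adj a b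
    · by_cases h : D a b
      · exact (key a b h).symm
      · have h' : D b a := not_not.1 fun h' => h ((hD.2 a b hab).2 h')
        have := key b a h'
        rwa [Sym2.eq_swap] at this
    · rw [deleteEdges_eq_self.2 (by simpa using hab)]
      exact hpre a b

variable {V : Type*} {G : SimpleGraph V}

/-- A strongly connected set of vertices under an antisymmetric set of arcs along edges of `G`. -/
structure IsStrongPart (G : SimpleGraph V) (X : Finset V) (D : V → V → Prop) : Prop where
  adj : ∀ x y, D x y → G.Adj x y
  left_mem : ∀ x y, D x y → x ∈ X
  right_mem : ∀ x y, D x y → y ∈ X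
  antisymm : ∀ x y, D x y → ¬ D y x
  strong : ∀ x ∈ X, ∀ y ∈ X, ReflTransGen D x y

theorem IsStrongPart.exists_subgraph {X : Finset V} {D : V → V → Prop}
    (h : IsStrongPart G X D) (hne : X.Nonempty) :
    ∃ H : G.Subgraph, H.verts = X ∧ Bridgeless H.coe ∧
      ∃ E : ↥H.verts → ↥H.verts → Prop, IsOrientation H.coe E ∧
        ∀ u v : ↥H.verts, ∃ m : ℕ, m + 1 ≤ X.card ∧ DiReach E u v m := by
  let H : G.Subgraph :=
    { verts := X
      Adj := fun x y => D x y ∨ D y x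
      adj_sub := fun {x y} hxy => hxy.elim (h.adj x y) fun h' => (h.adj y x h').symm
      edge_vert := fun {x y} hxy => hxy.elim (h.left_mem x y) (h.right_mem y x)
      symm := ⟨fun x y hxy => hxy.symm⟩ }
  let E : ↥H.verts → ↥H.verts → Prop := fun x y => D x y
  have hE : IsOrientation H.coe E :=
    ⟨fun x y hxy => Or.inl hxy, fun x y hxy => ⟨h.antisymm x y, fun hn => hxy.resolve_right hn⟩⟩
  have hstrong : ∀ x y : ↥H.verts, ReflTransGen E x y := by
    rintro ⟨x, hx⟩ ⟨y, hy⟩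
    have hxy := h.strong x hx y hy
    induction hxy with
    | refl => exact ReflTransGen.refl
    | tail _ hyz ih => exact (ih (h.left_mem _ _ hyz)).tail hyz
  have : Nonempty ↥H.verts := ⟨⟨hne.choose, hne.choose_spec⟩⟩
  refine ⟨H, rfl, bridgeless_of_isOrientation hE hstrong, E, hE, fun u v => ?_⟩
  let _ : Fintype ↥H.verts := inferInstanceAs (Fintype ↥(X : Set V))
  obtain ⟨m, hm, hr⟩ := exists_diReach_of_reflTransGen (hstrong u v)
  refine ⟨m, hm.trans (le_of_eq ?_), hr⟩
  exact Fintype.card_coe X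

end Orientation

section Potential

open Relation

variable {V : Type*}

/-- `Route X R w x n l`: an `R`-walk of length `l` leads from `x` to `X`, and its vertices other
than the last one have total weight `n`. -/
inductive Route (X : Finset V) (R : V → V → Prop) (w : V → ℕ) : V → ℕ → ℕ → Prop
  | base {x : V} : x ∈ X → Route X R w x 0 0
  | step {x y : V} {n l : ℕ} : R x y → Route X R w y n l → Route X R w x (w x + n) (l + 1)

theorem Route.exists_of_reflTransGen {X : Finset V} {R : V → V → Prop} (w : V → ℕ) {x y : V}
    (h : ReflTransGen R x y) (hy : y ∈ X) : ∃ n l, Route X R w x n l := by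
  induction h using ReflTransGen.head_induction_on with
  | refl => exact ⟨0, 0, .base hy⟩
  | head hxz _ ih =>
    obtain ⟨n, l, h⟩ := ih
    exact ⟨_, _, .step hxz h⟩

/-- `φ` is the weighted distance to `X` along `R`, and `nxt` chooses the second vertex of an
optimal route, the rank `lam` decreasing along it. -/
structure IsPotential (X : Finset V) (R : V → V → Prop) (w φ lam : V → ℕ) (nxt : V → V) :
    Prop where
  zero : ∀ x ∈ X, φ x = 0
  le : ∀ x y, R x y → φ x ≤ w x + φ y
  rel : ∀ x ∉ X, R x (nxt x)
  eq : ∀ x ∉ X, φ x = w x + φ (nxt x)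
  lt : ∀ x ∉ X, lam (nxt x) < lam x

theorem exists_isPotential {X : Finset V} {R : V → V → Prop} (w : V → ℕ)
    (h : ∀ x, ∃ y ∈ X, ReflTransGen R x y) : ∃ φ lam nxt, IsPotential X R w φ lam nxt := by
  classical
  have h1 : ∀ x, ∃ n l, Route X R w x n l := fun x => by
    obtain ⟨y, hy, hxy⟩ := h x
    exact Route.exists_of_reflTransGen w hxy hy
  let φ : V → ℕ := fun x => Nat.find (h1 x)
  have h2 : ∀ x, ∃ l, Route X R w x (φ x) l := fun x => Nat.find_spec (h1 x)
  let lam : V → ℕ := fun x => Nat.find (h2 x)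
  have h3 : ∀ x, Route X R w x (φ x) (lam x) := fun x => Nat.find_spec (h2 x)
  have hφ : ∀ {x n l}, Route X R w x n l → φ x ≤ n := fun {x n l} hr => Nat.find_min' (h1 x) ⟨l, hr⟩
  have hlam : ∀ {x l}, Route X R w x (φ x) l → lam x ≤ l := fun {x l} hr => Nat.find_min' (h2 x) hr
  have hle : ∀ x y, R x y → φ x ≤ w x + φ y := fun x y hxy => hφ (.step hxy (h3 y))
  have hnxt : ∀ x, ∃ y, x ∉ X → R x y ∧ φ x = w x + φ y ∧ lam y < lam x := by
    intro x
    generalize hn : φ x = n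
    generalize hl : lam x = l
    have hr := h3 x
    rw [hn, hl] at hr
    cases hr with
    | base hx => exact ⟨x, fun hx' => absurd hx hx'⟩
    | @step _ y n l hxy hy =>
      have h4 := hφ hy
      have h5 := hle x y hxy
      have h6 : φ y = n := by omega
      refine ⟨y, fun _ => ⟨hxy, by rw [h6], ?_⟩⟩
      exact Nat.lt_succ_of_le (hlam (h6 ▸ hy))
  choose nxt hn using hnxt
  exact ⟨φ, lam, nxt, fun x hx => Nat.le_zero.1 (hφ (.base hx)), hle, fun x hx => (hn x hx).1,
    fun x hx => (hn x hx).2.1, fun x hx => (hn x hx).2.2⟩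

namespace IsPotential

variable {X : Finset V} {R : V → V → Prop} {w φ lam : V → ℕ} {nxt : V → V}

/-- The arcs of the chosen optimal routes. -/
def arc (X : Finset V) (nxt : V → V) (x y : V) : Prop :=
  x ∉ X ∧ y = nxt x

theorem exists_mem_of_arc (h : IsPotential X R w φ lam nxt) (x : V) :
    ∃ y ∈ X, ReflTransGen (arc X nxt) x y := by
  induction hl : lam x using Nat.strong_induction_on generalizing x with
  | _ l ih =>
    by_cases hx : x ∈ X
    · exact ⟨x, hx, .refl⟩
    · obtain ⟨y, hy, hxy⟩ := ih _ (hl ▸ h.lt x hx) (nxt x) rfl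
      exact ⟨y, hy, .head ⟨hx, rfl⟩ hxy⟩

theorem le_of_reflTransGen (h : IsPotential X R w φ lam nxt) {x y : V}
    (hxy : ReflTransGen (arc X nxt) x y) : φ y ≤ φ x := by
  induction hxy with
  | refl => exact le_rfl
  | tail _ hyz ih =>
    obtain ⟨hy, rfl⟩ := hyz
    have := h.eq _ hy
    omega

theorem lt_of_reflTransGen (h : IsPotential X R w φ lam nxt) {x y : V}
    (hxy : ReflTransGen (arc X nxt) x y) (hne : x ≠ y) (hw : w x = 1) : φ y < φ x := by
  rcases hxy.cases_head with rfl | ⟨z, ⟨hx, rfl⟩, hzy⟩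
  · exact absurd rfl hne
  · have := h.eq x hx
    have := h.le_of_reflTransGen hzy
    omega

theorem exists_eq (h : IsPotential X R w φ lam nxt) (hw : ∀ x, w x ≤ 1) {t : ℕ} (ht : 1 ≤ t)
    (x : V) (hx : t ≤ φ x) :
    ∃ z, ReflTransGen (arc X nxt) x z ∧ z ∉ X ∧ w z = 1 ∧ φ z = t := by
  induction hl : lam x using Nat.strong_induction_on generalizing x with
  | _ l ih =>
    have hxX : x ∉ X := fun hxX => by
      have := h.zero x hxX
      omega
    by_cases hxt : w x = 1 ∧ φ x = t
    · exact ⟨x, .refl, hxX, hxt⟩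
    · have h1 := h.eq x hxX
      have h2 := hw x
      obtain ⟨z, hz, hz'⟩ := ih _ (hl ▸ h.lt x hxX) (nxt x) (by omega) rfl
      exact ⟨z, .head ⟨hxX, rfl⟩ hz, hz'⟩

open Classical in
theorem card_le [Fintype V] (h : IsPotential X R w φ lam nxt) (v : V) :
    (Finset.univ.filter fun z => ReflTransGen (arc X nxt) v z ∧ z ∉ X ∧ w z = 1).card ≤ φ v := by
  have hcard : (Finset.Icc 1 (φ v)).card = φ v := by simp
  rw [← hcard]
  refine Finset.card_le_card_of_injOn φ (fun z hz => ?_) fun z hz z' hz' hzz' => ?_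
  · simp only [Finset.coe_filter, Finset.mem_univ, true_and, Set.mem_ofPred_eq] at hz
    obtain ⟨hvz, hzX, hwz⟩ := hz
    have h1 := h.eq z hzX
    have h2 := h.le_of_reflTransGen hvz
    simp only [Finset.coe_Icc, Set.mem_Icc]
    omega
  · simp only [Finset.coe_filter, Finset.mem_univ, true_and, Set.mem_ofPred_eq] at hz hz'
    by_contra hne
    have hu : Relator.RightUnique (arc X nxt) := by
      rintro a b c ⟨_, rfl⟩ ⟨_, rfl⟩
      rfl
    rcases ReflTransGen.total_of_right_unique hu hz.1 hz'.1 with h1 | h1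
    · have := h.lt_of_reflTransGen h1 hne hz.2.2
      omega
    · have := h.lt_of_reflTransGen h1 (Ne.symm hne) hz'.2.2
      omega

end IsPotential

end Potential

section EarPath

open Relation

variable {V : Type*} {G : SimpleGraph V} {X : Finset V} {p : ℕ → V} {l : ℕ}

/-- The vertices `p 0, …, p l` form a path of `G` that starts in `X` and recedes from `X` at unit
speed. -/
structure IsEarPath (G : SimpleGraph V) (X : Finset V) (p : ℕ → V) (l : ℕ) : Prop where
  zero_mem : p 0 ∈ X
  adj : ∀ i < l, G.Adj (p i) (p (i + 1))
  le_dist : ∀ i ≤ l, ∀ x ∈ X, i ≤ G.dist (p i) x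

/-- The arcs of the path `p 0, …, p l`, directed forward. -/
def pathArc (p : ℕ → V) (l : ℕ) (x y : V) : Prop :=
  ∃ i < l, x = p i ∧ y = p (i + 1)

theorem exists_isEarPath (hG : G.Connected) (hX : X.Nonempty) {v : V}
    (hv : ∀ x ∈ X, l ≤ G.dist v x) : ∃ p, IsEarPath G X p l := by
  obtain ⟨x₀, hx₀, hmin⟩ := X.exists_min_image (fun x => G.dist v x) hX
  obtain ⟨q, hq⟩ := hG.exists_walk_length_eq_dist x₀ v
  rw [dist_comm] at hq
  have hl := hv x₀ hx₀
  refine ⟨q.getVert, by simpa using hx₀, fun i hi => q.adj_getVert_succ (by omega),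
    fun i hi x hx => ?_⟩
  have h1 := hmin x hx
  have h2 : G.dist (q.getVert i) v ≤ q.length - i := by
    simpa using dist_le (q.drop i)
  have h3 := hG.dist_triangle (u := v) (v := q.getVert i) (w := x)
  rw [dist_comm] at h2
  omega

namespace IsEarPath

theorem dist_zero_le (h : IsEarPath G X p l) (hG : G.Connected) {i : ℕ} (hi : i ≤ l) :
    G.dist (p i) (p 0) ≤ i := by
  induction i with
  | zero => simp
  | succ i ih =>
    have h1 := ih (by omega)
    have h2 := hG.dist_triangle (u := p (i + 1)) (v := p i) (w := p 0)
    have h3 := dist_eq_one_iff_adj.2 (h.adj i (by omega)).symm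
    omega

theorem le_dist_add (h : IsEarPath G X p l) (hG : G.Connected) {i j : ℕ} (hi : i ≤ l)
    (hj : j ≤ l) : j ≤ G.dist (p j) (p i) + i := by
  have h1 := h.dist_zero_le hG hi
  have h2 := h.le_dist j hj _ h.zero_mem
  have h3 := hG.dist_triangle (u := p j) (v := p i) (w := p 0)
  omega

theorem injOn (h : IsEarPath G X p l) (hG : G.Connected) {i j : ℕ} (hi : i ≤ l)
    (hj : j ≤ l) (hij : p i = p j) : i = j := by
  have h1 := h.le_dist_add hG hi hj
  have h2 := h.le_dist_add hG hj hi
  rw [hij, dist_self] at h1 h2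
  omega

theorem notMem (h : IsEarPath G X p l) {i : ℕ} (hi : i ≤ l) (h0 : i ≠ 0) : p i ∉ X := fun hX => by
  have := h.le_dist i hi _ hX
  rw [dist_self] at this
  omega

theorem not_pathArc_symm (h : IsEarPath G X p l) (hG : G.Connected) {x y : V}
    (hxy : pathArc p l x y) : ¬ pathArc p l y x := by
  obtain ⟨i, hi, rfl, rfl⟩ := hxy
  rintro ⟨j, hj, h1, h2⟩
  have h1 := h.injOn hG (by omega) (by omega) h1
  have h2 := h.injOn hG (by omega) (by omega) h2
  omega

theorem adj_of_pathArc (h : IsEarPath G X p l) {x y : V} (hxy : pathArc p l x y) : G.Adj x y := by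
  obtain ⟨i, hi, rfl, rfl⟩ := hxy
  exact h.adj i hi

theorem reflTransGen (p : ℕ → V) {i j : ℕ} (hij : i ≤ j) (hj : j ≤ l) :
    ReflTransGen (pathArc p l) (p i) (p j) := by
  induction j, hij using Nat.le_induction with
  | base => exact .refl
  | succ j hij ih => exact (ih (by omega)).tail ⟨j, by omega, rfl, rfl⟩

/-- Orienting the path forward, every vertex can still be led to `X`. -/
theorem exists_reflTransGen (h : IsEarPath G X p l) (hG : Bridgeless G) (x : V) :
    ∃ y ∈ X, ReflTransGen (fun x y => G.Adj x y ∧ ¬ pathArc p l y x) x y := by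
  set R : V → V → Prop := fun x y => G.Adj x y ∧ ¬ pathArc p l y x with hR
  have hpR : ∀ x y, pathArc p l x y → R x y := fun x y hxy =>
    ⟨h.adj_of_pathArc hxy, h.not_pathArc_symm hG.1 hxy⟩
  set B : Set V := {x | ¬ ∃ y ∈ X, ReflTransGen R x y} with hB
  have hstep : ∀ {a b}, a ∈ B → ReflTransGen R a b → b ∈ B := fun {a b} ha hab hb => by
    obtain ⟨y, hy, hby⟩ := hb
    exact ha ⟨y, hy, hab.trans hby⟩
  have hcross : ∀ a b, G.Adj a b → a ∈ B → b ∉ B → pathArc p l b a := by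
    intro a b hab ha hb
    by_contra hba
    exact hb (hstep ha (.single ⟨hab, hba⟩))
  have huniq : ∀ i j, i < l → j < l → p (i + 1) ∈ B → p j ∉ B → j ≤ i := by
    intro i j hi hj hiB hjB
    by_contra! hij
    have hpath := reflTransGen (l := l) p (show i + 1 ≤ j from hij) hj.le
    exact hjB (hstep hiB (ReflTransGen.mono hpR _ _ hpath))
  by_contra hx
  have h0 : p 0 ∉ B := fun h0 => h0 ⟨p 0, h.zero_mem, .refl⟩
  obtain ⟨q⟩ := hG.1.preconnected x (p 0)
  obtain ⟨d, -, hd1, hd2⟩ := q.exists_boundary_dart B hx h0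
  obtain ⟨i, hi, hd2', hd1'⟩ := hcross _ _ d.adj hd1 hd2
  rw [hd1'] at hd1
  rw [hd2'] at hd2
  have hbr := hG.2 s(p (i + 1), p i)
  rw [isBridge_iff, not_not] at hbr
  obtain ⟨q'⟩ := hbr
  obtain ⟨e, -, he1, he2⟩ := q'.exists_boundary_dart B hd1 hd2
  have hadj := deleteEdges_adj.1 e.adj
  obtain ⟨j, hj, he2', he1'⟩ := hcross _ _ hadj.1 he1 he2
  have hij : j = i :=
    le_antisymm (huniq i j hi hj hd1 (he2' ▸ he2)) (huniq j i hj hi (he1' ▸ he1) hd2)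
  subst hij
  apply hadj.2
  rw [he1', he2']
  rfl

open Classical in
/-- A strong part can be enlarged by an ear path followed by an optimal way back. -/
theorem exists_isStrongPart [Fintype V] {D : V → V → Prop} (h : IsEarPath G X p l)
    (hG : Bridgeless G) (hD : IsStrongPart G X D) :
    ∃ (X' : Finset V) (D' : V → V → Prop) (φ : V → ℕ), IsStrongPart G X' D' ∧ X ⊆ X' ∧
      (∀ i ≤ l, p i ∈ X') ∧ X'.card ≤ X.card + l + φ (p l) ∧ (∀ x ∈ X, φ x = 0) ∧
      (∀ x y, G.Adj x y → ¬ pathArc p l x y → ¬ pathArc p l y x → φ x ≤ φ y + 1) ∧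
      ∀ t, 1 ≤ t → t ≤ φ (p l) → ∃ z ∈ X', z ∉ X ∧ (∀ i ≤ l, z ≠ p i) ∧ φ z = t := by
  let w : V → ℕ := fun x => if ∃ i ≤ l, x = p i then 0 else 1
  have hw : ∀ x, w x ≤ 1 := fun x => by
    simp only [w]
    split_ifs <;> omega
  have hw1 : ∀ {x}, w x = 1 ↔ ∀ i ≤ l, x ≠ p i := by
    intro x
    simp only [w]
    split_ifs with h1
    · simpa using h1
    · simpa using h1
  obtain ⟨φ, lam, nxt, hφ⟩ := exists_isPotential w (h.exists_reflTransGen hG)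
  let E : V → V → Prop := IsPotential.arc X nxt
  let T : V → Prop := fun x => ReflTransGen E (p l) x
  let D' : V → V → Prop := fun x y => D x y ∨ pathArc p l x y ∨ (T x ∧ E x y)
  let Y : Finset V := (Finset.Icc 1 l).image p
  let Z : Finset V := Finset.univ.filter fun z => T z ∧ z ∉ X ∧ w z = 1
  let X' : Finset V := X ∪ Y ∪ Z
  have hX : X ⊆ X' := fun x hx => by simp [X', hx]
  have hp : ∀ i ≤ l, p i ∈ X' := by
    intro i hi
    rcases Nat.eq_zero_or_pos i with rfl | h0
    · exact hX h.zero_mem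
    · refine Finset.mem_union_left _ (Finset.mem_union_right _ ?_)
      exact Finset.mem_image_of_mem p (Finset.mem_Icc.2 ⟨h0, hi⟩)
  have hT : ∀ x, T x → x ∈ X' := by
    intro x hx
    by_cases hxX : x ∈ X
    · exact hX hxX
    by_cases hxw : w x = 1
    · exact Finset.mem_union_right _ (by simp [Z, hx, hxX, hxw])
    · have : ∃ i ≤ l, x = p i := by simpa using mt hw1.2 hxw
      obtain ⟨i, hi, rfl⟩ := this
      exact hp i hi
  have hE : ∀ {x y}, E x y → G.Adj x y ∧ ¬ pathArc p l y x ∧ x ∉ X ∧ lam y < lam x := by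
    rintro x _ ⟨hx, rfl⟩
    exact ⟨(hφ.rel x hx).1, (hφ.rel x hx).2, hx, hφ.lt x hx⟩
  have hTE : ∀ {x y}, T x → ReflTransGen E x y → ReflTransGen D' x y := by
    intro x y hx hxy
    induction hxy with
    | refl => exact .refl
    | tail hxz hzy ih => exact ih.tail (.inr (.inr ⟨hx.trans hxz, hzy⟩))
  have hPD : ∀ {i j}, i ≤ j → j ≤ l → ReflTransGen D' (p i) (p j) := fun {i j} hij hj =>
    ReflTransGen.mono (fun x y hxy => .inr (.inl hxy)) _ _ (reflTransGen p hij hj)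
  have hXD : ∀ x ∈ X, ∀ y ∈ X, ReflTransGen D' x y := fun x hx y hy =>
    ReflTransGen.mono (fun x y hxy => .inl hxy) _ _ (hD.strong x hx y hy)
  have hmem : ∀ {x}, x ∈ X' → x ∈ X ∨ (∃ i ≤ l, x = p i) ∨ T x := by
    intro x hx
    simp only [X', Finset.mem_union] at hx
    rcases hx with (hx | hx) | hx
    · exact .inl hx
    · obtain ⟨i, hi, rfl⟩ := Finset.mem_image.1 hx
      exact .inr (.inl ⟨i, (Finset.mem_Icc.1 hi).2, rfl⟩)
    · exact .inr (.inr (Finset.mem_filter.1 hx).2.1)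
  have hfrom : ∀ x ∈ X', ReflTransGen D' (p 0) x := by
    intro x hx
    rcases hmem hx with hx | ⟨i, hi, rfl⟩ | hx
    · exact hXD _ h.zero_mem _ hx
    · exact hPD (Nat.zero_le _) hi
    · exact (hPD (Nat.zero_le _) le_rfl).trans (hTE .refl hx)
  have hTto : ∀ x, T x → ReflTransGen D' x (p 0) := by
    intro x hx
    obtain ⟨y, hy, hxy⟩ := hφ.exists_mem_of_arc x
    exact (hTE hx hxy).trans (hXD y hy _ h.zero_mem)
  have hto : ∀ x ∈ X', ReflTransGen D' x (p 0) := by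
    intro x hx
    rcases hmem hx with hx | ⟨i, hi, rfl⟩ | hx
    · exact hXD _ hx _ h.zero_mem
    · exact (hPD hi le_rfl).trans (hTto _ .refl)
    · exact hTto x hx
  have hnotD : ∀ {x y}, pathArc p l x y → ¬ (x ∈ X ∧ y ∈ X) := by
    rintro x y ⟨i, hi, rfl, rfl⟩ ⟨-, hy⟩
    exact h.notMem (show i + 1 ≤ l from hi) (Nat.succ_ne_zero i) hy
  refine ⟨X', D', φ, ⟨?_, ?_, ?_, ?_, fun x hx y hy => (hto x hx).trans (hfrom y hy)⟩, hX, hp, ?_,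
    hφ.zero, ?_, ?_⟩
  · rintro x y (hxy | hxy | ⟨-, hxy⟩)
    · exact hD.adj x y hxy
    · exact h.adj_of_pathArc hxy
    · exact (hE hxy).1
  · rintro x y (hxy | ⟨i, hi, rfl, rfl⟩ | ⟨hx, -⟩)
    · exact hX (hD.left_mem x y hxy)
    · exact hp i hi.le
    · exact hT x hx
  · rintro x y (hxy | ⟨i, hi, rfl, rfl⟩ | ⟨hx, hxy⟩)
    · exact hX (hD.right_mem x y hxy)
    · exact hp (i + 1) hi
    · exact hT y (hx.tail hxy)
  · rintro x y (hxy | hxy | ⟨-, hxy⟩) (hyx | hyx | ⟨-, hyx⟩)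
    · exact hD.antisymm x y hxy hyx
    · exact hnotD hyx ⟨hD.right_mem x y hxy, hD.left_mem x y hxy⟩
    · exact (hE hyx).2.2.1 (hD.right_mem x y hxy)
    · exact hnotD hxy ⟨hD.right_mem y x hyx, hD.left_mem y x hyx⟩
    · exact h.not_pathArc_symm hG.1 hxy hyx
    · exact (hE hyx).2.1 hxy
    · exact (hE hxy).2.2.1 (hD.right_mem y x hyx)
    · exact (hE hxy).2.1 hyx
    · exact lt_asymm (hE hxy).2.2.2 (hE hyx).2.2.2
  · have h1 : Z.card ≤ φ (p l) := hφ.card_le (p l)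
    have h2 : Y.card ≤ l := Finset.card_image_le.trans (by simp)
    have h3 : X'.card ≤ (X ∪ Y).card + Z.card := Finset.card_union_le _ _
    have h4 : (X ∪ Y).card ≤ X.card + Y.card := Finset.card_union_le _ _
    omega
  · intro x y hxy _ hyx
    have h1 := hφ.le x y ⟨hxy, hyx⟩
    have h2 := hw x
    omega
  · intro t ht htl
    obtain ⟨z, hz, hzX, hzw, hzt⟩ := hφ.exists_eq hw ht _ htl
    exact ⟨z, hT z hz, hzX, hw1.1 hzw, hzt⟩

end IsEarPath

end EarPath

section Growth

variable {V : Type*} [Fintype V] {G : SimpleGraph V}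

/-- A nonempty strong part `X` together with a set `C ⊆ X` of centers that are pairwise at distance
at least `g` in a subgraph `K` of `G`; the degrees in `K` are at least `δ` up to the deficiency
`loss`, and the order of `X` is controlled by the number of centers. -/
structure IsPackedPart (G : SimpleGraph V) (δ g S : ℕ) (r : ℝ) (X C : Finset V)
    (D : V → V → Prop) (K : SimpleGraph V) (loss : V → ℕ) : Prop where
  strong : IsStrongPart G X D
  nonempty : X.Nonempty
  subset : C ⊆ X
  le : K ≤ G
  adj : ∀ x ∉ X, ∀ y, G.Adj x y → K.Adj x y
  degree_center : ∀ c ∈ C, δ ≤ nbrCard K c + loss c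
  degree : ∀ x, δ ≤ nbrCard K x + 2 + loss x
  separated : ∀ c ∈ C, ∀ c' ∈ C, c ≠ c' → ∀ w : K.Walk c c', g ≤ w.length
  card_le : ((X.card : ℝ) - 1) * (1 + δ * S) ≤
    r * (C.card * (1 + δ * S) - S * (∑ x, loss x : ℕ))

theorem nbrCard_mono {K K' : SimpleGraph V} {x : V} (h : ∀ y, K.Adj x y → K'.Adj x y) :
    nbrCard K x ≤ nbrCard K' x := by
  classical
  exact Finset.card_le_card (Finset.monotone_filter_right _ fun y _ => h y)

theorem nbrCard_le_add_card {K K' : SimpleGraph V} {x : V} {A : Finset V}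
    (h : ∀ y ∉ A, K.Adj x y → K'.Adj x y) : nbrCard K x ≤ nbrCard K' x + A.card := by
  classical
  refine (Finset.card_le_card (t := (Finset.univ.filter fun y => K'.Adj x y) ∪ A)
    fun y hy => ?_).trans (Finset.card_union_le _ _)
  by_cases hyA : y ∈ A
  · exact Finset.mem_union_right _ hyA
  · exact Finset.mem_union_left _ (by simpa using h y hyA (by simpa using hy))

theorem minDegree_le_nbrCard [DecidableRel G.Adj] (x : V) : G.minDegree ≤ nbrCard G x := by
  classical
  refine (G.minDegree_le_degree x).trans (le_of_eq ?_)
  rw [← card_neighborFinset_eq_degree, nbrCard]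
  congr 1
  ext y
  simp

theorem le_add_length {W : Type*} {K : SimpleGraph W} {φ : W → ℕ}
    (h : ∀ x y, K.Adj x y → φ x ≤ φ y + 1) {x y : W} (q : K.Walk x y) : φ x ≤ φ y + q.length := by
  induction q with
  | nil => simp
  | cons hxy q ih =>
    have := h _ _ hxy
    rw [Walk.length_cons]
    omega

namespace IsPackedPart

variable {δ g S L : ℕ} {r ε : ℝ} {X C : Finset V} {D : V → V → Prop} {K : SimpleGraph V}
  {loss : V → ℕ}

theorem singleton (v : V) (hdeg : ∀ x, δ ≤ nbrCard G x) (hr : 0 ≤ r) :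
    IsPackedPart G δ g S r {v} {v} (fun _ _ => False) G fun _ => 0 where
  strong := ⟨fun _ _ h => h.elim, fun _ _ h => h.elim, fun _ _ h => h.elim, fun _ _ h => h.elim,
    fun x hx y hy => by
      rw [Finset.mem_singleton.1 hx, Finset.mem_singleton.1 hy]⟩
  nonempty := Finset.singleton_nonempty v
  subset := subset_rfl
  le := le_rfl
  adj _ _ _ h := h
  degree_center c _ := hdeg c
  degree x := (hdeg x).trans (by omega)
  separated c hc c' hc' hne :=
    absurd ((Finset.mem_singleton.1 hc).trans (Finset.mem_singleton.1 hc').symm) hne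
  card_le := by
    simp only [Finset.card_singleton, Finset.sum_const_zero]
    push_cast
    rw [sub_self, zero_mul]
    exact mul_nonneg hr (by simp; positivity)

theorem degree_of_notMem (h : IsPackedPart G δ g S r X C D K loss)
    (hdeg : ∀ x, δ ≤ nbrCard G x) {x : V} (hx : x ∉ X) : δ ≤ nbrCard K x :=
  (hdeg x).trans (nbrCard_mono (h.adj x hx))

open Classical in
/-- If the way back is short, the new centers are taken along the ear path. -/
theorem extend_of_short (h : IsPackedPart G δ g S (2 * g + ε) X C D K loss)
    (hdeg : ∀ x, δ ≤ nbrCard G x) (hG : G.Connected) (hg : 1 ≤ g)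
    (hL : (g : ℝ) - 1 ≤ ε * L) {p : ℕ → V} (hp : IsEarPath G X p (L * g)) {X' : Finset V}
    {D' : V → V → Prop} (hD' : IsStrongPart G X' D') (hX : X ⊆ X')
    (hpX : ∀ i ≤ L * g, p i ∈ X') {m : ℕ} (hcard : X'.card ≤ X.card + L * g + m)
    (hm : m < L * g + g) :
    ∃ C', IsPackedPart G δ g S (2 * g + ε) X' C' D' K loss := by
  have hle : ∀ {j}, j ∈ Finset.Icc 1 L → j * g ≤ L * g := fun hj =>
    Nat.mul_le_mul_right g (Finset.mem_Icc.1 hj).2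
  have hpos : ∀ {j}, j ∈ Finset.Icc 1 L → g ≤ j * g := fun hj =>
    Nat.le_mul_of_pos_left g (Finset.mem_Icc.1 hj).1
  have hnot : ∀ {j}, j ∈ Finset.Icc 1 L → p (j * g) ∉ X := fun hj =>
    hp.notMem (hle hj) (by have := hpos hj; omega)
  let A : Finset V := (Finset.Icc 1 L).image fun j => p (j * g)
  have hA : A.card = L := by
    rw [Finset.card_image_of_injOn, Nat.card_Icc, Nat.add_sub_cancel]
    intro i hi j hj hij
    exact Nat.eq_of_mul_eq_mul_right hg (hp.injOn hG (hle hi) (hle hj) hij)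
  have hCA : Disjoint C A := by
    refine Finset.disjoint_left.2 fun x hx hxA => ?_
    obtain ⟨j, hj, rfl⟩ := Finset.mem_image.1 hxA
    exact hnot hj (h.subset hx)
  have hdist : ∀ {a b : V} (w : K.Walk a b), G.dist a b ≤ w.length := fun w => by
    simpa using dist_le (w.mapLe h.le)
  have hAC : ∀ c ∈ A, ∀ c' ∈ C, g ≤ G.dist c c' := by
    intro c hc c' hc'
    obtain ⟨j, hj, rfl⟩ := Finset.mem_image.1 hc
    exact (hpos hj).trans (hp.le_dist _ (hle hj) _ (h.subset hc'))
  have hAA : ∀ {i j}, i ∈ Finset.Icc 1 L → j ∈ Finset.Icc 1 L → i < j →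
      g ≤ G.dist (p (j * g)) (p (i * g)) := by
    intro i j hi hj hij
    have h1 := hp.le_dist_add hG (hle hi) (hle hj)
    have h2 : (i + 1) * g ≤ j * g := Nat.mul_le_mul_right g hij
    rw [add_mul, one_mul] at h2
    omega
  refine ⟨C ∪ A, hD', h.nonempty.mono hX, Finset.union_subset (h.subset.trans hX) fun x hx => ?_,
    h.le, fun x hx => h.adj x fun hx' => hx (hX hx'), fun c hc => ?_, h.degree, ?_, ?_⟩
  · obtain ⟨j, hj, rfl⟩ := Finset.mem_image.1 hx
    exact hpX _ (hle hj)
  · rcases Finset.mem_union.1 hc with hc | hc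
    · exact h.degree_center c hc
    · obtain ⟨j, hj, rfl⟩ := Finset.mem_image.1 hc
      exact (h.degree_of_notMem hdeg (hnot hj)).trans (Nat.le_add_right _ _)
  · intro c hc c' hc' hne w
    rcases Finset.mem_union.1 hc with hc | hc <;> rcases Finset.mem_union.1 hc' with hc' | hc'
    · exact h.separated c hc c' hc' hne w
    · have h1 := hAC c' hc' c hc
      rw [dist_comm] at h1
      exact h1.trans (hdist w)
    · exact (hAC c hc c' hc').trans (hdist w)
    · refine le_trans ?_ (hdist w)
      obtain ⟨i, hi, rfl⟩ := Finset.mem_image.1 hc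
      obtain ⟨j, hj, rfl⟩ := Finset.mem_image.1 hc'
      rcases lt_trichotomy i j with hij | rfl | hij
      · rw [dist_comm]
        exact hAA hi hj hij
      · exact absurd rfl hne
      · exact hAA hj hi hij
  · rw [Finset.card_union_of_disjoint hCA, hA]
    have h1 := h.card_le
    have h2 : (X'.card : ℝ) ≤ X.card + L * g + m := by exact_mod_cast hcard
    have h3 : (m : ℝ) + 1 ≤ L * g + g := by exact_mod_cast hm
    have h4 : (L : ℝ) * g + m ≤ (2 * g + ε) * L := by linarith
    have h5 : (0 : ℝ) ≤ 1 + δ * S := by positivity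
    have h6 := mul_le_mul_of_nonneg_right h4 h5
    have h7 := mul_le_mul_of_nonneg_right h2 h5
    push_cast at h1 ⊢
    linarith

open Classical in
/-- If the way back is long, the new centers are taken along it, and the edges of the ear path are
discarded. -/
theorem extend_of_long (h : IsPackedPart G δ g S (2 * g + ε) X C D K loss) (hε : 0 < ε)
    (hdeg : ∀ x, δ ≤ nbrCard G x) (hδ : 4 ≤ δ) (hg : 1 ≤ g)
    (hL : (g : ℝ) - 1 ≤ ε * L) {p : ℕ → V} (hp : IsEarPath G X p (L * g)) (hG : G.Connected)
    {X' : Finset V} {D' : V → V → Prop} (hD' : IsStrongPart G X' D') (hX : X ⊆ X')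
    (hpX : ∀ i ≤ L * g, p i ∈ X') {m : ℕ} (hcard : X'.card ≤ X.card + L * g + m)
    (hm : L * g + g ≤ m) {φ : V → ℕ} (hφ0 : ∀ x ∈ X, φ x = 0)
    (hφ : ∀ x y, G.Adj x y → ¬ pathArc p (L * g) x y → ¬ pathArc p (L * g) y x → φ x ≤ φ y + 1)
    (hlevel : ∀ t, 1 ≤ t → t ≤ m → ∃ z ∈ X', z ∉ X ∧ (∀ i ≤ L * g, z ≠ p i) ∧ φ z = t) :
    ∃ C' K' loss', IsPackedPart G δ g S (2 * g + ε) X' C' D' K' loss' := by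
  let N := m / g
  have hNm : N * g ≤ m := Nat.div_mul_le_self m g
  have hmN : m < N * g + g := Nat.lt_div_mul_add hg
  have hNL : L + 1 ≤ N := (Nat.le_div_iff_mul_le hg).2 (by rw [add_mul, one_mul]; exact hm)
  have hpos : ∀ {j}, j ∈ Finset.Icc 1 N → g ≤ j * g := fun hj =>
    Nat.le_mul_of_pos_left g (Finset.mem_Icc.1 hj).1
  have hc : ∀ j, ∃ z, j ∈ Finset.Icc 1 N → z ∈ X' ∧ z ∉ X ∧ (∀ i ≤ L * g, z ≠ p i) ∧
      φ z = j * g := by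
    intro j
    by_cases hj : j ∈ Finset.Icc 1 N
    · obtain ⟨z, hz⟩ := hlevel (j * g) (hg.trans (hpos hj))
        ((Nat.mul_le_mul_right g (Finset.mem_Icc.1 hj).2).trans hNm)
      exact ⟨z, fun _ => hz⟩
    · exact ⟨p 0, fun hj' => absurd hj' hj⟩
  choose c hc using hc
  let A : Finset V := (Finset.Icc 1 N).image c
  have hA : A.card = N := by
    rw [Finset.card_image_of_injOn, Nat.card_Icc, Nat.add_sub_cancel]
    intro i hi j hj hij
    have h1 := (hc i hi).2.2.2
    have h2 := (hc j hj).2.2.2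
    rw [hij, h2] at h1
    exact (Nat.eq_of_mul_eq_mul_right hg h1).symm
  have hCA : Disjoint C A := by
    refine Finset.disjoint_left.2 fun x hx hxA => ?_
    obtain ⟨j, hj, rfl⟩ := Finset.mem_image.1 hxA
    exact (hc j hj).2.1 (h.subset hx)
  let K' : SimpleGraph V :=
    { Adj := fun x y => K.Adj x y ∧ ¬ pathArc p (L * g) x y ∧ ¬ pathArc p (L * g) y x
      symm := ⟨fun x y hxy => ⟨hxy.1.symm, hxy.2.2, hxy.2.1⟩⟩
      loopless := ⟨fun x hx => K.loopless.irrefl x hx.1⟩ }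
  let loss' : V → ℕ := fun x => loss x + if x = p 0 then 1 else 0
  have hsum : ∑ x, loss' x = ∑ x, loss x + 1 := by
    simp [loss', Finset.sum_add_distrib]
  have hKK : K' ≤ K := fun x y hxy => hxy.1
  have hKeq : ∀ {x}, (∀ i ≤ L * g, x ≠ p i) → ∀ y, K.Adj x y → K'.Adj x y := by
    intro x hx y hxy
    refine ⟨hxy, ?_, ?_⟩
    · rintro ⟨i, hi, h1, -⟩
      exact hx i hi.le h1
    · rintro ⟨i, hi, -, h1⟩
      exact hx (i + 1) hi h1
  have hzero : nbrCard K (p 0) ≤ nbrCard K' (p 0) + 1 := by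
    have := nbrCard_le_add_card (K := K) (K' := K') (x := p 0) (A := {p 1}) fun y hy hxy => ?_
    · simpa using this
    · refine ⟨hxy, ?_, ?_⟩
      · rintro ⟨i, hi, h1, rfl⟩
        have := hp.injOn hG (Nat.zero_le _) hi.le h1
        subst this
        simp at hy
      · rintro ⟨i, hi, -, h1⟩
        have := hp.injOn hG (Nat.zero_le _) hi h1
        omega
  have hsucc : ∀ i, i + 1 ≤ L * g → nbrCard K (p (i + 1)) ≤ nbrCard K' (p (i + 1)) + 2 := by
    intro i hi
    have := nbrCard_le_add_card (K := K) (K' := K') (x := p (i + 1)) (A := {p i, p (i + 2)})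
      fun y hy hxy => ?_
    · exact this.trans (Nat.add_le_add_left Finset.card_le_two _)
    · refine ⟨hxy, ?_, ?_⟩
      · rintro ⟨j, hj, h1, rfl⟩
        have := hp.injOn hG hi hj.le h1
        subst this
        simp at hy
      · rintro ⟨j, hj, rfl, h1⟩
        have := hp.injOn hG hi hj h1
        rw [Nat.add_right_cancel this] at hy
        simp at hy
  have hold : ∀ x ∈ X, nbrCard K x + loss x ≤ nbrCard K' x + loss' x := by
    intro x hx
    by_cases hx0 : x = p 0
    · subst hx0
      simp only [loss', if_true]
      omega
    · have := nbrCard_mono (K := K) (K' := K') (x := x) (hKeq fun i hi hxi => ?_)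
      · exact Nat.add_le_add this (Nat.le_add_right _ _)
      · rcases Nat.eq_zero_or_pos i with rfl | hi0
        · exact hx0 hxi
        · exact hp.notMem hi hi0.ne' (hxi ▸ hx)
  have hCX : ∀ x ∈ C ∪ A, φ x = 0 ∨ ∃ j ∈ Finset.Icc 1 N, x = c j ∧ φ x = j * g := by
    intro x hx
    rcases Finset.mem_union.1 hx with hx | hx
    · exact .inl (hφ0 x (h.subset hx))
    · obtain ⟨j, hj, rfl⟩ := Finset.mem_image.1 hx
      exact .inr ⟨j, hj, rfl, (hc j hj).2.2.2⟩
  have hφK : ∀ x y, K'.Adj x y → φ x ≤ φ y + 1 := fun x y hxy =>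
    hφ x y (h.le hxy.1) hxy.2.1 hxy.2.2
  have hlen : ∀ {x y} (q : K'.Walk x y), φ x ≤ φ y + q.length ∧ φ y ≤ φ x + q.length := by
    intro x y q
    exact ⟨le_add_length hφK q, by simpa using le_add_length hφK q.reverse⟩
  refine ⟨C ∪ A, K', loss', hD', h.nonempty.mono hX,
    Finset.union_subset (h.subset.trans hX) fun x hx => ?_, hKK.trans h.le, fun x hx y hxy => ?_,
    fun x hx => ?_, fun x => ?_, ?_, ?_⟩
  · obtain ⟨j, hj, rfl⟩ := Finset.mem_image.1 hx
    exact (hc j hj).1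
  · exact hKeq (x := x) (fun i hi hxi => hx (hxi ▸ hpX i hi)) y
      (h.adj x (fun hx' => hx (hX hx')) y hxy)
  · rcases Finset.mem_union.1 hx with hx | hx
    · exact (h.degree_center x hx).trans (hold x (h.subset hx))
    · obtain ⟨j, hj, rfl⟩ := Finset.mem_image.1 hx
      have h1 := h.degree_of_notMem hdeg (hc j hj).2.1
      exact (h1.trans (nbrCard_mono (hKeq (hc j hj).2.2.1))).trans (Nat.le_add_right _ _)
  · by_cases hx : x ∈ X
    · have h1 := h.degree x
      have h2 := hold x hx
      omega
    · have h1 := h.degree_of_notMem hdeg hx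
      by_cases hxp : ∃ i ≤ L * g, x = p i
      · obtain ⟨i, hi, rfl⟩ := hxp
        rcases i with _ | i
        · exact absurd hp.zero_mem hx
        · have := hsucc i hi
          omega
      · push Not at hxp
        have := nbrCard_mono (K := K) (K' := K') (hKeq hxp)
        omega
  · intro x hx y hy hne q
    have hq := hlen q
    have key : ∀ {i j}, i < j → i * g + g ≤ j * g := fun {i j} hij => by
      have h2 : (i + 1) * g ≤ j * g := Nat.mul_le_mul_right g hij
      rwa [add_mul, one_mul] at h2
    by_cases hxC : x ∈ C ∧ y ∈ C
    · have := h.separated x hxC.1 y hxC.2 hne (q.mapLe hKK)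
      simpa using this
    rcases hCX x hx with hx0 | ⟨i, hi, rfl, hxi⟩ <;> rcases hCX y hy with hy0 | ⟨j, hj, rfl, hyj⟩
    · exfalso
      refine hxC ⟨(Finset.mem_union.1 hx).resolve_right fun hxA => ?_,
        (Finset.mem_union.1 hy).resolve_right fun hyA => ?_⟩
      · obtain ⟨j, hj, rfl⟩ := Finset.mem_image.1 hxA
        have h1 := (hc j hj).2.2.2
        have h2 := hpos hj
        omega
      · obtain ⟨j, hj, rfl⟩ := Finset.mem_image.1 hyA
        have h1 := (hc j hj).2.2.2
        have h2 := hpos hj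
        omega
    · have := hpos hj
      omega
    · have := hpos hi
      omega
    · rcases lt_trichotomy i j with hij | rfl | hij
      · have := key hij
        omega
      · exact absurd rfl hne
      · have := key hij
        omega
  · rw [Finset.card_union_of_disjoint hCA, hA, hsum]
    have h1 := h.card_le
    have h2 : (X'.card : ℝ) ≤ X.card + L * g + m := by exact_mod_cast hcard
    have h3 : (m : ℝ) + 1 ≤ N * g + g := by exact_mod_cast hmN
    have h4 : (L : ℝ) + 1 ≤ N := by exact_mod_cast hNL
    have h5 : (0 : ℝ) ≤ 1 + δ * S := by positivity
    have hδ' : (4 : ℝ) ≤ δ := by exact_mod_cast hδ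
    have hS : (0 : ℝ) ≤ S := S.cast_nonneg
    have h6 : (S : ℝ) ≤ (1 + δ * S) / 2 := by nlinarith
    have h7 : (L : ℝ) * g + m ≤ (2 * g + ε) * (N - 1 / 2) := by
      have hg0 : (0 : ℝ) ≤ g := g.cast_nonneg
      have h8 : ((L : ℝ) + 1) * g ≤ N * g := mul_le_mul_of_nonneg_right h4 hg0
      have h9 : ε * (L : ℝ) ≤ ε * (N - 1 / 2) :=
        mul_le_mul_of_nonneg_left (by linarith) hε.le
      linarith
    have h8 := mul_le_mul_of_nonneg_right h7 h5
    have h9 := mul_le_mul_of_nonneg_right h2 h5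
    have hr : (0 : ℝ) ≤ 2 * g + ε := by positivity
    have h10 := mul_le_mul_of_nonneg_left h6 hr
    push_cast at h1 ⊢
    linarith

theorem exists_extend (h : IsPackedPart G δ g S (2 * g + ε) X C D K loss) (hε : 0 < ε)
    (hdeg : ∀ x, δ ≤ nbrCard G x) (hδ : 4 ≤ δ) (hG : Bridgeless G) (hg : 1 ≤ g) (hL1 : 1 ≤ L)
    (hL : (g : ℝ) - 1 ≤ ε * L) {v : V} (hv : ∀ x ∈ X, L * g ≤ G.dist v x) :
    ∃ X' C' D' K' loss', X.card < X'.card ∧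
      IsPackedPart G δ g S (2 * g + ε) X' C' D' K' loss' := by
  obtain ⟨p, hp⟩ := exists_isEarPath hG.1 h.nonempty hv
  obtain ⟨X', D', φ, hD', hX, hpX, hcard, hφ0, hφ, hlevel⟩ := hp.exists_isStrongPart hG h.strong
  have hLg : 1 ≤ L * g := Nat.mul_pos hL1 hg
  have hlt : X.card < X'.card := Finset.card_lt_card
    (Finset.ssubset_iff_of_subset hX |>.2 ⟨p 1, hpX 1 hLg, hp.notMem hLg one_ne_zero⟩)
  rcases lt_or_ge (φ (p (L * g))) (L * g + g) with hm | hm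
  · obtain ⟨C', h'⟩ := h.extend_of_short hdeg hG.1 hg hL hp hD' hX hpX hcard hm
    exact ⟨X', C', D', K, loss, hlt, h'⟩
  · obtain ⟨C', K', loss', h'⟩ := h.extend_of_long hε hdeg hδ hg hL hp hG.1 hD' hX hpX hcard hm hφ0
      hφ hlevel
    exact ⟨X', C', D', K', loss', hlt, h'⟩

/-- A packed part of maximal order comes close to every vertex. -/
theorem exists_dominating (hε : 0 < ε) (hdeg : ∀ x, δ ≤ nbrCard G x) (hδ : 4 ≤ δ)
    (hG : Bridgeless G) (hg : 1 ≤ g) (hL1 : 1 ≤ L) (hL : (g : ℝ) - 1 ≤ ε * L) (S : ℕ) :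
    ∃ X C D K loss, IsPackedPart G δ g S (2 * g + ε) X C D K loss ∧
      ∀ v, ∃ x ∈ X, G.dist v x < L * g := by
  classical
  let P : ℕ → Prop := fun n => ∃ X C D K loss, X.card = n ∧
    IsPackedPart G δ g S (2 * g + ε) X C D K loss
  have hbound : ∀ n, P n → n ≤ Fintype.card V := by
    rintro _ ⟨X, _, _, _, _, rfl, _⟩
    exact X.card_le_univ
  have hr : (0 : ℝ) ≤ 2 * g + ε := by positivity
  have h1 : P 1 := ⟨{hG.1.nonempty.some}, _, _, _, _, Finset.card_singleton _, singleton _ hdeg hr⟩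
  obtain ⟨X, C, D, K, loss, hX, h⟩ := Nat.findGreatest_spec (hbound 1 h1) h1
  refine ⟨X, C, D, K, loss, h, ?_⟩
  by_contra! hv
  obtain ⟨v, hv⟩ := hv
  obtain ⟨X', C', D', K', loss', hlt, h'⟩ := h.exists_extend hε hdeg hδ hG hg hL1 hL hv
  have hP : P X'.card := ⟨X', C', D', K', loss', rfl, h'⟩
  have := Nat.le_findGreatest (hbound _ hP) hP
  omega

theorem card_sub_one_mul_le (h : IsPackedPart G δ g (∑ i ∈ Finset.range ((g - 1) / 2), (δ - 3) ^ i)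
    r X C D K loss) (hr : 0 ≤ r) (hδ : 4 ≤ δ) (hg : (g : ℕ∞) ≤ G.egirth) (hg3 : 3 ≤ g) :
    ((X.card : ℝ) - 1) * hPoly δ g ≤ r * Fintype.card V := by
  have h1 := card_mul_le_card_add (hg.trans (egirth_anti h.le)) hδ h.degree_center h.degree
    h.separated ((g - 1) / 2) (by omega)
  have h2 := h.card_le
  rw [hPoly_eq hg3]
  generalize ∑ i ∈ Finset.range ((g - 1) / 2), (δ - 3) ^ i = S at *
  have h3 : (C.card : ℝ) * (1 + δ * S) ≤ Fintype.card V + S * (∑ x, loss x : ℕ) := by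
    exact_mod_cast h1
  rw [Nat.cast_add, Nat.cast_one, Nat.cast_mul]
  exact h2.trans (mul_le_mul_of_nonneg_left (by linarith) hr)

end IsPackedPart

end Growth

/-- For a bridgeless graph `G` of order `n`, minimum degree `δ ≥ 4` and girth
`g`, and any `ε > 0`, with `L = ⌈(g-1)/ε⌉`, there is a bridgeless subgraph `H` of `G` such that
every vertex of `G` is at distance less than `L·g` from `V(H)`, and `H` admits a strong
orientation of diameter at most `(2g+ε)·n/h(δ,g)`. -/
theorem exists_bridgeless_subgraph_small_oriented_diameter
    {V : Type*} [Fintype V] (G : SimpleGraph V) [DecidableRel G.Adj]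
    (n δ g : ℕ) (hn : Fintype.card V = n)
    (hG : Bridgeless G) (hδ : G.minDegree = δ) (hδ4 : 4 ≤ δ)
    (hg : G.egirth = (g : ℕ∞)) (ε : ℝ) (hε : 0 < ε) :
    ∃ H : G.Subgraph,
      Bridgeless H.coe ∧
      (∀ v : V, ∃ u ∈ H.verts, G.dist v u < ⌈((g : ℝ) - 1) / ε⌉₊ * g) ∧
      ∃ D : ↥H.verts → ↥H.verts → Prop, IsOrientation H.coe D ∧
        ∀ u v : ↥H.verts, ∃ m : ℕ,
          (m : ℝ) ≤ (2 * g + ε) * n / hPoly δ g ∧ DiReach D u v m := by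
  have hg3 : 3 ≤ g := by
    have := G.three_le_egirth
    rw [hg] at this
    exact_mod_cast this
  have hg3' : (3 : ℝ) ≤ g := by exact_mod_cast hg3
  have hL1 : 1 ≤ ⌈((g : ℝ) - 1) / ε⌉₊ := Nat.ceil_pos.2 (div_pos (by linarith) hε)
  have hL : (g : ℝ) - 1 ≤ ε * ⌈((g : ℝ) - 1) / ε⌉₊ := by
    rw [mul_comm, ← div_le_iff₀ hε]
    exact Nat.le_ceil _
  have hdeg : ∀ x, δ ≤ nbrCard G x := fun x => hδ ▸ minDegree_le_nbrCard x
  obtain ⟨X, C, D, K, loss, h, hdom⟩ := IsPackedPart.exists_dominating hε hdeg hδ4 hG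
    (by omega) hL1 hL (∑ i ∈ Finset.range ((g - 1) / 2), (δ - 3) ^ i)
  obtain ⟨H, hH, hbr, E, hE, hreach⟩ := h.strong.exists_subgraph h.nonempty
  refine ⟨H, hbr, fun v => ?_, E, hE, fun u v => ?_⟩
  · obtain ⟨x, hx, hvx⟩ := hdom v
    exact ⟨x, hH ▸ hx, hvx⟩
  · obtain ⟨m, hm, hr⟩ := hreach u v
    refine ⟨m, ?_, hr⟩
    have hpos : (0 : ℝ) < hPoly δ g := by
      rw [hPoly_eq hg3]
      positivity
    have h1 := h.card_sub_one_mul_le (by positivity) hδ4 hg.ge hg3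
    have h2 : (m : ℝ) + 1 ≤ X.card := by exact_mod_cast hm
    rw [le_div_iff₀ hpos, ← hn]
    exact (mul_le_mul_of_nonneg_right (by linarith) hpos.le).trans h1
end
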